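/- Let Ξ ⊆ Ω be a prediction set satisfying Assumption A. For λ ≥ 0, let 𝒢^Ξ_λ be the liminf-closure of { λ + (H·S)_T : H ∈ ℋ and λ + (H·S)_t ≥ 0 on Ξ for all t ∈ [0,T] }, i.e. the smallest set of functions X : C[0,T] → [−∞,∞] containing these payoffs and such that liminf_n X_n ∈ 𝒢^Ξ_λ whenever X_n ∈ 𝒢^Ξ_λ for every n. Define Φ^cl(ξ) := inf{ λ ∈ ℝ : there is Y ∈ 𝒢^Ξ_λ with Y ≥ ξ on Ξ }. Then for every Borel measurable function ξ : C[0,T] → [0,∞] one has Φ^cl(ξ) = sup_{Q ∈ M(Ξ)} E_Q[ξ]. -/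

import Mathlib

open MeasureTheory Filter Set Topology
open scoped ENNReal Classical

noncomputable section

namespace PathwiseSuperhedging

/-- The path space `C[0,T]`: continuous functions on `[0,T]` with the sup-norm. -/
abbrev Path (T : ℝ) := C(Set.Icc (0:ℝ) T, ℝ)

variable (T : ℝ)

instance : MeasurableSpace (Path T) := borel _
instance : BorelSpace (Path T) := ⟨rfl⟩

variable (hT : 0 ≤ T)

/-- time `0` as an element of `[0,T]`. -/
def t0 : Set.Icc (0:ℝ) T := ⟨0, le_refl 0, hT⟩

/-- clamp a real time into `[0,T]`. -/
def clamp (t : ℝ) : Set.Icc (0:ℝ) T := Set.projIcc 0 T hT t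

/-- evaluation of a path at a (clamped) real time. -/
def ev (ω : Path T) (t : ℝ) : ℝ := ω (clamp T hT t)

/-- The stopping times `σ^m_k`:  `σ^m_0 = 0` and
`σ^m_{k+1} = inf { t ≥ σ^m_k : |S_t - S_{σ^m_k}| ≥ 2^{-m} }` (equal to `T+1` if no such
time `t ≤ T` exists). -/
def sig (m : ℕ) : ℕ → Path T → ℝ
  | 0 => fun _ => 0
  | k + 1 => fun ω =>
      sInf ({t : ℝ | sig m k ω ≤ t ∧ t ≤ T ∧
        (2:ℝ) ^ (-(m:ℤ)) ≤ |ev T hT ω t - ev T hT ω (sig m k ω)|} ∪ {T + 1})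

/-- The discretized integral `𝕊^m_t = ∑_k S_{σ^m_k} (S_{σ^m_{k+1} ∧ t} - S_{σ^m_k ∧ t})`. -/
def Sm (m : ℕ) (t : ℝ) (ω : Path T) : ℝ :=
  ∑' k : ℕ, ev T hT ω (sig T hT m k ω) *
    (ev T hT ω (min (sig T hT m (k + 1) ω) t) - ev T hT ω (min (sig T hT m k ω) t))

/-- The pathwise integral `𝕊_t = liminf_m 𝕊^m_t`. -/
def SS (t : ℝ) (ω : Path T) : ℝ := Filter.liminf (fun m => Sm T hT m t ω) Filter.atTop

/-- The candidate quadratic variation `S_t² - S_0² - 2 𝕊_t`. -/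
def qvRaw (ω : Path T) (t : ℝ) : ℝ := (ev T hT ω t) ^ 2 - (ev T hT ω 0) ^ 2 - 2 * SS T hT t ω

/-- The set `Ω` of paths for which `𝕊^m → 𝕊` uniformly and
`t ↦ S_t² - S_0² - 2𝕊_t` is nondecreasing. -/
def BigOmega : Set (Path T) :=
  {ω | TendstoUniformly (fun m (t : Set.Icc (0:ℝ) T) => Sm T hT m (t : ℝ) ω)
        (fun t => SS T hT (t : ℝ) ω) Filter.atTop ∧
      MonotoneOn (qvRaw T hT ω) (Set.Icc (0:ℝ) T)}

/-- The pathwise quadratic variation `⟨ω⟩`, as an element of `C[0,T]`; it equals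
`S² - S_0² - 2𝕊` for `ω ∈ Ω` (this function being continuous there) and `0` otherwise. -/
def qv (ω : Path T) : Path T :=
  if h : ω ∈ BigOmega T hT ∧ Continuous fun t : Set.Icc (0:ℝ) T => qvRaw T hT ω (t : ℝ)
  then ⟨fun t => qvRaw T hT ω (t : ℝ), h.2⟩ else 0

/-- The raw filtration `F_t = σ(S_s : s ≤ t)` generated by the canonical process. -/
def Fraw (t : ℝ) : MeasurableSpace (Path T) :=
  ⨆ (s : Set.Icc (0:ℝ) T) (_ : (s : ℝ) ≤ t),
    MeasurableSpace.comap (fun ω : Path T => ω s) inferInstance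

/-- The right-continuous filtration `F_{t+} = ⋂_{s > t} F_{s ∧ T}`. -/
def Fplus (t : ℝ) : MeasurableSpace (Path T) :=
  ⨅ (s : ℝ) (_ : t < s), Fraw T (min s T)

/-- `τ` is a stopping time for the raw filtration `𝔽`. -/
def IsStopRaw (τ : Path T → ℝ) : Prop :=
  ∀ t ∈ Set.Icc (0:ℝ) T, MeasurableSet[Fraw T t] {ω | τ ω ≤ t}

/-- `τ` is a stopping time for the right-continuous filtration `𝔽₊`. -/
def IsStopPlus (τ : Path T → ℝ) : Prop :=
  ∀ t ∈ Set.Icc (0:ℝ) T, MeasurableSet[Fplus T t] {ω | τ ω ≤ t}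

/-- `f` is measurable with respect to the σ-field `F_{τ+}`. -/
def MeasAtStopPlus (τ f : Path T → ℝ) : Prop :=
  ∀ B : Set ℝ, MeasurableSet B → ∀ t ∈ Set.Icc (0:ℝ) T,
    MeasurableSet[Fplus T t] (f ⁻¹' B ∩ {ω | τ ω ≤ t})

/-- The set `ℋ` of simple trading strategies `H = ∑_{l=1}^L h_l 1_{(τ_l, τ_{l+1}]}`
with `𝔽₊`-stopping times `0 ≤ τ_1 ≤ ⋯ ≤ τ_{L+1} ≤ T` and bounded `F_{τ_l+}`-measurable
coefficients `h_l`. -/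
structure SimpleStrategy where
  L : ℕ
  τ : Fin (L + 1) → Path T → ℝ
  coeff : Fin L → Path T → ℝ
  τ_nonneg : ∀ ω, 0 ≤ τ 0 ω
  τ_mono : ∀ (l : Fin L) (ω), τ l.castSucc ω ≤ τ l.succ ω
  τ_le : ∀ ω, τ (Fin.last L) ω ≤ T
  τ_stop : ∀ l, IsStopPlus T (τ l)
  coeff_bdd : ∀ l, ∃ C : ℝ, ∀ ω, |coeff l ω| ≤ C
  coeff_meas : ∀ l : Fin L, MeasAtStopPlus T (τ l.castSucc) (coeff l)

/-- The pathwise stochastic integral `(H · X)_t(ω)` of a simple strategy against a process. -/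
def integ (H : SimpleStrategy T) (X : ℝ → Path T → ℝ) (t : ℝ) (ω : Path T) : ℝ :=
  ∑ l : Fin H.L, H.coeff l ω *
    (X (min (H.τ l.succ ω) t) ω - X (min (H.τ l.castSucc ω) t) ω)

/-- The canonical process `S_t(ω) = ω(t)`. -/
def Sproc (t : ℝ) (ω : Path T) : ℝ := ev T hT ω t

/-- `X` is a `Q`-`𝔽`-martingale (on the time interval `[0,T]`). -/
def IsMart (Q : Measure (Path T)) (X : ℝ → Path T → ℝ) : Prop :=
  (∀ t ∈ Set.Icc (0:ℝ) T, Integrable (X t) Q) ∧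
  ∀ s t : ℝ, s ∈ Set.Icc (0:ℝ) T → t ∈ Set.Icc (0:ℝ) T → s ≤ t →
    ∀ A : Set (Path T), MeasurableSet[Fraw T s] A →
      ∫ ω in A, X t ω ∂Q = ∫ ω in A, X s ω ∂Q

/-- `X` is a `Q`-`𝔽`-local martingale: there are `𝔽`-stopping times increasing `Q`-a.s.
to `∞` such that each stopped process is a `Q`-`𝔽`-martingale. -/
def IsLocalMart (Q : Measure (Path T)) (X : ℝ → Path T → ℝ) : Prop :=
  ∃ τ : ℕ → Path T → ℝ,
    (∀ m, IsStopRaw T (τ m)) ∧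
    (∀ᵐ ω ∂Q, Monotone (fun m => τ m ω) ∧ Tendsto (fun m => τ m ω) atTop atTop) ∧
    (∀ m, IsMart T Q (fun t ω => X (min (τ m ω) t) ω))

/-- The set `M(Ξ)` of local martingale measures concentrated on `Ξ`. -/
def MSet (Ξ : Set (Path T)) : Set (Measure (Path T)) :=
  {Q | IsProbabilityMeasure Q ∧ IsLocalMart T Q (Sproc T hT) ∧ Q Ξ = 1}

/-- The set `M_Z(Ξ)` of local martingale measures concentrated on `Ξ` with `E_Q[Z] < ∞`. -/
def MZSet (Ξ : Set (Path T)) (Z : Path T → ℝ≥0∞) : Set (Measure (Path T)) :=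
  {Q | IsProbabilityMeasure Q ∧ IsLocalMart T Q (Sproc T hT) ∧ Q Ξ = 1 ∧
       ∫⁻ ω, Z ω ∂Q ≠ ⊤}

/-- The stopped path `ω^t(s) = ω(t ∧ s)`. -/
def stopPath (ω : Path T) (t : Set.Icc (0:ℝ) T) : Path T :=
  ⟨fun s => ω ⟨min t.1 s.1, le_min t.2.1 s.2.1, (min_le_left _ _).trans t.2.2⟩,
    ω.continuous.comp ((continuous_const.min continuous_subtype_val).subtype_mk _)⟩

/-- Assumption A on the prediction set `Ξ` and its lift `Ξ̄`. -/
structure AssumptionA (Ξ : Set (Path T)) (Xibar : Set (Path T × Path T)) : Prop where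
  xi_nonempty : Ξ.Nonempty
  xibar_nonempty : Xibar.Nonempty
  xi_eq : Ξ = {ω ∈ BigOmega T hT | (ω, qv T hT ω) ∈ Xibar}
  A1 : ∃ K : ℕ → Set (Path T × Path T), (∀ n, IsCompact (K n)) ∧ Xibar = ⋃ n, K n
  A2 : ∀ p ∈ Xibar, p.2 (t0 T hT) = 0 ∧ Monotone p.2
  A3 : ∀ p ∈ Xibar, ∀ t : Set.Icc (0:ℝ) T, (stopPath T p.1 t, stopPath T p.2 t) ∈ Xibar

/-! ### The enlarged space -/

/-- The enlarged space `Ω̄ = C[0,T] × C[0,T]`. -/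
abbrev PathPair (T : ℝ) := Path T × Path T

/-- The embedding `ψ(ω) = (ω, ⟨ω⟩)`. -/
def psiMap (ω : Path T) : PathPair T := (ω, qv T hT ω)

/-- The diagonal set `Δ̄ = ψ(Ω)`. -/
def Delta : Set (PathPair T) := psiMap T hT '' BigOmega T hT

/-- The first canonical process `S̄_t(ω,ν) = ω(t)` on the enlarged space. -/
def SbarProc (t : ℝ) (p : PathPair T) : ℝ := ev T hT p.1 t

/-- The second canonical process `V̄_t(ω,ν) = ν(t)` on the enlarged space. -/
def VbarProc (t : ℝ) (p : PathPair T) : ℝ := ev T hT p.2 t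

/-- The process `𝕊̄ = (S̄² - S̄_0² - V̄)/2` on the enlarged space. -/
def SSbarProc (t : ℝ) (p : PathPair T) : ℝ :=
  ((ev T hT p.1 t) ^ 2 - (ev T hT p.1 0) ^ 2 - ev T hT p.2 t) / 2

/-- The raw filtration `F̄_t = σ(S̄_s, V̄_s : s ≤ t)` on the enlarged space. -/
def FbarRaw (t : ℝ) : MeasurableSpace (PathPair T) :=
  ⨆ (s : Set.Icc (0:ℝ) T) (_ : (s : ℝ) ≤ t),
    MeasurableSpace.comap (fun p : PathPair T => (p.1 s, p.2 s)) inferInstance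

/-- The right-continuous filtration `F̄_{t+} = ⋂_{s>t} F̄_{s ∧ T}` on the enlarged space. -/
def FbarPlus (t : ℝ) : MeasurableSpace (PathPair T) :=
  ⨅ (s : ℝ) (_ : t < s), FbarRaw T (min s T)

/-- The σ-field generated by all subsets of `Δ̄ᶜ`. -/
def nullDelta : MeasurableSpace (PathPair T) :=
  MeasurableSpace.generateFrom {N : Set (PathPair T) | N ⊆ (Delta T hT)ᶜ}

/-- The `Δ̄`-augmented raw filtration `F̄^Δ_t`. -/
def FbarDelta (t : ℝ) : MeasurableSpace (PathPair T) := FbarRaw T t ⊔ nullDelta T hT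

/-- The `Δ̄`-augmented right-continuous filtration `F̄^Δ_{t+}`. -/
def FbarDeltaPlus (t : ℝ) : MeasurableSpace (PathPair T) := FbarPlus T t ⊔ nullDelta T hT

/-- `τ` is a stopping time for the raw filtration `𝔽̄` on the enlarged space. -/
def IsStopBarRaw (τ : PathPair T → ℝ) : Prop :=
  ∀ t ∈ Set.Icc (0:ℝ) T, MeasurableSet[FbarRaw T t] {p | τ p ≤ t}

/-- `τ` is a stopping time for the filtration `𝔽̄₊^Δ`. -/
def IsStopBarDeltaPlus (τ : PathPair T → ℝ) : Prop :=
  ∀ t ∈ Set.Icc (0:ℝ) T, MeasurableSet[FbarDeltaPlus T hT t] {p | τ p ≤ t}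

/-- `f` is measurable with respect to `F̄^Δ_{τ+}`. -/
def MeasAtStopBarDeltaPlus (τ f : PathPair T → ℝ) : Prop :=
  ∀ B : Set ℝ, MeasurableSet B → ∀ t ∈ Set.Icc (0:ℝ) T,
    MeasurableSet[FbarDeltaPlus T hT t] (f ⁻¹' B ∩ {p | τ p ≤ t})

/-- The set `ℋ̄` of simple strategies on the enlarged space. -/
structure SimpleStrategyBar where
  L : ℕ
  τ : Fin (L + 1) → PathPair T → ℝ
  coeff : Fin L → PathPair T → ℝ
  τ_nonneg : ∀ p, 0 ≤ τ 0 p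
  τ_mono : ∀ (l : Fin L) (p), τ l.castSucc p ≤ τ l.succ p
  τ_le : ∀ p, τ (Fin.last L) p ≤ T
  τ_stop : ∀ l, IsStopBarDeltaPlus T hT (τ l)
  coeff_bdd : ∀ l, ∃ C : ℝ, ∀ p, |coeff l p| ≤ C
  coeff_meas : ∀ l : Fin L, MeasAtStopBarDeltaPlus T hT (τ l.castSucc) (coeff l)

/-- The pathwise stochastic integral on the enlarged space. -/
def integBar (H : SimpleStrategyBar T hT) (X : ℝ → PathPair T → ℝ) (t : ℝ)
    (p : PathPair T) : ℝ :=
  ∑ l : Fin H.L, H.coeff l p *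
    (X (min (H.τ l.succ p) t) p - X (min (H.τ l.castSucc p) t) p)

/-- `X` is a `Q̄`-`𝔽̄`-martingale on the enlarged space. -/
def IsMartBar (Q : Measure (PathPair T)) (X : ℝ → PathPair T → ℝ) : Prop :=
  (∀ t ∈ Set.Icc (0:ℝ) T, Integrable (X t) Q) ∧
  ∀ s t : ℝ, s ∈ Set.Icc (0:ℝ) T → t ∈ Set.Icc (0:ℝ) T → s ≤ t →
    ∀ A : Set (PathPair T), MeasurableSet[FbarRaw T s] A →
      ∫ p in A, X t p ∂Q = ∫ p in A, X s p ∂Q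

/-- `X` is a `Q̄`-`𝔽̄`-local martingale on the enlarged space. -/
def IsLocalMartBar (Q : Measure (PathPair T)) (X : ℝ → PathPair T → ℝ) : Prop :=
  ∃ τ : ℕ → PathPair T → ℝ,
    (∀ m, IsStopBarRaw T (τ m)) ∧
    (∀ᵐ p ∂Q, Monotone (fun m => τ m p) ∧ Tendsto (fun m => τ m p) atTop atTop) ∧
    (∀ m, IsMartBar T Q (fun t p => X (min (τ m p) t) p))

/-- The set `M̄(Ξ̄)` of measures on the enlarged space under which `S̄` and `𝕊̄` are local
martingales and which are concentrated on `Ξ̄`. -/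
def MbarSet (Xibar : Set (PathPair T)) : Set (Measure (PathPair T)) :=
  {Q | IsProbabilityMeasure Q ∧ IsLocalMartBar T Q (SbarProc T hT) ∧
       IsLocalMartBar T Q (SSbarProc T hT) ∧ Q Xibar = 1}

/-- The set `M̄_{Z̄}(Ξ̄)`. -/
def MbarZSet (Xibar : Set (PathPair T)) (Zbar : PathPair T → ℝ≥0∞) :
    Set (Measure (PathPair T)) :=
  {Q | IsProbabilityMeasure Q ∧ IsLocalMartBar T Q (SbarProc T hT) ∧
       IsLocalMartBar T Q (SSbarProc T hT) ∧ Q Xibar = 1 ∧ ∫⁻ p, Zbar p ∂Q ≠ ⊤}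

/-! ### Expectations and superhedging functionals -/

/-- The positive part of an extended real number, as an element of `[0,∞]`. -/
def erealPos (x : EReal) : ℝ≥0∞ := if x = ⊤ then ⊤ else ENNReal.ofReal x.toReal

/-- The expectation `E_Q[ξ]` of an extended-real-valued random variable, as an
extended real number (positive part minus negative part). -/
def expEReal {α : Type*} [MeasurableSpace α] (Q : Measure α) (ξ : α → EReal) : EReal :=
  ((∫⁻ x, erealPos (ξ x) ∂Q : ℝ≥0∞) : EReal) - ((∫⁻ x, erealPos (-ξ x) ∂Q : ℝ≥0∞) : EReal)

/-- The set of initial capitals `λ` that allow superhedging `ξ` on `Ξ`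
(trading in `S` and `𝕊` with simple strategies, in the liminf sense). -/
def PhiSet (Ξ : Set (Path T)) (ξ : Path T → EReal) : Set ℝ :=
  {lam : ℝ | ∃ H G : ℕ → SimpleStrategy T,
    (∀ n : ℕ, ∀ t ∈ Set.Icc (0:ℝ) T, ∀ ω ∈ Ξ,
      0 ≤ lam + integ T (H n) (Sproc T hT) t ω + integ T (G n) (SS T hT) t ω) ∧
    (∀ ω ∈ Ξ, ξ ω ≤ (lam : EReal) +
      Filter.liminf (fun n =>
        ((integ T (H n) (Sproc T hT) T ω + integ T (G n) (SS T hT) T ω : ℝ) : EReal))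
        Filter.atTop)}

/-- The superhedging price `Φ(ξ)`. -/
def Phi (Ξ : Set (Path T)) (ξ : Path T → EReal) : EReal :=
  sInf ((fun lam : ℝ => (lam : EReal)) '' PhiSet T hT Ξ ξ)

/-- The supremum of the pricing functionals `E_Q[ξ]` over `Q ∈ M(Ξ)`,
for a nonnegative claim `ξ`. -/
def supMart (Ξ : Set (Path T)) (ξ : Path T → ℝ≥0∞) : ℝ≥0∞ :=
  ⨆ Q ∈ MSet T hT Ξ, ∫⁻ ω, ξ ω ∂Q

/-- The liminf-closure `𝒢^Ξ_λ`: the smallest set of functions `C[0,T] → [-∞,∞]`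
containing `λ + (H·S)_T` for admissible simple `H` and closed under countable liminf. -/
inductive GG (Ξ : Set (Path T)) (lam : ℝ) : (Path T → EReal) → Prop
  | base (H : SimpleStrategy T)
      (hadm : ∀ t ∈ Set.Icc (0:ℝ) T, ∀ ω ∈ Ξ, 0 ≤ lam + integ T H (Sproc T hT) t ω) :
      GG Ξ lam (fun ω => ((lam + integ T H (Sproc T hT) T ω : ℝ) : EReal))
  | lim (X : ℕ → Path T → EReal) (h : ∀ n, GG Ξ lam (X n)) :
      GG Ξ lam (fun ω => Filter.liminf (fun n => X n ω) Filter.atTop)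

/-- The superhedging price `Φ^cl(ξ)` defined via the liminf-closure. -/
def PhiCl (Ξ : Set (Path T)) (ξ : Path T → EReal) : EReal :=
  sInf {x : EReal | ∃ lam : ℝ, x = (lam : EReal) ∧
    ∃ Y : Path T → EReal, GG T hT Ξ lam Y ∧ ∀ ω ∈ Ξ, ξ ω ≤ Y ω}


/-- The set of initial capitals allowing superhedging on the enlarged space
(superhedging on `Δ̄ ∩ Ξ̄`). -/
def PhiBarSet (Xibar : Set (PathPair T)) (ξ : PathPair T → EReal) : Set ℝ :=
  {lam : ℝ | ∃ H G : ℕ → SimpleStrategyBar T hT,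
    (∀ n : ℕ, ∀ t ∈ Set.Icc (0:ℝ) T, ∀ p ∈ Delta T hT ∩ Xibar,
      0 ≤ lam + integBar T hT (H n) (SbarProc T hT) t p
            + integBar T hT (G n) (SSbarProc T hT) t p) ∧
    (∀ p ∈ Delta T hT ∩ Xibar, ξ p ≤ (lam : EReal) +
      Filter.liminf (fun n =>
        ((integBar T hT (H n) (SbarProc T hT) T p
          + integBar T hT (G n) (SSbarProc T hT) T p : ℝ) : EReal)) Filter.atTop)}

/-- The superhedging price `Φ̄(ξ̄)` on the enlarged space. -/
def PhiBar (Xibar : Set (PathPair T)) (ξ : PathPair T → EReal) : EReal :=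
  sInf ((fun lam : ℝ => (lam : EReal)) '' PhiBarSet T hT Xibar ξ)

/-- The supremum of pricing functionals over `M̄(Ξ̄)` for a nonnegative claim. -/
def supMartBar (Xibar : Set (PathPair T)) (ξ : PathPair T → ℝ≥0∞) : ℝ≥0∞ :=
  ⨆ Q ∈ MbarSet T hT Xibar, ∫⁻ p, ξ p ∂Q

/-- Assumption B on the prediction set `Ξ`, determined by a growth function `Z̄`
(with values in `[1,∞]`). -/
structure AssumptionB (Ξ : Set (Path T)) (Zbar : PathPair T → ℝ≥0∞) : Prop where
  xi_nonempty : Ξ.Nonempty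
  one_le : ∀ p, 1 ≤ Zbar p
  xi_eq : Ξ = {ω ∈ BigOmega T hT | Zbar (ω, qv T hT ω) ≠ ⊤}
  B1 : ∀ c : ℝ≥0∞, c ≠ ⊤ → IsCompact {p : PathPair T | Zbar p ≤ c}
  B2 : ∀ p : PathPair T, Zbar p ≠ ⊤ → p.2 (t0 T hT) = 0 ∧ Monotone p.2
  B3 : ∀ p : PathPair T, ENNReal.ofReal (‖p.1‖ + ‖p.2‖) ≤ Zbar p

/-- The set of initial capitals allowing `Z`-admissible superhedging of `ξ` on `Ξ`. -/
def PhiZSet (Ξ : Set (Path T)) (Z : Path T → ℝ≥0∞) (ξ : Path T → EReal) : Set ℝ :=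
  {lam : ℝ | ∃ c : ℝ, 0 ≤ c ∧ ∃ H G : ℕ → SimpleStrategy T,
    (∀ n : ℕ, ∀ ω ∈ Ξ,
      -(c * (Z ω).toReal) ≤
        lam + integ T (H n) (Sproc T hT) T ω + integ T (G n) (SS T hT) T ω) ∧
    (∀ ω ∈ Ξ, ξ ω ≤ (lam : EReal) +
      Filter.liminf (fun n =>
        ((integ T (H n) (Sproc T hT) T ω + integ T (G n) (SS T hT) T ω : ℝ) : EReal))
        Filter.atTop)}

/-- The superhedging price `Φ^Z(ξ)`. -/
def PhiZ (Ξ : Set (Path T)) (Z : Path T → ℝ≥0∞) (ξ : Path T → EReal) : EReal :=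
  sInf ((fun lam : ℝ => (lam : EReal)) '' PhiZSet T hT Ξ Z ξ)

/-- The `α`-Hölder norm `‖ω‖_α = |ω(0)| + sup_{s ≠ t} |ω(t) - ω(s)| / |t-s|^α`,
with values in `[0,∞]`. -/
def holderNormE (α : ℝ) (ω : Path T) : ℝ≥0∞ :=
  ENNReal.ofReal |ω (t0 T hT)| +
    ⨆ (s : Set.Icc (0:ℝ) T) (t : Set.Icc (0:ℝ) T) (_ : s ≠ t),
      ENNReal.ofReal (|ω t - ω s| / |t.1 - s.1| ^ α)

/-- The set of Hölder continuous paths `⋃_n { ω : ‖ω‖_{1/n} ≤ n }`. -/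
def CHolder : Set (Path T) :=
  ⋃ n : ℕ, {ω : Path T | 0 < n ∧ holderNormE T hT (1 / n) ω ≤ (n : ℝ≥0∞)}

end PathwiseSuperhedging

namespace PathwiseSuperhedging

theorem measI {α : Type*} {m : MeasurableSpace α} {f : α → ℝ} (h : ∀ s, MeasurableSet (f ⁻¹' Iic s)) :
    Measurable f := measurable_of_Iic h
theorem measMul {α : Type*} {m : MeasurableSpace α} {f g : α → ℝ} (hf : Measurable f)
    (hg : Measurable g) : Measurable (fun x => f x * g x) := hf.mul hg
theorem measAdd {α : Type*} {m : MeasurableSpace α} {f g : α → ℝ} (hf : Measurable f)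
    (hg : Measurable g) : Measurable (fun x => f x + g x) := hf.add hg
theorem measInd {α : Type*} {m : MeasurableSpace α} {f : α → ℝ} {s : Set α} (hf : Measurable f)
    (hs : MeasurableSet s) : Measurable (s.indicator f) := hf.indicator hs

/-- measurability into path space is coordinatewise -/
theorem measurable_path {T : ℝ} (hT : 0 ≤ T) {α : Type*} {m : MeasurableSpace α} (g : α → Path T)
    (h : ∀ t, Measurable (fun a => g a t)) : Measurable g := by
  haveI : Nonempty (Set.Icc (0:ℝ) T) := ⟨t0 T hT⟩
  let Φ : Path T → (ℕ → ℝ) := fun ω n => ω (TopologicalSpace.denseSeq (Set.Icc (0:ℝ) T) n)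
  have hc : Continuous Φ := continuous_pi fun n => continuous_eval_const _
  have hi : Function.Injective Φ := by
    intro a b hab
    apply ContinuousMap.coe_injective
    refine Continuous.ext_on (TopologicalSpace.denseRange_denseSeq (Set.Icc (0:ℝ) T))
      a.continuous b.continuous ?_
    rintro _ ⟨n, rfl⟩
    exact congrFun hab n
  have he : MeasurableEmbedding Φ := hc.measurableEmbedding hi
  rw [← he.measurable_comp_iff]
  exact measurable_pi_iff.2 fun n => h _

theorem measurable_eval_path {T : ℝ} : Measurable (fun x : Path T × Set.Icc (0:ℝ) T => x.1 x.2) :=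
  (ContinuousEval.continuous_eval).measurable

theorem continuous_ev {T : ℝ} (hT : 0 ≤ T) (ω : Path T) : Continuous (ev T hT ω) :=
  ω.continuous.comp (continuous_projIcc (h := hT))

/-- measurability of `S_τ` -/
theorem measurable_ev {T : ℝ} (hT : 0 ≤ T) {α : Type*} {m : MeasurableSpace α} {g : α → Path T}
    {τ : α → ℝ} (hg : Measurable g) (hτ : Measurable τ) :
    Measurable (fun a => ev T hT (g a) (τ a)) :=
  measurable_eval_path.comp (hg.prodMk ((continuous_projIcc (h := hT)).measurable.comp hτ))

theorem Fraw_le (T : ℝ) (t : ℝ) : Fraw T t ≤ instMeasurableSpacePath T := by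
  refine iSup_le fun s => iSup_le fun _ => ?_
  exact (continuous_eval_const s).measurable.comap_le

theorem Fraw_mono (T : ℝ) {s t : ℝ} (h : s ≤ t) : Fraw T s ≤ Fraw T t := by
  refine iSup_le fun u => iSup_le fun hu => ?_
  exact le_iSup_of_le u (le_iSup_of_le (hu.trans h) le_rfl)

theorem Fraw_le_Fplus (T : ℝ) {t : ℝ} (h : t ≤ T) : Fraw T t ≤ Fplus T t :=
  le_iInf fun s => le_iInf fun hs => Fraw_mono T (le_min hs.le h)

theorem Fplus_le_Fraw (T : ℝ) {s t : ℝ} (h : s < t) : Fplus T s ≤ Fraw T t :=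
  (iInf_le_of_le t (iInf_le_of_le h le_rfl)).trans (Fraw_mono T (min_le_left _ _))

theorem Fplus_le_FrawT (T : ℝ) (s : ℝ) : Fplus T s ≤ Fraw T T :=
  (iInf_le_of_le (s+1) (iInf_le_of_le (by linarith) le_rfl)).trans (Fraw_mono T (min_le_right _ _))

theorem Fplus_mono (T : ℝ) {s t : ℝ} (h : s ≤ t) : Fplus T s ≤ Fplus T t :=
  le_iInf fun u => le_iInf fun hu => iInf_le_of_le u (iInf_le_of_le (h.trans_lt hu) le_rfl)

theorem Fplus_le (T : ℝ) (t : ℝ) : Fplus T t ≤ instMeasurableSpacePath T :=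
  (Fplus_le_FrawT T t).trans (Fraw_le T T)

theorem measurable_eval_Fraw {T : ℝ} (u : Set.Icc (0:ℝ) T) {t : ℝ} (h : (u:ℝ) ≤ t) :
    Measurable[Fraw T t] (fun ω : Path T => ω u) :=
  measurable_iff_comap_le.2 (le_iSup_of_le u (le_iSup_of_le h le_rfl))

theorem measurable_stopPath {T : ℝ} (hT : 0 ≤ T) (t : Set.Icc (0:ℝ) T) :
    Measurable[Fraw T t] (fun ω : Path T => stopPath T ω t) := by
  refine @measurable_path T hT _ (Fraw T t) _ fun u => ?_
  exact measurable_eval_Fraw (T := T) ⟨min t.1 u.1, _⟩ (min_le_left _ _)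

theorem Fraw_eq_comap {T : ℝ} (hT : 0 ≤ T) (t : Set.Icc (0:ℝ) T) :
    Fraw T t = MeasurableSpace.comap (fun ω : Path T => stopPath T ω t) inferInstance := by
  apply le_antisymm
  · refine iSup_le fun s => iSup_le fun hs => ?_
    have : (fun ω : Path T => ω s) = (fun ω : Path T => ω s) ∘ (fun ω => stopPath T ω t) := by
      funext ω
      simp only [Function.comp, stopPath, ContinuousMap.coe_mk]
      congr 1
      exact Subtype.ext (min_eq_right hs).symm
    rw [this, ← MeasurableSpace.comap_comp]
    exact MeasurableSpace.comap_mono (continuous_eval_const s).measurable.comap_le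
  · exact (measurable_stopPath hT t).comap_le

theorem clamp_mem {T : ℝ} (hT : 0 ≤ T) {t : ℝ} (ht : t ∈ Set.Icc 0 T) : clamp T hT t = ⟨t, ht⟩ :=
  projIcc_of_mem hT ht

theorem ev_stopPath {T : ℝ} (hT : 0 ≤ T) (ω : Path T) (t : Set.Icc (0:ℝ) T) (u : ℝ) :
    ev T hT (stopPath T ω t) u = ev T hT ω (min u t) := by
  simp only [ev, stopPath, ContinuousMap.coe_mk, clamp]
  congr 1
  apply Subtype.ext
  have h1 := t.2.1
  have h2 := t.2.2
  simp only [coe_projIcc]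
  rcases le_total u t with h | h
  · rw [min_eq_left h]
    rw [min_eq_right]
    rw [min_eq_right (h.trans h2)]; exact max_le h1 h
  · rw [min_eq_right h, min_eq_left]
    · rw [min_eq_right h2, max_eq_right h1]
    · rw [le_max_iff]; right; exact le_min h2 h

/-- `S_{τ∧t}` is measurable at time t -/
theorem measurable_ev_min {T : ℝ} (hT : 0 ≤ T) {t : ℝ} (ht : t ∈ Set.Icc 0 T)
    {m : MeasurableSpace (Path T)} (hm : Fraw T t ≤ m) {τ : Path T → ℝ}
    (hτ : Measurable[m] (fun ω => min (τ ω) t)) :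
    Measurable[m] (fun ω => ev T hT ω (min (τ ω) t)) := by
  have : (fun ω => ev T hT ω (min (τ ω) t)) =
      fun ω => ev T hT (stopPath T ω ⟨t, ht⟩) (min (τ ω) t) := by
    funext ω
    rw [ev_stopPath]
    simp
  rw [this]
  exact measurable_ev hT ((measurable_stopPath hT ⟨t, ht⟩).mono hm le_rfl) hτ

theorem measurable_ev_Fraw {T : ℝ} (hT : 0 ≤ T) {s t : ℝ} (ht : t ∈ Set.Icc 0 T) (hst : s ≤ t) :
    Measurable[Fraw T t] (fun ω => ev T hT ω s) := by
  have := measurable_ev_min hT ht (m := Fraw T t) le_rfl (τ := fun _ => s) measurable_const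
  simpa [min_eq_left hst] using this

theorem measurable_ev_const {T : ℝ} (hT : 0 ≤ T) (s : ℝ) :
    Measurable (fun ω : Path T => ev T hT ω s) := measurable_ev hT measurable_id measurable_const

/-- min with t of a stopping time is measurable -/
theorem measurable_min_of_st {α : Type*} {m : MeasurableSpace α} {τ : α → ℝ} {t : ℝ}
    (h : ∀ s < t, MeasurableSet {ω | τ ω ≤ s}) : Measurable (fun ω => min (τ ω) t) := by
  refine measurable_of_Iic fun s => ?_
  by_cases hs : s < t
  · have : (fun ω => min (τ ω) t) ⁻¹' Iic s = {ω | τ ω ≤ s} := by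
      ext ω; simp [hs]
    rw [this]; exact h s hs
  · have : (fun ω => min (τ ω) t) ⁻¹' Iic s = univ := by
      ext ω; simp [not_lt.1 hs]
    rw [this]; exact MeasurableSet.univ

theorem IsStopRaw.plus {T : ℝ} {τ : Path T → ℝ} (h : IsStopRaw T τ) : IsStopPlus T τ :=
  fun t ht => Fraw_le_Fplus T ht.2 _ (h t ht)

theorem IsStopPlus.measurable_min {T : ℝ} {τ : Path T → ℝ} (h : IsStopPlus T τ)
    (h0 : ∀ ω, 0 ≤ τ ω) {t : ℝ} (ht : t ∈ Set.Icc 0 T) :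
    Measurable[Fplus T t] (fun ω => min (τ ω) t) := by
  refine @measurable_min_of_st _ (Fplus T t) _ _ fun s hs => ?_
  by_cases h1 : 0 ≤ s
  · exact Fplus_mono T hs.le _ (h s ⟨h1, hs.le.trans ht.2⟩)
  · have : {ω | τ ω ≤ s} = ∅ := by
      ext ω; simp; exact (not_le.1 h1).trans_le (h0 ω)
    rw [this]; exact @MeasurableSet.empty _ (Fplus T t)

theorem IsStopRaw.measurable_min {T : ℝ} {τ : Path T → ℝ} (h : IsStopRaw T τ)
    {t : ℝ} (ht : t ∈ Set.Icc 0 T) :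
    Measurable[Fraw T t] (fun ω => max 0 (min (τ ω) t)) := by
  refine @measI _ (Fraw T t) _ fun s => ?_
  by_cases h1 : 0 ≤ s
  · by_cases hs : s < t
    · have : (fun ω => max 0 (min (τ ω) t)) ⁻¹' Iic s = {ω | τ ω ≤ s} := by
        ext ω; simp [hs, h1]
      rw [this]; exact Fraw_mono T hs.le _ (h s ⟨h1, hs.le.trans ht.2⟩)
    · have : (fun ω => max 0 (min (τ ω) t)) ⁻¹' Iic s = univ := by
        ext ω; simp [not_lt.1 hs, h1]
      rw [this]; exact @MeasurableSet.univ _ (Fraw T t)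
  · have : (fun ω => max 0 (min (τ ω) t)) ⁻¹' Iic s = ∅ := by
      ext ω; simp [h1]
    rw [this]; exact @MeasurableSet.empty _ (Fraw T t)

theorem ev_max {T : ℝ} (hT : 0 ≤ T) (ω : Path T) (s : ℝ) : ev T hT ω (max 0 s) = ev T hT ω s := by
  simp only [ev, clamp]; congr 1; apply Subtype.ext; simp only [coe_projIcc]
  rcases le_total 0 s with h | h
  · rw [max_eq_right h]
  · rw [max_eq_left h, min_eq_right hT, min_eq_right (h.trans hT), max_eq_left h, max_self]

/-- `S_{τ∧t}` is adapted. -/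
theorem IsStopRaw.measurable_ev {T : ℝ} (hT : 0 ≤ T) {τ : Path T → ℝ} (h : IsStopRaw T τ)
    {t : ℝ} (ht : t ∈ Set.Icc 0 T) :
    Measurable[Fraw T t] (fun ω => ev T hT ω (min (τ ω) t)) := by
  have h1 := h.measurable_min ht
  have := measurable_ev_min hT ht (m := Fraw T t) le_rfl (τ := fun ω => max 0 (min (τ ω) t)) (by
    have : (fun ω => min (max 0 (min (τ ω) t)) t) = (fun ω => max 0 (min (τ ω) t)) := by
      funext ω; exact min_eq_left (max_le ht.1 (min_le_right _ _))
    rw [this]; exact h1)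
  have h2 : (fun ω => ev T hT ω (min (max 0 (min (τ ω) t)) t)) =
      (fun ω => ev T hT ω (min (τ ω) t)) := by
    funext ω; rw [min_eq_left (max_le ht.1 (min_le_right _ _)), ev_max]
  rwa [h2] at this

theorem IsStopPlus.measurable_ev {T : ℝ} (hT : 0 ≤ T) {τ : Path T → ℝ} (h : IsStopPlus T τ)
    (h0 : ∀ ω, 0 ≤ τ ω) {t : ℝ} (ht : t ∈ Set.Icc 0 T) :
    Measurable[Fplus T t] (fun ω => ev T hT ω (min (τ ω) t)) :=
  measurable_ev_min hT ht (Fraw_le_Fplus T ht.2) (h.measurable_min h0 ht)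

theorem IsStopPlus.measurable {T : ℝ} (hT : 0 ≤ T) {τ : Path T → ℝ} (h : IsStopPlus T τ)
    (h0 : ∀ ω, 0 ≤ τ ω) (h1 : ∀ ω, τ ω ≤ T) : Measurable τ := by
  have := (h.measurable_min h0 (t := T) ⟨hT, le_rfl⟩).mono (Fplus_le T T) le_rfl
  simpa [h1] using this

/-- equivalent form of measurability at a stopping time -/
theorem measAtStop_iff {T : ℝ} {τ f : Path T → ℝ} (h : IsStopPlus T τ) :
    MeasAtStopPlus T τ f ↔ ∀ t ∈ Set.Icc (0:ℝ) T,
      Measurable[Fplus T t] ({ω | τ ω ≤ t}.indicator f) := by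
  constructor
  · intro hf t ht B hB
    rw [indicator_preimage, Set.ite]
    apply @MeasurableSet.union _ (Fplus T t)
    · exact hf B hB t ht
    · apply @MeasurableSet.diff _ (Fplus T t) _ _ _ (h t ht)
      exact @measurable_const _ _ _ (Fplus T t) (0:ℝ) B hB
  · intro hf B hB t ht
    have : f ⁻¹' B ∩ {ω | τ ω ≤ t} = ({ω | τ ω ≤ t}.indicator f) ⁻¹' B ∩ {ω | τ ω ≤ t} := by
      ext ω
      simp only [mem_inter_iff, mem_preimage, mem_ofPred_eq, and_congr_left_iff]
      intro h; rw [indicator_of_mem]; exact h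
    rw [this]
    exact @MeasurableSet.inter _ (Fplus T t) _ _ (hf t ht hB) (h t ht)

theorem MeasAtStopPlus.measurable {T : ℝ} (hT : 0 ≤ T) {τ f : Path T → ℝ}
    (h1 : ∀ ω, τ ω ≤ T) (hf : MeasAtStopPlus T τ f) : Measurable f := by
  intro B hB
  have := hf B hB T ⟨hT, le_rfl⟩
  have h2 : f ⁻¹' B ∩ {ω | τ ω ≤ T} = f ⁻¹' B := by
    apply inter_eq_left.2; intro ω _; exact h1 ω
  rw [h2] at this
  exact Fplus_le T T _ this

theorem MeasAtStopPlus.comp {T : ℝ} {τ f : Path T → ℝ} (hf : MeasAtStopPlus T τ f) {φ : ℝ → ℝ}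
    (hφ : Measurable φ) : MeasAtStopPlus T τ (fun ω => φ (f ω)) :=
  fun B hB t ht => hf (φ ⁻¹' B) (hφ hB) t ht

theorem MeasAtStopPlus.mul {T : ℝ} {τ f g : Path T → ℝ} (h : IsStopPlus T τ)
    (hf : MeasAtStopPlus T τ f) (hg : MeasAtStopPlus T τ g) :
    MeasAtStopPlus T τ (fun ω => f ω * g ω) := by
  rw [measAtStop_iff h] at *
  intro t ht
  have := @measMul _ (Fplus T t) _ _ (hf t ht) (hg t ht)
  convert this using 1
  ext ω; by_cases hω : τ ω ≤ t <;> simp [indicator, hω]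

theorem MeasAtStopPlus.add {T : ℝ} {τ f g : Path T → ℝ} (h : IsStopPlus T τ)
    (hf : MeasAtStopPlus T τ f) (hg : MeasAtStopPlus T τ g) :
    MeasAtStopPlus T τ (fun ω => f ω + g ω) := by
  rw [measAtStop_iff h] at *
  intro t ht
  have := @measAdd _ (Fplus T t) _ _ (hf t ht) (hg t ht)
  convert this using 1
  ext ω; by_cases hω : τ ω ≤ t <;> simp [indicator, hω]

theorem MeasAtStopPlus.sum {T : ℝ} {ι : Type*} (s : Finset ι) {τ : Path T → ℝ}
    {f : ι → Path T → ℝ} (h : IsStopPlus T τ)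
    (hf : ∀ i ∈ s, MeasAtStopPlus T τ (f i)) :
    MeasAtStopPlus T τ (fun ω => ∑ i ∈ s, f i ω) := by
  induction s using Finset.induction_on with
  | empty =>
    rw [measAtStop_iff h]; intro t ht
    simp only [Finset.sum_empty, indicator_zero]; exact @measurable_const _ _ _ (Fplus T t) _
  | insert a s ha ih =>
    simp only [Finset.sum_insert ha]
    exact MeasAtStopPlus.add h (hf a (Finset.mem_insert_self _ _))
      (ih fun i hi => hf i (Finset.mem_insert_of_mem hi))

/-- monotonicity of the σ-fields at stopping times -/
theorem MeasAtStopPlus.mono {T : ℝ} {τ θ f : Path T → ℝ} (hθ : IsStopPlus T θ)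
    (hle : ∀ ω, τ ω ≤ θ ω) (hf : MeasAtStopPlus T τ f) : MeasAtStopPlus T θ f := by
  intro B hB t ht
  have : f ⁻¹' B ∩ {ω | θ ω ≤ t} = (f ⁻¹' B ∩ {ω | τ ω ≤ t}) ∩ {ω | θ ω ≤ t} := by
    ext ω; simp only [mem_inter_iff, mem_ofPred_eq]
    constructor
    · rintro ⟨h1, h2⟩; exact ⟨⟨h1, (hle ω).trans h2⟩, h2⟩
    · rintro ⟨⟨h1, _⟩, h2⟩; exact ⟨h1, h2⟩
  rw [this]
  exact @MeasurableSet.inter _ (Fplus T t) _ _ (hf B hB t ht) (hθ t ht)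

/-- `S_θ` is measurable at `τ ≥ θ`. -/
theorem measAtStop_ev {T : ℝ} (hT : 0 ≤ T) {τ θ : Path T → ℝ} (hτ : IsStopPlus T τ)
    (hθ : IsStopPlus T θ) (h0 : ∀ ω, 0 ≤ θ ω) (hle : ∀ ω, θ ω ≤ τ ω) :
    MeasAtStopPlus T τ (fun ω => ev T hT ω (θ ω)) := by
  apply MeasAtStopPlus.mono hτ hle
  rw [measAtStop_iff hθ]
  intro t ht
  have := @measInd _ (Fplus T t) _ _ (hθ.measurable_ev hT h0 ht) (hθ t ht)
  convert this using 1
  ext ω; by_cases hω : θ ω ≤ t <;> simp [indicator, hω]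

theorem IsStopPlus.const {T : ℝ} (c : ℝ) : IsStopPlus T (fun _ => c) := by
  intro t _; exact @MeasurableSet.const _ (Fplus T t) _

theorem IsStopPlus.inf2 {T : ℝ} {τ θ : Path T → ℝ} (h : IsStopPlus T τ) (h' : IsStopPlus T θ) :
    IsStopPlus T (fun ω => min (τ ω) (θ ω)) := by
  intro t ht
  have : {ω | min (τ ω) (θ ω) ≤ t} = {ω | τ ω ≤ t} ∪ {ω | θ ω ≤ t} := by ext; simp
  rw [this]
  exact @MeasurableSet.union _ (Fplus T t) _ _ (h t ht) (h' t ht)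

theorem IsStopPlus.sup2 {T : ℝ} {τ θ : Path T → ℝ} (h : IsStopPlus T τ) (h' : IsStopPlus T θ) :
    IsStopPlus T (fun ω => max (τ ω) (θ ω)) := by
  intro t ht
  have : {ω | max (τ ω) (θ ω) ≤ t} = {ω | τ ω ≤ t} ∩ {ω | θ ω ≤ t} := by ext; simp
  rw [this]
  exact @MeasurableSet.inter _ (Fplus T t) _ _ (h t ht) (h' t ht)

theorem measAtStop_const_time {T : ℝ} {s : ℝ} {f : Path T → ℝ}
    (hf : Measurable[Fraw T s] f) (hs : s ≤ T) : MeasAtStopPlus T (fun _ => s) f := by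
  intro B hB t ht
  by_cases h : s ≤ t
  · simp only [h, ofPred_true, inter_univ]
    exact Fplus_mono T h _ (Fraw_le_Fplus T hs _ (hf hB))
  · simp only [h, ofPred_false, inter_empty]; exact @MeasurableSet.empty _ (Fplus T t)

end PathwiseSuperhedging

namespace PathwiseSuperhedging

theorem measStrong {α : Type*} {m : MeasurableSpace α} {f : α → ℝ} (hf : Measurable f) :
    StronglyMeasurable f := hf.stronglyMeasurable

theorem os_disc {T : ℝ} (hT : 0 ≤ T) (Q : Measure (Path T)) [IsProbabilityMeasure Q]
    (X : ℝ → Path T → ℝ) (hm : ∀ t ∈ Set.Icc (0:ℝ) T, Measurable[Fraw T t] (X t))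
    (hM : IsMart T Q X) (N : ℕ) (idx : Path T → ℕ) (hidx : ∀ ω, idx ω < N) (s : ℕ → ℝ)
    (hs : ∀ i, s i ∈ Set.Icc (0:ℝ) T)
    (hE : ∀ i, MeasurableSet[Fraw T (s i)] {ω | idx ω = i}) (Z : Path T → ℝ)
    (hZ : ∀ i (B : Set ℝ), MeasurableSet B →
      MeasurableSet[Fraw T (s i)] (Z ⁻¹' B ∩ {ω | idx ω = i})) :
    ∃ m : MeasurableSpace (Path T), m ≤ instMeasurableSpacePath T ∧
      (fun ω => X (s (idx ω)) ω) =ᵐ[Q] Q[X T | m] ∧ Measurable[m] Z := by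
  obtain ⟨m, hmdef⟩ : ∃ m : MeasurableSpace (Path T), ∀ A, MeasurableSet[m] A ↔
      (MeasurableSet[instMeasurableSpacePath T] A ∧ ∀ i, MeasurableSet[Fraw T (s i)] (A ∩ {ω | idx ω = i})) := by
    refine ⟨{
      MeasurableSet' := fun A => MeasurableSet A ∧
        ∀ i, MeasurableSet[Fraw T (s i)] (A ∩ {ω | idx ω = i})
      measurableSet_empty := ⟨MeasurableSet.empty, fun i => by
        rw [empty_inter]; exact @MeasurableSet.empty _ (Fraw T (s i))⟩
      measurableSet_compl := fun A hA => ⟨hA.1.compl, fun i => by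
        have : Aᶜ ∩ {ω | idx ω = i} = {ω | idx ω = i} \ (A ∩ {ω | idx ω = i}) := by
          ext; simp; tauto
        rw [this]
        exact @MeasurableSet.diff _ (Fraw T (s i)) _ _ (hE i) (hA.2 i)⟩
      measurableSet_iUnion := fun f hf => ⟨MeasurableSet.iUnion fun n => (hf n).1, fun i => by
        rw [iUnion_inter]
        exact @MeasurableSet.iUnion _ _ (Fraw T (s i)) _ _ fun n => (hf n).2 i⟩ }, fun A => Iff.rfl⟩
  have hle : m ≤ instMeasurableSpacePath T := fun A hA => ((hmdef A).1 hA).1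
  have hun : ∀ A : Set (Path T), (∀ i, MeasurableSet[Fraw T (s i)] (A ∩ {ω | idx ω = i})) →
      MeasurableSet[m] A := by
    intro A hA
    refine (hmdef A).2 ⟨?_, hA⟩
    have : A = ⋃ i, A ∩ {ω | idx ω = i} := by ext; simp
    rw [this]
    exact @MeasurableSet.iUnion _ _ (instMeasurableSpacePath T) _ _ fun i => Fraw_le T _ _ (hA i)
  have hXm : Measurable[m] (fun ω => X (s (idx ω)) ω) := by
    intro B hB
    refine hun _ fun i => ?_
    have : (fun ω => X (s (idx ω)) ω) ⁻¹' B ∩ {ω | idx ω = i} =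
        (X (s i)) ⁻¹' B ∩ {ω | idx ω = i} := by
      ext ω; simp only [mem_inter_iff, mem_preimage, mem_ofPred_eq, and_congr_left_iff]
      rintro rfl; rfl
    rw [this]
    exact @MeasurableSet.inter _ (Fraw T (s i)) _ _ (hm _ (hs i) hB) (hE i)
  have hTT : T ∈ Set.Icc (0:ℝ) T := ⟨hT, le_rfl⟩
  have hEi : ∀ i, MeasurableSet[instMeasurableSpacePath T] {ω : Path T | idx ω = i} := fun i => Fraw_le T _ _ (hE i)
  have hdec : ∀ Y : ℕ → Path T → ℝ, (fun ω => Y (idx ω) ω) =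
      fun ω => ∑ i ∈ Finset.range N, {ω | idx ω = i}.indicator (Y i) ω := by
    intro Y; funext ω
    simp only [indicator_apply, mem_ofPred_eq]
    rw [Finset.sum_ite_eq, if_pos (Finset.mem_range.2 (hidx ω))]
  have hint : ∀ Y : ℕ → Path T → ℝ, (∀ i, Integrable (Y i) Q) →
      Integrable (fun ω => Y (idx ω) ω) Q := by
    intro Y hY
    rw [hdec]
    exact integrable_finsetSum _ fun i _ => (hY i).indicator (hEi i)
  have hI : ∀ Y : ℕ → Path T → ℝ, (∀ i, Integrable (Y i) Q) → ∀ A, MeasurableSet[instMeasurableSpacePath T] A →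
      ∫ ω in A, Y (idx ω) ω ∂Q = ∑ i ∈ Finset.range N, ∫ ω in A ∩ {ω | idx ω = i}, Y i ω ∂Q := by
    intro Y hY A hA
    rw [hdec, integral_finsetSum _ fun i _ => ((hY i).indicator (hEi i)).integrableOn]
    refine Finset.sum_congr rfl fun i _ => ?_
    rw [setIntegral_indicator (hEi i)]
  refine ⟨m, hle, ?_, ?_⟩
  · refine ae_eq_condExp_of_forall_setIntegral_eq hle (hM.1 T hTT) ?_ ?_ ?_
    · intro A _ _
      exact (hint (fun i => X (s i)) fun i => hM.1 _ (hs i)).integrableOn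
    · intro A hA _
      replace hA := (hmdef A).1 hA
      rw [hI (fun i => X (s i)) (fun i => hM.1 _ (hs i)) A hA.1,
        hI (fun _ => X T) (fun i => hM.1 _ hTT) A hA.1]
      refine Finset.sum_congr rfl fun i _ => ?_
      exact (hM.2 _ _ (hs i) hTT (hs i).2 _ (hA.2 i)).symm
    · exact (measStrong hXm).aestronglyMeasurable
  · intro B hB
    exact hun _ fun i => hZ i B hB

theorem stop_lt_meas {T : ℝ} (hT : 0 ≤ T) {τ Z : Path T → ℝ}
    (h0 : ∀ ω, 0 ≤ τ ω) (h1 : ∀ ω, τ ω ≤ T)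
    (hZ : MeasAtStopPlus T τ Z) (c : ℝ) (B : Set ℝ) (hB : MeasurableSet B) :
    MeasurableSet[Fraw T (min c T)] (Z ⁻¹' B ∩ {ω | τ ω < c}) := by
  by_cases hc : T < c
  · have : Z ⁻¹' B ∩ {ω | τ ω < c} = Z ⁻¹' B ∩ {ω | τ ω ≤ T} := by
      ext ω; simp only [mem_inter_iff, mem_ofPred_eq, and_congr_right_iff]
      intro _; exact ⟨fun _ => h1 ω, fun _ => (h1 ω).trans_lt hc⟩
    rw [this, min_eq_right hc.le]
    exact Fplus_le_FrawT T T _ (hZ B hB T ⟨hT, le_rfl⟩)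
  · rw [min_eq_left (not_lt.1 hc)]
    have : Z ⁻¹' B ∩ {ω | τ ω < c} =
        ⋃ (q : ℚ) (_ : 0 ≤ (q:ℝ) ∧ (q:ℝ) < c), Z ⁻¹' B ∩ {ω | τ ω ≤ q} := by
      ext ω; simp only [mem_inter_iff, mem_ofPred_eq, mem_iUnion, exists_prop]
      constructor
      · rintro ⟨h2, h3⟩
        obtain ⟨q, hq1, hq2⟩ := exists_rat_btwn h3
        exact ⟨q, ⟨(h0 ω).trans hq1.le, hq2⟩, h2, hq1.le⟩
      · rintro ⟨q, hq, h2, h3⟩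
        exact ⟨h2, h3.trans_lt hq.2⟩
    rw [this]
    refine @MeasurableSet.iUnion _ _ (Fraw T c) _ _ fun q => ?_
    refine @MeasurableSet.iUnion _ _ (Fraw T c) _ _ fun hq => ?_
    exact Fplus_le_Fraw T hq.2 _ (hZ B hB q ⟨hq.1, hq.2.le.trans (not_lt.1 hc)⟩)

/-- optional stopping -/
theorem optional_stopping {T : ℝ} (hT : 0 ≤ T) (Q : Measure (Path T)) [IsProbabilityMeasure Q]
    (X : ℝ → Path T → ℝ) (hc : ∀ ω, Continuous fun t => X t ω)
    (hm : ∀ t ∈ Set.Icc (0:ℝ) T, Measurable[Fraw T t] (X t))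
    (hM : IsMart T Q X) {τ : Path T → ℝ}
    (h0 : ∀ ω, 0 ≤ τ ω) (h1 : ∀ ω, τ ω ≤ T) {Z : Path T → ℝ} (hZ : MeasAtStopPlus T τ Z)
    (C : ℝ) (hC : ∀ ω, |Z ω| ≤ C) :
    Integrable (fun ω => X (τ ω) ω) Q ∧ ∫ ω, Z ω * X (τ ω) ω ∂Q = ∫ ω, Z ω * X T ω ∂Q := by
  have hTT : T ∈ Set.Icc (0:ℝ) T := ⟨hT, le_rfl⟩
  have hXT := hM.1 T hTT
  have hZm : Measurable Z := hZ.measurable hT h1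
  let s : ℕ → ℕ → ℝ := fun n i => min (((i:ℝ)+1)/((n:ℝ)+1)) T
  let idx : ℕ → Path T → ℕ := fun n ω => ⌊((n:ℝ)+1) * τ ω⌋₊
  have key : ∀ n, ∃ m : MeasurableSpace (Path T), m ≤ instMeasurableSpacePath T ∧
      (fun ω => X (s n (idx n ω)) ω) =ᵐ[Q] Q[X T | m] ∧ Measurable[m] Z := by
    intro n
    have hn : (0:ℝ) < (n:ℝ)+1 := by positivity
    have hset : ∀ i, {ω | idx n ω = i} = {ω | τ ω < ((i:ℝ)+1)/((n:ℝ)+1)} \ {ω | τ ω < (i:ℝ)/((n:ℝ)+1)} := by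
      intro i; ext ω
      simp only [idx, mem_ofPred_eq, Set.mem_sdiff, not_lt]
      rw [Nat.floor_eq_iff (mul_nonneg hn.le (h0 ω)), lt_div_iff₀ hn, div_le_iff₀ hn, mul_comm]
      tauto
    have hZE : ∀ i (B : Set ℝ), MeasurableSet B →
      MeasurableSet[Fraw T (s n i)] (Z ⁻¹' B ∩ {ω | idx n ω = i}) := by
      intro i B hB
      have e : Z ⁻¹' B ∩ {ω | idx n ω = i} =
        (Z ⁻¹' B ∩ {ω | τ ω < ((i:ℝ)+1)/((n:ℝ)+1)}) \ (Z ⁻¹' B ∩ {ω | τ ω < (i:ℝ)/((n:ℝ)+1)}) := by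
        rw [hset]; ext; simp; tauto
      rw [e]
      refine @MeasurableSet.diff _ (Fraw T (s n i)) _ _ (stop_lt_meas hT h0 h1 hZ _ B hB) ?_
      refine Fraw_mono T ?_ _ (stop_lt_meas hT h0 h1 hZ _ B hB)
      exact min_le_min_right _ (by gcongr; linarith)
    refine os_disc hT Q X hm hM (⌊((n:ℝ)+1) * T⌋₊ + 1) (idx n) ?_ (s n) ?_ ?_ Z hZE
    · intro ω
      exact Nat.lt_succ_of_le (Nat.floor_le_floor (by gcongr; exact h1 ω))
    · intro i; exact ⟨le_min (by positivity) hT, min_le_right _ _⟩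
    · intro i
      have := hZE i univ MeasurableSet.univ
      simpa using this
  choose m hmle hmX hmZ using key
  have hUI := hXT.uniformIntegrable_condExp hmle
  have htend : ∀ ω, Tendsto (fun n => s n (idx n ω)) atTop (𝓝 (τ ω)) := by
    intro ω
    have hlo : ∀ n, τ ω ≤ s n (idx n ω) := by
      intro n
      have hn : (0:ℝ) < (n:ℝ)+1 := by positivity
      refine le_min ?_ (h1 ω)
      rw [le_div_iff₀ hn, mul_comm]
      exact (Nat.lt_floor_add_one _).le
    have hhi : ∀ n, s n (idx n ω) ≤ τ ω + 1/((n:ℝ)+1) := by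
      intro n
      have hn : (0:ℝ) < (n:ℝ)+1 := by positivity
      refine (min_le_left _ _).trans ?_
      rw [div_le_iff₀ hn, add_mul, one_div, inv_mul_cancel₀ hn.ne']
      have := Nat.floor_le (mul_nonneg hn.le (h0 ω))
      rw [mul_comm (τ ω)]
      linarith
    refine tendsto_of_tendsto_of_tendsto_of_le_of_le tendsto_const_nhds ?_ hlo hhi
    have := tendsto_one_div_add_atTop_nhds_zero_nat (𝕜 := ℝ)
    simpa using this.const_add (τ ω)
  have hae : ∀ᵐ ω ∂Q, Tendsto (fun n => (Q[X T | m n]) ω) atTop (𝓝 (X (τ ω) ω)) := by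
    have : ∀ᵐ ω ∂Q, ∀ n, X (s n (idx n ω)) ω = (Q[X T | m n]) ω := ae_all_iff.2 hmX
    filter_upwards [this] with ω hω
    simp_rw [← hω]
    exact ((hc ω).tendsto _).comp (htend ω)
  have hmem := hUI.memLp_of_ae_tendsto hae
  have hint : Integrable (fun ω => X (τ ω) ω) Q := memLp_one_iff_integrable.1 hmem
  refine ⟨hint, ?_⟩
  have hL := tendsto_Lp_finite_of_tendsto_ae le_rfl ENNReal.one_ne_top
    (fun n => integrable_condExp.aestronglyMeasurable) hmem hUI.2.1 hae
  have hbd : ∀ᵐ ω ∂Q, ‖Z ω‖ ≤ C := Eventually.of_forall hC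
  have hbm : ∀ {f : Path T → ℝ}, Integrable f Q → Integrable (fun ω => Z ω * f ω) Q :=
    fun hf => hf.bdd_mul hZm.aestronglyMeasurable hbd
  have heq : ∀ n, ∫ ω, Z ω * (Q[X T | m n]) ω ∂Q = ∫ ω, Z ω * X T ω ∂Q := by
    intro n
    have hs : StronglyMeasurable[m n] Z := measStrong (hmZ n)
    have := condExp_stronglyMeasurable_mul_of_bound (hmle n) hs hXT C hbd
    rw [← integral_condExp (hmle n) (f := fun ω => Z ω * X T ω)]
    exact (integral_congr_ae this).symm
  have hlim : Tendsto (fun n => ∫ ω, Z ω * (Q[X T | m n]) ω ∂Q) atTop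
      (𝓝 (∫ ω, Z ω * X (τ ω) ω ∂Q)) := by
    refine tendsto_integral_of_L1' _ (hbm hint).1 (Eventually.of_forall fun n => hbm integrable_condExp) ?_
    have h2 : Tendsto (fun n => ENNReal.ofReal C * eLpNorm (Q[X T | m n] - fun ω => X (τ ω) ω) 1 Q)
        atTop (𝓝 0) := by
      have := ENNReal.Tendsto.const_mul hL (Or.inr (ENNReal.ofReal_ne_top (r := C)))
      simpa using this
    refine tendsto_of_tendsto_of_tendsto_of_le_of_le tendsto_const_nhds h2 (fun _ => bot_le) ?_
    intro n
    refine eLpNorm_le_mul_eLpNorm_of_ae_le_mul (Eventually.of_forall fun ω => ?_) 1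
    simp only [Pi.sub_apply, ← mul_sub, norm_mul]
    gcongr
    exact hC ω
  simp_rw [heq] at hlim
  exact tendsto_nhds_unique hlim tendsto_const_nhds
end PathwiseSuperhedging

namespace PathwiseSuperhedging

theorem ae_of_full {α : Type*} [MeasurableSpace α] {Q : Measure α} [IsProbabilityMeasure Q]
    {Ξ A : Set α} (h : Q Ξ = 1) (hA : MeasurableSet A) (hsub : Ξ ⊆ A) : ∀ᵐ ω ∂Q, ω ∈ A := by
  have : A ∈ ae Q := by
    rw [mem_ae_iff_prob_eq_one hA]
    exact le_antisymm prob_le_one (h ▸ measure_mono hsub)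
  exact this

theorem SimpleStrategy.mono {T : ℝ} (H : SimpleStrategy T) (ω : Path T) :
    Monotone (fun l => H.τ l ω) := Fin.monotone_iff_le_succ.2 fun l => H.τ_mono l ω

theorem SimpleStrategy.nonneg {T : ℝ} (H : SimpleStrategy T) (l) (ω : Path T) : 0 ≤ H.τ l ω :=
  (H.τ_nonneg ω).trans (H.mono ω (Fin.zero_le l))

theorem SimpleStrategy.leT {T : ℝ} (H : SimpleStrategy T) (l) (ω : Path T) : H.τ l ω ≤ T :=
  (H.mono ω (Fin.le_last l)).trans (H.τ_le ω)

theorem wd_base {T : ℝ} (hT : 0 ≤ T) {Ξ : Set (Path T)} {Q : Measure (Path T)}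
    (hQ : Q ∈ MSet T hT Ξ) (lam : ℝ) (H : SimpleStrategy T)
    (hadm : ∀ t ∈ Set.Icc (0:ℝ) T, ∀ ω ∈ Ξ, 0 ≤ lam + integ T H (Sproc T hT) t ω) :
    Measurable (fun ω => lam + integ T H (Sproc T hT) T ω) ∧
    ∫⁻ ω, ENNReal.ofReal (lam + integ T H (Sproc T hT) T ω) ∂Q ≤ ENNReal.ofReal lam := by
  obtain ⟨hP, ⟨θ, hθs, hθl, hθM⟩, hΞ⟩ := hQ
  have hTT : T ∈ Set.Icc (0:ℝ) T := ⟨hT, le_rfl⟩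
  have hcm : ∀ l, Measurable (H.coeff l) := fun l =>
    (H.coeff_meas l).measurable hT (fun ω => H.leT _ ω)
  have hτm : ∀ l, Measurable (H.τ l) := fun l =>
    (H.7 l).measurable hT (fun ω => H.nonneg l ω) (fun ω => H.leT l ω)
  have hmeasW : Measurable (fun ω => lam + integ T H (Sproc T hT) T ω) := by
    unfold integ Sproc
    refine measurable_const.add (Finset.measurable_sum _ fun l _ => (hcm l).mul ?_)
    exact (measurable_ev hT measurable_id ((hτm _).min measurable_const)).sub
      (measurable_ev hT measurable_id ((hτm _).min measurable_const))
  refine ⟨hmeasW, ?_⟩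
  let X : ℕ → ℝ → Path T → ℝ := fun m t ω => ev T hT ω (min (θ m ω) t)
  have hXm : ∀ m, ∀ t ∈ Set.Icc (0:ℝ) T, Measurable[Fraw T t] (X m t) :=
    fun m t ht => (hθs m).measurable_ev hT ht
  have hXc : ∀ m ω, Continuous fun t => X m t ω := fun m ω =>
    (continuous_ev hT ω).comp (continuous_const.min continuous_id)
  let W : ℕ → Path T → ℝ := fun m ω => lam + ∑ l : Fin H.L, H.coeff l ω *
    (X m (H.τ l.succ ω) ω - X m (H.τ l.castSucc ω) ω)
  have hWe : ∀ m ω, W m ω = lam + integ T H (Sproc T hT) (max 0 (min (θ m ω) T)) ω := by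
    intro m ω
    simp only [W, integ, Sproc, X]
    congr 1
    have : ∀ l, ev T hT ω (min (θ m ω) (H.τ l ω)) =
        ev T hT ω (min (H.τ l ω) (max 0 (min (θ m ω) T))) := by
      intro l
      rw [← ev_max hT ω (min (θ m ω) (H.τ l ω))]
      congr 1
      have h1 := H.nonneg l ω
      have h2 := H.leT l ω
      rw [min_max_distrib_left, min_eq_right h1, min_comm (θ m ω) T, ← min_assoc, min_eq_left h2,
        min_comm]
    simp only [this]
  have hint : ∀ m l, Integrable (fun ω => X m (H.τ l ω) ω) Q := fun m l =>
    (optional_stopping hT Q (X m) (hXc m) (hXm m) (hθM m) (H.nonneg l) (H.leT l)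
      (Z := fun _ => 0) (by
        rw [measAtStop_iff (H.7 l)]
        intro t _; simp only [indicator_zero]; exact @measurable_const _ _ _ (Fplus T t) _) 0
        (by simp)).1
  have hint2 : ∀ m l (l' : Fin H.L), Integrable (fun ω => H.coeff l' ω * X m (H.τ l ω) ω) Q := by
    intro m l l'
    obtain ⟨C, hC⟩ := H.coeff_bdd l'
    exact (hint m l).bdd_mul (hcm l').aestronglyMeasurable (Eventually.of_forall hC)
  have hzero : ∀ m (l : Fin H.L), ∫ ω, H.coeff l ω *
    (X m (H.τ l.succ ω) ω - X m (H.τ l.castSucc ω) ω) ∂Q = 0 := by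
    intro m l
    obtain ⟨C, hC⟩ := H.coeff_bdd l
    simp only [mul_sub]
    rw [integral_sub (hint2 m _ l) (hint2 m _ l)]
    rw [(optional_stopping hT Q (X m) (hXc m) (hXm m) (hθM m) (H.nonneg _) (H.leT _)
      (H.coeff_meas l) C hC).2]
    rw [(optional_stopping hT Q (X m) (hXc m) (hXm m) (hθM m) (H.nonneg _) (H.leT _)
      ((H.coeff_meas l).mono (H.7 _) (H.τ_mono l)) C hC).2, sub_self]
  have hint3 : ∀ m (l : Fin H.L), Integrable (fun ω => H.coeff l ω *
    (X m (H.τ l.succ ω) ω - X m (H.τ l.castSucc ω) ω)) Q := by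
    intro m l
    simp only [mul_sub]
    exact (hint2 m _ l).sub (hint2 m _ l)
  have hWint : ∀ m, Integrable (W m) Q := fun m =>
    (integrable_const lam).add (integrable_finsetSum _ fun l _ => hint3 m l)
  have hWval : ∀ m, ∫ ω, W m ω ∂Q = lam := by
    intro m
    simp only [W]
    rw [integral_add (integrable_const lam) (integrable_finsetSum _ fun l _ => hint3 m l),
      integral_finsetSum _ fun l _ => hint3 m l]
    simp [hzero]
  have hXmeas : ∀ m l, Measurable (fun ω => X m (H.τ l ω) ω) := by
    intro m l
    have : (fun ω => X m (H.τ l ω) ω) = fun ω => ev T hT ω (min (H.τ l ω) (max 0 (min (θ m ω) T))) := by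
      funext ω
      simp only [X]
      rw [← ev_max hT ω (min (θ m ω) (H.τ l ω))]
      congr 1
      have h1 := H.nonneg l ω
      have h2 := H.leT l ω
      rw [min_max_distrib_left, min_eq_right h1, min_comm (θ m ω) T, ← min_assoc, min_eq_left h2,
        min_comm]
    rw [this]
    exact measurable_ev hT measurable_id ((hτm l).min
      (((hθs m).measurable_min hTT).mono (Fraw_le T T) le_rfl))
  have hWmeas : ∀ m, Measurable (W m) := by
    intro m
    exact measurable_const.add (Finset.measurable_sum _ fun l _ => (hcm l).mul
      ((hXmeas m _).sub (hXmeas m _)))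
  have hWnn : ∀ m, ∀ᵐ ω ∂Q, 0 ≤ W m ω := by
    intro m
    refine ae_of_full (A := {ω | 0 ≤ W m ω}) hΞ (measurableSet_le measurable_const (hWmeas m)) ?_
    intro ω hω
    rw [mem_ofPred_eq, hWe]
    exact hadm _ ⟨le_max_left _ _, max_le hT (min_le_right _ _)⟩ ω hω
  have hlW : ∀ m, ∫⁻ ω, ENNReal.ofReal (W m ω) ∂Q = ENNReal.ofReal lam := by
    intro m
    rw [← ofReal_integral_eq_lintegral_ofReal (hWint m) (hWnn m), hWval]
  have hlim : ∀ᵐ ω ∂Q, ENNReal.ofReal (lam + integ T H (Sproc T hT) T ω) =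
      liminf (fun m => ENNReal.ofReal (W m ω)) atTop := by
    filter_upwards [hθl] with ω hω
    symm
    apply Tendsto.liminf_eq
    apply tendsto_const_nhds.congr'
    filter_upwards [hω.2.eventually_ge_atTop T] with m hm
    rw [hWe, min_eq_right hm, max_eq_right hT]
  rw [lintegral_congr_ae hlim]
  refine (lintegral_liminf_le fun m => (hWmeas m).ennreal_ofReal).trans ?_
  simp only [hlW, liminf_const, le_refl]

theorem GG_weak {T : ℝ} (hT : 0 ≤ T) {Ξ : Set (Path T)} {Q : Measure (Path T)}
    (hQ : Q ∈ MSet T hT Ξ) {lam : ℝ} {Y : Path T → EReal} (hY : GG T hT Ξ lam Y) :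
    Measurable Y ∧ ∫⁻ ω, (Y ω).toENNReal ∂Q ≤ ENNReal.ofReal lam := by
  induction hY with
  | base H hadm =>
    obtain ⟨h1, h2⟩ := wd_base hT hQ lam H hadm
    exact ⟨measurable_coe_real_ereal.comp h1, h2⟩
  | lim X _ ih =>
    refine ⟨Measurable.liminf fun n => (ih n).1, ?_⟩
    have : ∀ ω, (liminf (fun n => X n ω) atTop).toENNReal =
        liminf (fun n => (X n ω).toENNReal) atTop := fun ω =>
      Monotone.map_liminf_of_continuousAt (fun _ _ h => EReal.toENNReal_le_toENNReal h) _
        EReal.continuous_toENNReal.continuousAt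
    simp only [this]
    refine (lintegral_liminf_le fun n => (ih n).1.ereal_toENNReal).trans ?_
    refine liminf_le_of_le (by isBoundedDefault) ?_
    intro b hb
    obtain ⟨n, hn⟩ := hb.exists
    exact hn.trans (ih n).2

theorem GG_nonneg {T : ℝ} (hT : 0 ≤ T) {Ξ : Set (Path T)} (hne : Ξ.Nonempty)
    {lam : ℝ} {Y : Path T → EReal} (hY : GG T hT Ξ lam Y) : 0 ≤ lam := by
  induction hY with
  | base H hadm =>
    obtain ⟨ω, hω⟩ := hne
    have := hadm 0 ⟨le_rfl, hT⟩ ω hω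
    simpa [integ, min_eq_right (H.nonneg _ ω)] using this
  | lim X _ ih => exact ih 0

theorem weak_duality {T : ℝ} (hT : 0 ≤ T) {Ξ : Set (Path T)} (hne : Ξ.Nonempty)
    {ξ : Path T → ℝ≥0∞} (hξ : Measurable ξ) {lam : ℝ} {Y : Path T → EReal} (hY : GG T hT Ξ lam Y)
    (hle : ∀ ω ∈ Ξ, (ξ ω : EReal) ≤ Y ω) : (supMart T hT Ξ ξ : EReal) ≤ lam := by
  have hl := GG_nonneg hT hne hY
  have : supMart T hT Ξ ξ ≤ ENNReal.ofReal lam := by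
    refine iSup_le fun Q => iSup_le fun hQ => ?_
    have hP := hQ.1
    obtain ⟨h1, h2⟩ := GG_weak hT hQ hY
    refine le_trans (lintegral_mono_ae ?_) h2
    have := ae_of_full hQ.2.2 (measurableSet_le hξ.coe_ereal_ennreal h1) hle
    filter_upwards [this] with ω hω
    have h3 := EReal.toENNReal_le_toENNReal hω
    simpa using h3
  have h4 : (supMart T hT Ξ ξ : EReal) ≤ (ENNReal.ofReal lam : EReal) :=
    EReal.coe_ennreal_le_coe_ennreal_iff.2 this
  rwa [EReal.coe_ennreal_ofReal, max_eq_left hl] at h4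

end PathwiseSuperhedging

namespace PathwiseSuperhedging

theorem measLe {α : Type*} {m : MeasurableSpace α} {f g : α → ℝ} (hf : Measurable f)
    (hg : Measurable g) : MeasurableSet {x | f x ≤ g x} := measurableSet_le hf hg
/-! hitting -/
theorem meas_exists_le {α : Type*} {m : MeasurableSpace α} (Z : ℝ → α → ℝ)
    (hc : ∀ ω, Continuous fun t => Z t ω) {t : ℝ} (ht : 0 ≤ t)
    (hm : ∀ u ∈ Icc (0:ℝ) t, Measurable (Z u)) :
    MeasurableSet {ω | ∃ u ∈ Icc (0:ℝ) t, Z u ω ≤ 0} := by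
  have hmem : ∀ q : ℝ, max 0 (min q t) ∈ Icc (0:ℝ) t := fun q =>
    ⟨le_max_left _ _, max_le ht (min_le_right _ _)⟩
  have : {ω | ∃ u ∈ Icc (0:ℝ) t, Z u ω ≤ 0} =
      ⋂ n : ℕ, ⋃ q : ℚ, {ω | Z (max 0 (min (q:ℝ) t)) ω < 1 / ((n:ℝ) + 1)} := by
    ext ω
    simp only [mem_ofPred_eq, mem_iInter, mem_iUnion]
    constructor
    · rintro ⟨u, hu, hZ⟩ n
      have hcont : Continuous (fun q : ℝ => Z (max 0 (min q t)) ω) :=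
        (hc ω).comp (continuous_const.max (continuous_id.min continuous_const))
      have hop : IsOpen {q : ℝ | Z (max 0 (min q t)) ω < 1 / ((n:ℝ)+1)} :=
        isOpen_lt hcont continuous_const
      have hne : {q : ℝ | Z (max 0 (min q t)) ω < 1 / ((n:ℝ)+1)}.Nonempty := by
        refine ⟨u, ?_⟩
        rw [mem_ofPred_eq, min_eq_left hu.2, max_eq_right hu.1]
        exact hZ.trans_lt (by positivity)
      obtain ⟨x, hx, q, rfl⟩ := Rat.denseRange_cast.inter_open_nonempty _ hop hne
      exact ⟨q, hx⟩
    · intro h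
      obtain ⟨u, hu, hmin⟩ := (isCompact_Icc (a := (0:ℝ)) (b := t)).exists_isMinOn
        ⟨0, le_rfl, ht⟩ (hc ω).continuousOn
      refine ⟨u, hu, ?_⟩
      refine le_of_forall_pos_lt_add fun ε hε => ?_
      obtain ⟨n, hn⟩ := exists_nat_one_div_lt hε
      obtain ⟨q, hq⟩ := h n
      have : Z u ω ≤ Z (max 0 (min (q:ℝ) t)) ω := hmin (hmem _)
      linarith
  rw [this]
  refine MeasurableSet.iInter fun n => MeasurableSet.iUnion fun q => ?_
  exact measurableSet_lt (hm _ (hmem _)) measurable_const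

def hit {T : ℝ} (Z : ℝ → Path T → ℝ) (ω : Path T) : ℝ :=
  sInf ({t : ℝ | t ∈ Icc (0:ℝ) T ∧ Z t ω ≤ 0} ∪ {T})

theorem hit_bdd {T : ℝ} (hT : 0 ≤ T) (Z : ℝ → Path T → ℝ) (ω : Path T) :
    BddBelow ({t : ℝ | t ∈ Icc (0:ℝ) T ∧ Z t ω ≤ 0} ∪ {T}) :=
  ⟨0, by rintro x (hx | hx); exacts [hx.1.1, by rw [mem_singleton_iff.1 hx]; exact hT]⟩

theorem hit_nonneg {T : ℝ} (hT : 0 ≤ T) (Z : ℝ → Path T → ℝ) (ω : Path T) : 0 ≤ hit Z ω :=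
  le_csInf ⟨T, Or.inr rfl⟩
    (by rintro x (hx | hx); exacts [hx.1.1, by rw [mem_singleton_iff.1 hx]; exact hT])

theorem hit_le {T : ℝ} (hT : 0 ≤ T) (Z : ℝ → Path T → ℝ) (ω : Path T) : hit Z ω ≤ T :=
  csInf_le (hit_bdd hT Z ω) (Or.inr rfl)

theorem hit_le_of {T : ℝ} (hT : 0 ≤ T) {Z : ℝ → Path T → ℝ} {ω : Path T} {t : ℝ}
    (ht : t ∈ Icc (0:ℝ) T) (h : Z t ω ≤ 0) : hit Z ω ≤ t :=
  csInf_le (hit_bdd hT Z ω) (Or.inl ⟨ht, h⟩)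

theorem hit_mem {T : ℝ} (hT : 0 ≤ T) {Z : ℝ → Path T → ℝ} (hc : ∀ ω, Continuous fun t => Z t ω)
    (ω : Path T) : Z (hit Z ω) ω ≤ 0 ∨ hit Z ω = T := by
  have hcl : IsClosed ({t : ℝ | t ∈ Icc (0:ℝ) T ∧ Z t ω ≤ 0} ∪ {T}) :=
    (isClosed_Icc.inter (isClosed_le (hc ω) continuous_const)).union isClosed_singleton
  have := hcl.csInf_mem ⟨T, Or.inr rfl⟩ (hit_bdd hT Z ω)
  rcases this with h | h
  · exact Or.inl h.2
  · exact Or.inr h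

theorem hit_stop {T : ℝ} (hT : 0 ≤ T) {Z : ℝ → Path T → ℝ} (hc : ∀ ω, Continuous fun t => Z t ω)
    (hm : ∀ t ∈ Icc (0:ℝ) T, Measurable[Fplus T t] (Z t)) : IsStopPlus T (hit Z) := by
  intro t ht
  by_cases h : t < T
  · have : {ω | hit Z ω ≤ t} = {ω | ∃ u ∈ Icc (0:ℝ) t, Z u ω ≤ 0} := by
      ext ω; simp only [mem_ofPred_eq]
      constructor
      · intro h1
        refine ⟨hit Z ω, ⟨hit_nonneg hT Z ω, h1⟩, ?_⟩
        rcases hit_mem hT hc ω with h2 | h2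
        · exact h2
        · linarith
      · rintro ⟨u, hu, h1⟩
        exact (hit_le_of hT ⟨hu.1, hu.2.trans ht.2⟩ h1).trans hu.2
    rw [this]
    exact @meas_exists_le _ (Fplus T t) Z hc t ht.1 fun u hu =>
      (hm u ⟨hu.1, hu.2.trans ht.2⟩).mono (Fplus_mono T hu.2) le_rfl
  · have : {ω | hit Z ω ≤ t} = univ := by
      ext ω; simp only [mem_ofPred_eq, mem_univ, iff_true]
      exact (hit_le hT Z ω).trans (not_lt.1 h)
    rw [this]; exact @MeasurableSet.univ _ (Fplus T t)

/-! restriction -/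
theorem measAtStop_const {T : ℝ} {τ : Path T → ℝ} (hτ : IsStopPlus T τ) (c : ℝ) :
    MeasAtStopPlus T τ (fun _ => c) := by
  rw [measAtStop_iff hτ]; intro t ht
  exact @measInd _ (Fplus T t) _ _ (@measurable_const _ _ _ (Fplus T t) _) (hτ t ht)

theorem measAtStop_restrict {T : ℝ} {a τ h : Path T → ℝ} (ha : IsStopPlus T a)
    (hτ : IsStopPlus T τ) (a0 : ∀ ω, 0 ≤ a ω) (τ0 : ∀ ω, 0 ≤ τ ω) (hh : MeasAtStopPlus T a h) :
    MeasAtStopPlus T τ (fun ω => if a ω ≤ τ ω then h ω else 0) := by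
  rw [measAtStop_iff hτ]
  rw [measAtStop_iff ha] at hh
  intro t ht
  have e : {ω | τ ω ≤ t}.indicator (fun ω => if a ω ≤ τ ω then h ω else 0) =
      ({ω | τ ω ≤ t} ∩ {ω | min (a ω) t ≤ min (τ ω) t}).indicator ({ω | a ω ≤ t}.indicator h) := by
    funext ω
    simp only [indicator, mem_inter_iff, mem_ofPred_eq]
    by_cases h1 : τ ω ≤ t
    · by_cases h2 : a ω ≤ τ ω
      · have h3 := h2.trans h1
        simp [h1, h2, h3]
      · simp only [h1, h2, if_true, if_false, true_and]
        rw [not_le] at h2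
        by_cases h4 : a ω ≤ t
        · rw [if_neg]; rw [min_eq_left h4, min_eq_left h1]; exact not_le.2 h2
        · rw [if_neg h4, ite_self]
    · simp [h1]
  rw [e]
  refine @measInd _ (Fplus T t) _ _ (hh t ht) (@MeasurableSet.inter _ (Fplus T t) _ _ (hτ t ht) ?_)
  exact @measLe _ (Fplus T t) _ _ (ha.measurable_min a0 ht) (hτ.measurable_min τ0 ht)

/-! order statistics -/
def ostat {T : ℝ} {n : ℕ} (c : Fin n → Path T → ℝ) (k : ℕ) (ω : Path T) : ℝ :=
  if h : k < n then c (Tuple.sort (fun i => c i ω) ⟨k, h⟩) ω else T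

theorem ostat_stop {T : ℝ} {n : ℕ} (c : Fin n → Path T → ℝ) (hc : ∀ i, IsStopPlus T (c i)) (k : ℕ) :
    IsStopPlus T (ostat c k) := by
  by_cases h : k < n
  · intro t ht
    have e : {ω | ostat c k ω ≤ t} =
        ⋃ s : {s : Finset (Fin n) // k < s.card}, ⋂ i : s.1, {ω | c i ω ≤ t} := by
      ext ω
      simp only [mem_ofPred_eq, mem_iUnion, mem_iInter, ostat, dif_pos h]
      have := Tuple.lt_card_le_iff_apply_le_of_monotone (n := n) (f := (fun i => c i ω) ∘ Tuple.sort (fun i => c i ω)) (a := t) (h_sorted := Tuple.monotone_sort _) (j := ⟨k, h⟩)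
      simp only [Function.comp] at this
      rw [← this]
      have hcard : (Finset.univ.filter fun i => c (Tuple.sort (fun i => c i ω) i) ω ≤ t).card =
        (Finset.univ.filter fun i => c i ω ≤ t).card := by
        rw [← Fintype.card_subtype, ← Fintype.card_subtype]
        exact Fintype.card_congr ((Tuple.sort fun i => c i ω).subtypeEquiv fun i => Iff.rfl)
      constructor
      · intro h1
        refine ⟨⟨Finset.univ.filter fun i => c i ω ≤ t, ?_⟩, ?_⟩
        · rw [← hcard]; convert h1
        · rintro ⟨i, hi⟩; simpa using hi
      · rintro ⟨s, hs⟩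
        have h2 : s.1.card ≤ (Finset.univ.filter fun i => c i ω ≤ t).card := by
          apply Finset.card_le_card
          intro i hi; simpa using hs ⟨i, hi⟩
        rw [← hcard] at h2
        have h3 := s.2.trans_le h2
        convert h3
    rw [e]
    exact @MeasurableSet.iUnion _ _ (Fplus T t) _ _ fun s => @MeasurableSet.iInter _ _ (Fplus T t) _ _ fun i => hc i t ht
  · have : ostat c k = fun _ => T := by funext ω; simp [ostat, h]
    rw [this]; exact IsStopPlus.const _

theorem ostat_mem {T : ℝ} {n : ℕ} (hT : 0 ≤ T) (c : Fin n → Path T → ℝ) (hc : ∀ i ω, c i ω ∈ Icc 0 T) (k : ℕ) (ω) :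
    ostat c k ω ∈ Icc 0 T := by
  unfold ostat; split_ifs
  · exact hc _ _
  · exact ⟨hT, le_rfl⟩

theorem ostat_mono {T : ℝ} {n : ℕ} (c : Fin n → Path T → ℝ) (hc : ∀ i ω, c i ω ∈ Icc 0 T) (ω) :
    Monotone fun k => ostat c k ω := by
  intro j k hjk
  simp only [ostat]
  by_cases h : k < n
  · rw [dif_pos h, dif_pos (hjk.trans_lt h)]
    exact Tuple.monotone_sort (fun i => c i ω) (show (⟨j, _⟩ : Fin n) ≤ ⟨k, h⟩ from hjk)
  · rw [dif_neg h]
    split_ifs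
    · exact (hc _ _).2
    · exact le_rfl

theorem ostat_surj {T : ℝ} {n : ℕ} (c : Fin n → Path T → ℝ) (ω) (i : Fin n) :
    ∃ k < n, ostat c k ω = c i ω := by
  refine ⟨((Tuple.sort fun i => c i ω).symm i), Fin.is_lt _, ?_⟩
  rw [ostat, dif_pos (Fin.is_lt _)]
  simp

theorem telescope (x : ℝ → ℝ) (y : ℕ → ℝ) (hy : Monotone y) {n j : ℕ} (hj : j ≤ n) :
    ∑ k ∈ Finset.range n, (if y j ≤ y k then (1:ℝ) else 0) * (x (y (k+1)) - x (y k)) =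
      x (y n) - x (y j) := by
  have : ∀ k, (if y j ≤ y k then (1:ℝ) else 0) * (x (y (k+1)) - x (y k)) =
      x (max (y j) (y (k+1))) - x (max (y j) (y k)) := by
    intro k
    split_ifs with h
    · rw [max_eq_right h, max_eq_right (h.trans (hy k.le_succ)), one_mul]
    · have hk : k < j := by
        by_contra hk
        exact h (hy (not_lt.1 hk))
      rw [max_eq_left (not_le.1 h).le, max_eq_left (hy hk)]; simp
  simp only [this]
  rw [Finset.sum_range_sub (fun k => x (max (y j) (y k)))]
  rw [max_eq_right (hy hj), max_eq_left (hy (Nat.zero_le j))]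

end PathwiseSuperhedging

namespace PathwiseSuperhedging

/-- unordered finite families of elementary positions -/
structure Fam (T : ℝ) where
  ι : Type
  ft : Fintype ι
  a : ι → Path T → ℝ
  b : ι → Path T → ℝ
  h : ι → Path T → ℝ
  a0 : ∀ i ω, 0 ≤ a i ω
  ab : ∀ i ω, a i ω ≤ b i ω
  bT : ∀ i ω, b i ω ≤ T
  sa : ∀ i, IsStopPlus T (a i)
  sb : ∀ i, IsStopPlus T (b i)
  bdd : ∀ i, ∃ C, ∀ ω, |h i ω| ≤ C
  hm : ∀ i, MeasAtStopPlus T (a i) (h i)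

instance {T : ℝ} (F : Fam T) : Fintype F.ι := F.ft

namespace Fam
variable {T : ℝ}

def W (F : Fam T) (hT : 0 ≤ T) (t : ℝ) (ω : Path T) : ℝ :=
  ∑ i : F.ι, F.h i ω * (ev T hT ω (min (F.b i ω) t) - ev T hT ω (min (F.a i ω) t))

def coef (F : Fam T) (u : ℝ) (ω : Path T) : ℝ :=
  ∑ i : F.ι, F.h i ω * (if F.a i ω ≤ u ∧ u < F.b i ω then 1 else 0)

theorem W_zero (F : Fam T) (hT : 0 ≤ T) (ω : Path T) : F.W hT 0 ω = 0 := by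
  refine Finset.sum_eq_zero fun i _ => ?_
  rw [min_eq_right (F.a0 i ω), min_eq_right ((F.a0 i ω).trans (F.ab i ω)), sub_self, mul_zero]

theorem W_cont (F : Fam T) (hT : 0 ≤ T) (ω : Path T) : Continuous fun t => F.W hT t ω := by
  unfold W
  refine continuous_finset_sum _ fun i _ => continuous_const.mul (Continuous.sub ?_ ?_)
  · exact (continuous_ev hT ω).comp (continuous_const.min continuous_id)
  · exact (continuous_ev hT ω).comp (continuous_const.min continuous_id)

theorem _root_.PathwiseSuperhedging.measSum {α ι : Type*} {m : MeasurableSpace α} (s : Finset ι) {f : ι → α → ℝ}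
    (h : ∀ i ∈ s, Measurable (f i)) : Measurable (fun x => ∑ i ∈ s, f i x) :=
  Finset.measurable_sum s h

theorem _root_.PathwiseSuperhedging.measSub {α : Type*} {m : MeasurableSpace α} {f g : α → ℝ} (hf : Measurable f)
    (hg : Measurable g) : Measurable (fun x => f x - g x) := hf.sub hg

theorem W_meas (F : Fam T) (hT : 0 ≤ T) {t : ℝ} (ht : t ∈ Icc 0 T) :
    Measurable[Fplus T t] (F.W hT t) := by
  have e : F.W hT t = fun ω => ∑ i : F.ι, ({ω | F.a i ω ≤ t}.indicator (F.h i) ω) *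
      (ev T hT ω (min (F.b i ω) t) - ev T hT ω (min (F.a i ω) t)) := by
    funext ω
    refine Finset.sum_congr rfl fun i _ => ?_
    by_cases h : F.a i ω ≤ t
    · simp [indicator, h]
    · have h1 := (not_le.1 h).le
      rw [min_eq_right h1, min_eq_right (h1.trans (F.ab i ω)), sub_self, mul_zero, mul_zero]
  rw [e]
  refine @measSum _ _ (Fplus T t) _ _ fun i _ => @measMul _ (Fplus T t) _ _ ?_ (@measSub _ (Fplus T t) _ _ ?_ ?_)
  · exact (measAtStop_iff (F.sa i)).1 (F.hm i) t ht
  · exact (F.sb i).measurable_ev hT (fun ω => (F.a0 i ω).trans (F.ab i ω)) ht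
  · exact (F.sa i).measurable_ev hT (F.a0 i) ht

/-- sorted representation -/
theorem sorted (F : Fam T) (hT : 0 ≤ T) : ∃ (L : ℕ) (τ : ℕ → Path T → ℝ) (c : ℕ → Path T → ℝ),
    (∀ k ω, τ k ω ∈ Icc 0 T) ∧ (∀ ω, Monotone fun k => τ k ω) ∧ (∀ k, IsStopPlus T (τ k)) ∧
    (∀ k, MeasAtStopPlus T (τ k) (c k)) ∧ (∀ k, ∃ C, ∀ ω, |c k ω| ≤ C) ∧
    (∀ k ω, c k ω = F.coef (τ k ω) ω) ∧
    ∀ t ω, F.W hT t ω = ∑ k ∈ Finset.range L, c k ω *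
      (ev T hT ω (min (τ (k+1) ω) t) - ev T hT ω (min (τ k ω) t)) := by
  let N := Fintype.card (F.ι ⊕ F.ι)
  let e : Fin N ≃ F.ι ⊕ F.ι := (Fintype.equivFin _).symm
  let g : Fin N → Path T → ℝ := fun j => Sum.elim F.a F.b (e j)
  have gI : ∀ j ω, g j ω ∈ Icc 0 T := by
    intro j ω
    simp only [g]
    rcases e j with i | i
    · exact ⟨F.a0 i ω, (F.ab i ω).trans (F.bT i ω)⟩
    · exact ⟨(F.a0 i ω).trans (F.ab i ω), F.bT i ω⟩
  have gs : ∀ j, IsStopPlus T (g j) := by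
    intro j
    simp only [g]
    rcases e j with i | i
    · exact F.sa i
    · exact F.sb i
  have hst := ostat_stop g gs
  have hmem := ostat_mem hT g gI
  refine ⟨N, ostat g, fun k ω => F.coef (ostat g k ω) ω, hmem, ostat_mono g gI,
    hst, ?_, ?_, fun _ _ => rfl, ?_⟩
  · intro k
    unfold coef
    refine MeasAtStopPlus.sum _ (hst k) fun i _ => ?_
    have e1 : (fun ω => F.h i ω * (if F.a i ω ≤ ostat g k ω ∧ ostat g k ω < F.b i ω then (1:ℝ) else 0)) =
      fun ω => (if F.a i ω ≤ ostat g k ω then F.h i ω else 0) *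
        (1 + (-1) * (if F.b i ω ≤ ostat g k ω then (fun _ => (1:ℝ)) ω else 0)) := by
      funext ω
      by_cases h1 : F.a i ω ≤ ostat g k ω <;> by_cases h2 : F.b i ω ≤ ostat g k ω <;>
        simp [h1, h2, not_lt.2, not_le.1]
    rw [e1]
    refine MeasAtStopPlus.mul (hst k) ?_ (MeasAtStopPlus.add (hst k) (measAtStop_const (hst k) _)
      (MeasAtStopPlus.mul (hst k) (measAtStop_const (hst k) _) ?_))
    · exact measAtStop_restrict (F.sa i) (hst k) (F.a0 i) (fun ω => (hmem k ω).1) (F.hm i)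
    · exact measAtStop_restrict (F.sb i) (hst k) (fun ω => (F.a0 i ω).trans (F.ab i ω))
        (fun ω => (hmem k ω).1) (measAtStop_const (F.sb i) _)
  · intro k
    choose C hC using F.bdd
    refine ⟨∑ i, C i, fun ω => ?_⟩
    refine (Finset.abs_sum_le_sum_abs _ _).trans (Finset.sum_le_sum fun i _ => ?_)
    rw [abs_mul]
    have h1 := hC i ω
    have h2 := (abs_nonneg _).trans h1
    split_ifs <;> simp [h1, h2]
  · intro t ω
    have key : ∀ i : F.ι, ev T hT ω (min (F.b i ω) t) - ev T hT ω (min (F.a i ω) t) =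
        ∑ k ∈ Finset.range N, (if F.a i ω ≤ ostat g k ω ∧ ostat g k ω < F.b i ω then (1:ℝ) else 0) *
          (ev T hT ω (min (ostat g (k+1) ω) t) - ev T hT ω (min (ostat g k ω) t)) := by
      intro i
      obtain ⟨ja, hja, ea⟩ := ostat_surj g ω (e.symm (Sum.inl i))
      obtain ⟨jb, hjb, eb⟩ := ostat_surj g ω (e.symm (Sum.inr i))
      simp only [g, Equiv.apply_symm_apply, Sum.elim_inl, Sum.elim_inr] at ea eb
      have ta := telescope (fun u => ev T hT ω (min u t)) (fun k => ostat g k ω)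
        (ostat_mono g gI ω) hja.le
      have tb := telescope (fun u => ev T hT ω (min u t)) (fun k => ostat g k ω)
        (ostat_mono g gI ω) hjb.le
      simp only [g, ea] at ta
      simp only [g, eb] at tb
      have : ev T hT ω (min (F.b i ω) t) - ev T hT ω (min (F.a i ω) t) =
        (ev T hT ω (min (ostat g N ω) t) - ev T hT ω (min (F.a i ω) t)) -
        (ev T hT ω (min (ostat g N ω) t) - ev T hT ω (min (F.b i ω) t)) := by ring
      rw [this, ← ta, ← tb, ← Finset.sum_sub_distrib]
      refine Finset.sum_congr rfl fun k _ => ?_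
      rw [← sub_mul]
      congr 1
      have hab := F.ab i ω
      change (if F.a i ω ≤ ostat g k ω then (1:ℝ) else 0) - (if F.b i ω ≤ ostat g k ω then (1:ℝ) else 0) = _
      by_cases h1 : F.a i ω ≤ ostat g k ω <;> by_cases h2 : F.b i ω ≤ ostat g k ω
      · simp [h1, h2, not_lt.2]
      · simp [h1, h2, not_le.1]
      · exact absurd (hab.trans h2) h1
      · simp [h1, h2]
    unfold W
    simp only [key, Finset.mul_sum, coef, Finset.sum_mul]
    rw [Finset.sum_comm]
    simp only [mul_assoc]

theorem strat (F : Fam T) (hT : 0 ≤ T) : ∃ H : SimpleStrategy T, ∀ t ω, integ T H (Sproc T hT) t ω = F.W hT t ω := by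
  obtain ⟨L, τ, c, h1, h2, h3, h4, h5, -, h7⟩ := F.sorted hT
  refine ⟨⟨L, fun l => τ l, fun l => c l, fun ω => (h1 _ ω).1, fun l ω => h2 ω (by simp), fun ω => (h1 _ ω).2,
    fun l => h3 l, fun l => h5 l, fun l => h4 l⟩, fun t ω => ?_⟩
  rw [h7]
  simp only [integ, Sproc]
  rw [Finset.sum_range]
  simp

def halt (F : Fam T) (ρ : Path T → ℝ) (hρ : IsStopPlus T ρ) : Fam T where
  ι := F.ι
  ft := F.ft
  a := F.a
  b := fun i ω => max (F.a i ω) (min (F.b i ω) (ρ ω))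
  h := F.h
  a0 := F.a0
  ab := fun i ω => le_max_left _ _
  bT := fun i ω => max_le ((F.ab i ω).trans (F.bT i ω)) ((min_le_left _ _).trans (F.bT i ω))
  sa := F.sa
  sb := fun i => (F.sa i).sup2 ((F.sb i).inf2 hρ)
  bdd := F.bdd
  hm := F.hm

theorem stop_W (F : Fam T) (hT : 0 ≤ T) (ρ : Path T → ℝ) (hρ : IsStopPlus T ρ) (t : ℝ) (ω) :
    (F.halt ρ hρ).W hT t ω = F.W hT (min (ρ ω) t) ω := by
  unfold W halt
  refine Finset.sum_congr rfl fun i _ => ?_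
  simp only
  congr 1
  have hab := F.ab i ω
  rcases le_total (ρ ω) (F.a i ω) with h | h
  · rw [max_eq_left ((min_le_right _ _).trans h), sub_self]
    rw [min_eq_right ((min_le_left _ _).trans h), min_eq_right ((min_le_left _ _).trans (h.trans hab)), sub_self]
  · rw [max_eq_right (le_min hab h), min_assoc, ← min_assoc (F.a i ω), min_eq_left h]

theorem stop_coef (F : Fam T) (ρ : Path T → ℝ) (hρ : IsStopPlus T ρ) (u : ℝ) (ω) :
    (F.halt ρ hρ).coef u ω = if u < ρ ω then F.coef u ω else 0 := by
  unfold coef halt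
  simp only
  split_ifs with h
  · refine Finset.sum_congr rfl fun i _ => ?_
    congr 2
    simp only [lt_max_iff, lt_min_iff, h, and_true, eq_iff_iff]
    constructor
    · rintro ⟨h1, h2 | h2⟩
      · linarith
      · exact ⟨h1, h2⟩
    · rintro ⟨h1, h2⟩; exact ⟨h1, Or.inr h2⟩
  · refine Finset.sum_eq_zero fun i _ => ?_
    rw [if_neg, mul_zero]
    simp only [lt_max_iff, lt_min_iff, h, and_false, or_false, not_and, not_lt]
    exact fun h => h

def add (F G : Fam T) : Fam T where
  ι := F.ι ⊕ G.ι
  ft := inferInstance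
  a := Sum.elim F.a G.a
  b := Sum.elim F.b G.b
  h := Sum.elim F.h G.h
  a0 := by rintro (i | i); exacts [F.a0 i, G.a0 i]
  ab := by rintro (i | i); exacts [F.ab i, G.ab i]
  bT := by rintro (i | i); exacts [F.bT i, G.bT i]
  sa := by rintro (i | i); exacts [F.sa i, G.sa i]
  sb := by rintro (i | i); exacts [F.sb i, G.sb i]
  bdd := by rintro (i | i); exacts [F.bdd i, G.bdd i]
  hm := by rintro (i | i); exacts [F.hm i, G.hm i]

theorem add_W (F G : Fam T) (hT : 0 ≤ T) (t : ℝ) (ω) :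
    (F.add G).W hT t ω = F.W hT t ω + G.W hT t ω := Fintype.sum_sum_type _

theorem add_coef (F G : Fam T) (u : ℝ) (ω) :
    (F.add G).coef u ω = F.coef u ω + G.coef u ω := Fintype.sum_sum_type _

def smul (r : ℝ) (F : Fam T) : Fam T where
  ι := F.ι
  ft := inferInstance
  a := F.a
  b := F.b
  h := fun i ω => r * F.h i ω
  a0 := F.a0
  ab := F.ab
  bT := F.bT
  sa := F.sa
  sb := F.sb
  bdd := fun i => by
    obtain ⟨C, hC⟩ := F.bdd i
    exact ⟨|r| * C, fun ω => by rw [abs_mul]; gcongr; exact hC ω⟩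
  hm := fun i => MeasAtStopPlus.mul (F.sa i) (measAtStop_const (F.sa i) r) (F.hm i)

theorem smul_W (r : ℝ) (F : Fam T) (hT : 0 ≤ T) (t : ℝ) (ω) :
    (F.smul r).W hT t ω = r * F.W hT t ω := by
  simp only [W, Finset.mul_sum, ← mul_assoc]; rfl

theorem smul_coef (r : ℝ) (F : Fam T) (u : ℝ) (ω) :
    (F.smul r).coef u ω = r * F.coef u ω := by
  simp only [coef, Finset.mul_sum, ← mul_assoc]; rfl

/-- admissible strategies from families -/
theorem gg (F : Fam T) (hT : 0 ≤ T) (Ξ : Set (Path T)) {lam : ℝ} (hl : 0 < lam) :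
    ∃ Y, GG T hT Ξ lam Y ∧ ∀ ω, (∀ t ∈ Icc 0 T, 0 < lam + F.W hT t ω) →
      Y ω = ((lam + F.W hT T ω : ℝ) : EReal) := by
  let Z : ℝ → Path T → ℝ := fun t ω => lam + F.W hT t ω
  have hc : ∀ ω, Continuous fun t => Z t ω := fun ω => continuous_const.add (F.W_cont hT ω)
  have hρ : IsStopPlus T (hit Z) := hit_stop hT hc fun t ht =>
    @measAdd _ (Fplus T t) _ _ (@measurable_const _ _ _ (Fplus T t) _) (F.W_meas hT ht)
  obtain ⟨H, hH⟩ := (F.halt _ hρ).strat hT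
  refine ⟨_, GG.base H ?_, ?_⟩
  · intro t ht ω _
    rw [hH, stop_W]
    by_contra hneg
    rw [not_le] at hneg
    set s := min (hit Z ω) t with hs
    have hs0 : 0 ≤ s := le_min (hit_nonneg hT Z ω) ht.1
    have hsT : s ≤ T := (min_le_right _ _).trans ht.2
    have h0 : 0 < Z 0 ω := by simp only [Z, W_zero, add_zero]; exact hl
    have h1 : Z s ω < 0 := hneg
    obtain ⟨u, hu, hu0⟩ := intermediate_value_Icc' hs0 (hc ω).continuousOn
      (show (0:ℝ) ∈ Icc (Z s ω) (Z 0 ω) from ⟨h1.le, h0.le⟩)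
    have h2 : hit Z ω ≤ u := hit_le_of hT ⟨hu.1, hu.2.trans hsT⟩ hu0.le
    have h3 : u < s := lt_of_le_of_ne hu.2 (by rintro rfl; simp only at hu0; linarith)
    have h4 : s ≤ hit Z ω := min_le_left _ _
    linarith
  · intro ω hω
    rw [hH, stop_W]
    have : hit Z ω = T := by
      rcases hit_mem hT hc ω with h | h
      · exact absurd h (not_le.2 (hω _ ⟨hit_nonneg hT Z ω, hit_le hT Z ω⟩))
      · exact h
    rw [this, min_self]

end Fam
end PathwiseSuperhedging

namespace PathwiseSuperhedging

theorem intb {α : Type*} {m : MeasurableSpace α} {Q : Measure α} [IsFiniteMeasure Q] {f : α → ℝ} (hf : Measurable f) {C : ℝ}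
    (hC : ∀ᵐ x ∂Q, |f x| ≤ C) : Integrable f Q :=
  Integrable.of_bound hf.aestronglyMeasurable C hC

theorem os_incr {T : ℝ} (hT : 0 ≤ T) (Q : Measure (Path T)) [IsProbabilityMeasure Q]
    (hM : IsMart T Q (Sproc T hT)) {R : ℝ} (hR : ∀ᵐ ω ∂Q, ∀ t, |ev T hT ω t| ≤ R)
    {τ θ : Path T → ℝ} (hτ : IsStopPlus T τ) (hθ : IsStopPlus T θ)
    (h0 : ∀ ω, 0 ≤ τ ω) (hle : ∀ ω, τ ω ≤ θ ω) (h1 : ∀ ω, θ ω ≤ T)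
    {Z : Path T → ℝ} (hZ : MeasAtStopPlus T τ Z) {C : ℝ} (hC : ∀ᵐ ω ∂Q, |Z ω| ≤ C) :
    ∫ ω, Z ω * (ev T hT ω (θ ω) - ev T hT ω (τ ω)) ∂Q = 0 := by
  obtain ⟨ω0, hω0⟩ := hC.exists
  have C0 : 0 ≤ C := (abs_nonneg _).trans hω0
  let Z' : Path T → ℝ := fun ω => max (-C) (min C (Z ω))
  have hZ' : MeasAtStopPlus T τ Z' := hZ.comp (φ := fun x => max (-C) (min C x)) (by fun_prop)
  have hb : ∀ ω, |Z' ω| ≤ C := fun ω => abs_le.2 ⟨le_max_left _ _, max_le (by linarith) (min_le_left _ _)⟩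
  have he : ∀ᵐ ω ∂Q, Z ω = Z' ω := by
    filter_upwards [hC] with ω h
    obtain ⟨h2, h3⟩ := abs_le.1 h
    simp only [Z']; rw [min_eq_right h3, max_eq_right h2]
  have hcS : ∀ ω, Continuous fun t => Sproc T hT t ω := fun ω => continuous_ev hT ω
  have hmS : ∀ t ∈ Icc (0:ℝ) T, Measurable[Fraw T t] (Sproc T hT t) :=
    fun t ht => measurable_ev_Fraw hT ht le_rfl
  have A1 := optional_stopping hT Q _ hcS hmS hM h0 (fun ω => (hle ω).trans (h1 ω)) hZ' C hb
  have A2 := optional_stopping hT Q _ hcS hmS hM (fun ω => (h0 ω).trans (hle ω)) h1 (hZ'.mono hθ hle) C hb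
  have mZ : Measurable Z' := hZ'.measurable hT (fun ω => (hle ω).trans (h1 ω))
  have I1 : Integrable (fun ω => Z' ω * Sproc T hT (τ ω) ω) Q :=
    A1.1.bdd_mul mZ.aestronglyMeasurable (Eventually.of_forall hb)
  have I2 : Integrable (fun ω => Z' ω * Sproc T hT (θ ω) ω) Q :=
    A2.1.bdd_mul mZ.aestronglyMeasurable (Eventually.of_forall hb)
  have : ∫ ω, Z ω * (ev T hT ω (θ ω) - ev T hT ω (τ ω)) ∂Q
      = ∫ ω, (Z' ω * Sproc T hT (θ ω) ω - Z' ω * Sproc T hT (τ ω) ω) ∂Q := by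
    refine integral_congr_ae ?_
    filter_upwards [he] with ω h
    rw [h, mul_sub]; rfl
  rw [this, integral_sub I2 I1, A1.2, A2.2, sub_self]

theorem isometry {T : ℝ} (hT : 0 ≤ T) (Q : Measure (Path T)) [IsProbabilityMeasure Q]
    (hM : IsMart T Q (Sproc T hT)) {R : ℝ} (hR : ∀ᵐ ω ∂Q, ∀ t, |ev T hT ω t| ≤ R)
    (F : Fam T) {C : ℝ} (hC : ∀ᵐ ω ∂Q, ∀ u, |F.coef u ω| ≤ C) :
    Integrable (fun ω => (F.W hT T ω)^2) Q ∧ ∫ ω, (F.W hT T ω)^2 ∂Q ≤ C^2 * R^2 := by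
  obtain ⟨L, τ, c, hmem, hmono, hst, hcm, hcb, hcoef, hW⟩ := F.sorted hT
  let x : ℕ → Path T → ℝ := fun k ω => ev T hT ω (τ k ω)
  let M : ℕ → Path T → ℝ := fun k ω => ∑ j ∈ Finset.range k, c j ω * (x (j+1) ω - x j ω)
  have R0 : 0 ≤ R := by
    obtain ⟨ω0, h⟩ := hR.exists; exact (abs_nonneg _).trans (h 0)
  have C0 : 0 ≤ C := by
    obtain ⟨ω0, h⟩ := hC.exists; exact (abs_nonneg _).trans (h 0)
  have xs : ∀ j k, j ≤ k → MeasAtStopPlus T (τ k) (x j) := fun j k h =>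
    measAtStop_ev hT (hst k) (hst j) (fun ω => (hmem j ω).1) (fun ω => hmono ω h)
  have ds : ∀ j k, j + 1 ≤ k → MeasAtStopPlus T (τ k) (fun ω => x (j+1) ω - x j ω) := by
    intro j k h
    have := MeasAtStopPlus.add (hst k) (xs (j+1) k h)
      (MeasAtStopPlus.mul (hst k) (measAtStop_const (hst k) (-1)) (xs j k (by omega)))
    simpa [sub_eq_add_neg] using this
  have Ms : ∀ k, MeasAtStopPlus T (τ k) (M k) := by
    intro k
    refine MeasAtStopPlus.sum _ (hst k) fun j hj => ?_
    have hj := Finset.mem_range.1 hj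
    exact MeasAtStopPlus.mul (hst k) ((hcm j).mono (hst k) fun ω => hmono ω hj.le) (ds j k hj)
  have xm : ∀ k, Measurable (x k) := fun k => (xs k k le_rfl).measurable hT fun ω => (hmem k ω).2
  have cm : ∀ k, Measurable (c k) := fun k => (hcm k).measurable hT fun ω => (hmem k ω).2
  have Mm : ∀ k, Measurable (M k) := fun k => (Ms k).measurable hT fun ω => (hmem k ω).2
  choose B hB using hcb
  have dbd : ∀ᵐ ω ∂Q, ∀ j, |x (j+1) ω - x j ω| ≤ 2 * R := by
    filter_upwards [hR] with ω h j
    have h1 := abs_le.1 (h (τ (j+1) ω)); have h2 := abs_le.1 (h (τ j ω))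
    exact abs_le.2 ⟨by simp only [x]; linarith, by simp only [x]; linarith⟩
  have xbd : ∀ k, ∀ᵐ ω ∂Q, |x k ω| ≤ R := fun k => hR.mono fun ω h => h _
  have B0 : ∀ k, 0 ≤ B k := fun k => (abs_nonneg _).trans (hB k (Classical.choice ⟨0⟩))
  have Mbd : ∀ k, ∀ᵐ ω ∂Q, |M k ω| ≤ ∑ j ∈ Finset.range k, B j * (2 * R) := by
    intro k
    filter_upwards [dbd] with ω h
    refine (Finset.abs_sum_le_sum_abs _ _).trans (Finset.sum_le_sum fun j _ => ?_)
    rw [abs_mul]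
    exact mul_le_mul (hB j ω) (h j) (abs_nonneg _) (B0 j)
  have x2 : ∀ k, Integrable (fun ω => x k ω ^ 2) Q := fun k =>
    intb ((xm k).pow_const 2) (C := R^2) ((xbd k).mono fun ω h => by
      rw [abs_pow]; exact pow_le_pow_left₀ (abs_nonneg _) h 2)
  have M2 : ∀ k, Integrable (fun ω => M k ω ^ 2) Q := fun k =>
    intb ((Mm k).pow_const 2) (C := (∑ j ∈ Finset.range k, B j * (2 * R))^2) ((Mbd k).mono fun ω h => by
      rw [abs_pow]; exact pow_le_pow_left₀ (abs_nonneg _) h 2)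
  have ind : ∀ k, ∫ ω, M k ω ^ 2 ∂Q ≤ C^2 * (∫ ω, x k ω ^ 2 ∂Q - ∫ ω, x 0 ω ^ 2 ∂Q) := by
    intro k
    induction k with
    | zero => simp [M]
    | succ k ih =>
      have o1 : ∫ ω, (M k ω * c k ω) * (x (k+1) ω - x k ω) ∂Q = 0 :=
        os_incr hT Q hM hR (hst k) (hst (k+1)) (fun ω => (hmem k ω).1) (fun ω => hmono ω (Nat.le_succ k))
          (fun ω => (hmem (k+1) ω).2) (MeasAtStopPlus.mul (hst k) (Ms k) (hcm k))
          (C := (∑ j ∈ Finset.range k, B j * (2 * R)) * B k) ((Mbd k).mono fun ω h => by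
            rw [abs_mul]
            exact mul_le_mul h (hB k ω) (abs_nonneg _) ((abs_nonneg _).trans h))
      have o2 : ∫ ω, x k ω * (x (k+1) ω - x k ω) ∂Q = 0 :=
        os_incr hT Q hM hR (hst k) (hst (k+1)) (fun ω => (hmem k ω).1) (fun ω => hmono ω (Nat.le_succ k))
          (fun ω => (hmem (k+1) ω).2) (xs k k le_rfl) (xbd k)
      have i1 : Integrable (fun ω => (M k ω * c k ω) * (x (k+1) ω - x k ω)) Q :=
        intb (((Mm k).mul (cm k)).mul ((xm (k+1)).sub (xm k)))
          (C := ((∑ j ∈ Finset.range k, B j * (2 * R)) * B k) * (2 * R)) (by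
          filter_upwards [Mbd k, dbd] with ω h h'
          rw [abs_mul, abs_mul]
          have := (abs_nonneg _).trans h
          exact mul_le_mul (mul_le_mul h (hB k ω) (abs_nonneg _) this) (h' k) (abs_nonneg _)
            (mul_nonneg this (B0 k)))
      have i2 : Integrable (fun ω => x k ω * (x (k+1) ω - x k ω)) Q :=
        intb ((xm k).mul ((xm (k+1)).sub (xm k))) (C := R * (2 * R)) (by
          filter_upwards [xbd k, dbd] with ω h h'
          rw [abs_mul]
          exact mul_le_mul h (h' k) (abs_nonneg _) R0)
      have step : ∫ ω, M (k+1) ω ^ 2 ∂Q ≤ ∫ ω, (M k ω ^ 2 + 2 * ((M k ω * c k ω) * (x (k+1) ω - x k ω))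
          + C^2 * ((x (k+1) ω ^ 2 - x k ω ^ 2) - 2 * (x k ω * (x (k+1) ω - x k ω)))) ∂Q := by
        refine integral_mono_ae (M2 _) (((M2 k).add (i1.const_mul 2)).add
          ((((x2 _).sub (x2 _)).sub (i2.const_mul 2)).const_mul _)) ?_
        filter_upwards [hC] with ω h
        have h1 := h (τ k ω)
        rw [← hcoef] at h1
        have h2 : c k ω ^ 2 ≤ C^2 := by
          rw [← sq_abs]; exact pow_le_pow_left₀ (abs_nonneg _) h1 2
        have h3 := mul_le_mul_of_nonneg_right h2 (sq_nonneg (x (k+1) ω - x k ω))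
        have h4 : M (k+1) ω = M k ω + c k ω * (x (k+1) ω - x k ω) := Finset.sum_range_succ _ _
        rw [h4]
        nlinarith [h3]
      have e2 : ∫ ω, (M k ω ^ 2 + 2 * ((M k ω * c k ω) * (x (k+1) ω - x k ω))
          + C^2 * ((x (k+1) ω ^ 2 - x k ω ^ 2) - 2 * (x k ω * (x (k+1) ω - x k ω)))) ∂Q =
          ∫ ω, M k ω ^ 2 ∂Q + C^2 * (∫ ω, x (k+1) ω ^ 2 ∂Q - ∫ ω, x k ω ^ 2 ∂Q) := by
        have a1 := integral_add ((M2 k).add (i1.const_mul 2))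
          ((((x2 (k+1)).sub (x2 k)).sub (i2.const_mul 2)).const_mul (C^2))
        have a2 := integral_add (M2 k) (i1.const_mul 2)
        have a3 := integral_sub ((x2 (k+1)).sub (x2 k)) (i2.const_mul 2)
        have a4 := integral_sub (x2 (k+1)) (x2 k)
        simp only [integral_const_mul, Pi.add_apply, Pi.sub_apply, o1, o2] at a1 a2 a3 a4
        rw [a1, a2, a3, a4]; ring
      rw [e2] at step
      linarith
  have hWM : ∀ ω, F.W hT T ω = M L ω := by
    intro ω; rw [hW]
    refine Finset.sum_congr rfl fun k _ => ?_
    rw [min_eq_left (hmem _ ω).2, min_eq_left (hmem _ ω).2]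
  simp only [hWM]
  refine ⟨M2 L, (ind L).trans ?_⟩
  have : ∫ ω, x L ω ^ 2 ∂Q ≤ R^2 := by
    have := integral_mono_ae (x2 L) (integrable_const (R^2)) ((xbd L).mono fun ω h => by
      show x L ω ^ 2 ≤ R^2
      rw [← sq_abs]; exact pow_le_pow_left₀ (abs_nonneg _) h 2)
    simpa using this
  have h0 : 0 ≤ ∫ ω, x 0 ω ^ 2 ∂Q := integral_nonneg fun ω => sq_nonneg _
  exact mul_le_mul_of_nonneg_left (by linarith) (sq_nonneg _)

theorem maximal {T : ℝ} (hT : 0 ≤ T) (Q : Measure (Path T)) [IsProbabilityMeasure Q]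
    (hM : IsMart T Q (Sproc T hT)) {R : ℝ} (hR : ∀ᵐ ω ∂Q, ∀ t, |ev T hT ω t| ≤ R)
    (F : Fam T) {C : ℝ} (hC : ∀ᵐ ω ∂Q, ∀ u, |F.coef u ω| ≤ C) {ε : ℝ} (hε : 0 < ε) :
    Q {ω | ∃ t ∈ Icc 0 T, ε ≤ |F.W hT t ω|} ≤ ENNReal.ofReal (C^2 * R^2 / ε^2) := by
  let Z : ℝ → Path T → ℝ := fun t ω => ε - |F.W hT t ω|
  have hc : ∀ ω, Continuous fun t => Z t ω := fun ω => continuous_const.sub (F.W_cont hT ω).abs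
  have hρ : IsStopPlus T (hit Z) := hit_stop hT hc fun t ht =>
    @measSub _ (Fplus T t) _ _ (@measurable_const _ _ _ (Fplus T t) _)
      ((@Measurable.comp _ _ _ (Fplus T t) _ _ _ _ continuous_abs.measurable (F.W_meas hT ht)))
  have hC' : ∀ᵐ ω ∂Q, ∀ u, |(F.halt (hit Z) hρ).coef u ω| ≤ C := by
    filter_upwards [hC] with ω h u
    rw [Fam.stop_coef]; split_ifs
    · exact h u
    · simpa using (abs_nonneg _).trans (h u)
  obtain ⟨hi, hb⟩ := isometry hT Q hM hR (F.halt (hit Z) hρ) hC'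
  have hsub : {ω | ∃ t ∈ Icc 0 T, ε ≤ |F.W hT t ω|} ⊆ {ω | ε^2 ≤ ((F.halt (hit Z) hρ).W hT T ω)^2} := by
    rintro ω ⟨t, ht, h⟩
    show ε^2 ≤ _
    rw [Fam.stop_W, min_eq_left (hit_le hT _ _), ← sq_abs (F.W _ _ _)]
    refine pow_le_pow_left₀ hε.le ?_ 2
    rcases hit_mem hT hc ω with h1 | h1
    · simp only [Z] at h1; linarith
    · have h2 : hit Z ω ≤ t := hit_le_of hT ht (by simp only [Z]; linarith)
      have : t = hit Z ω := le_antisymm (by rw [h1]; exact ht.2) h2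
      rwa [← this]
  have hm := mul_meas_ge_le_integral_of_nonneg (μ := Q) (f := fun ω => ((F.halt (hit Z) hρ).W hT T ω)^2)
    (Eventually.of_forall fun ω => sq_nonneg _) hi (ε^2)
  have hε2 : 0 < ε^2 := by positivity
  calc Q _ ≤ Q {ω | ε^2 ≤ ((F.halt (hit Z) hρ).W hT T ω)^2} := measure_mono hsub
    _ = ENNReal.ofReal (Q.real {ω | ε^2 ≤ ((F.halt (hit Z) hρ).W hT T ω)^2}) := by
      rw [Measure.real, ENNReal.ofReal_toReal (measure_ne_top _ _)]
    _ ≤ _ := by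
      refine ENNReal.ofReal_le_ofReal ?_
      rw [le_div_iff₀ hε2, mul_comm]
      exact hm.trans hb

end PathwiseSuperhedging

namespace PathwiseSuperhedging

section sigfacts
variable {T : ℝ} (hT : 0 ≤ T) (m : ℕ) (ω : Path T)

abbrev sigSet (k : ℕ) : Set ℝ := {t : ℝ | sig T hT m k ω ≤ t ∧ t ≤ T ∧
        (2:ℝ) ^ (-(m:ℤ)) ≤ |ev T hT ω t - ev T hT ω (sig T hT m k ω)|} ∪ {T + 1}

theorem sig_succ (k : ℕ) : sig T hT m (k+1) ω = sInf (sigSet hT m ω k) := rfl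

theorem epos : (0:ℝ) < (2:ℝ) ^ (-(m:ℤ)) := by positivity

theorem sig_le (k : ℕ) : sig T hT m k ω ≤ T + 1 ∧ BddBelow (sigSet hT m ω k) ∧
    sig T hT m k ω ≤ sig T hT m (k+1) ω := by
  have step : ∀ k, sig T hT m k ω ≤ T + 1 → BddBelow (sigSet hT m ω k) ∧
      sig T hT m k ω ≤ sig T hT m (k+1) ω := by
    intro k h
    have hb : ∀ t ∈ sigSet hT m ω k, sig T hT m k ω ≤ t := by
      rintro t (ht | ht)
      · exact ht.1
      · rw [mem_singleton_iff.1 ht]; exact h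
    exact ⟨⟨_, hb⟩, by rw [sig_succ]; exact le_csInf ⟨T+1, Or.inr rfl⟩ hb⟩
  have h1 : sig T hT m k ω ≤ T + 1 := by
    induction k with
    | zero => show (0:ℝ) ≤ T + 1; linarith
    | succ k ih => rw [sig_succ]; exact csInf_le (step k ih).1 (Or.inr rfl)
  exact ⟨h1, step k h1⟩

theorem sig_mono : Monotone fun k => sig T hT m k ω :=
  monotone_nat_of_le_succ fun k => (sig_le hT m ω k).2.2

theorem sig_nonneg (k : ℕ) : 0 ≤ sig T hT m k ω := sig_mono hT m ω (Nat.zero_le k)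

theorem sig_mem (k : ℕ) : sig T hT m (k+1) ω ∈ sigSet hT m ω k := by
  rw [sig_succ]
  refine IsClosed.csInf_mem ?_ ⟨T+1, Or.inr rfl⟩ (sig_le hT m ω k).2.1
  refine IsClosed.union ?_ isClosed_singleton
  have hc := continuous_ev hT ω
  exact (isClosed_le continuous_const continuous_id).inter ((isClosed_le continuous_id continuous_const).inter
    (isClosed_le continuous_const ((hc.sub continuous_const).abs)))

theorem sig_jump {k : ℕ} (h : sig T hT m (k+1) ω ≤ T) :
    (2:ℝ) ^ (-(m:ℤ)) ≤ |ev T hT ω (sig T hT m (k+1) ω) - ev T hT ω (sig T hT m k ω)| := by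
  rcases sig_mem hT m ω k with h1 | h1
  · exact h1.2.2
  · rw [mem_singleton_iff.1 h1] at h; linarith

theorem sig_small {k : ℕ} {u : ℝ} (h : sig T hT m k ω ≤ u) (h2 : u < sig T hT m (k+1) ω) (h3 : u ≤ T) :
    |ev T hT ω u - ev T hT ω (sig T hT m k ω)| < (2:ℝ) ^ (-(m:ℤ)) := by
  by_contra hc
  rw [not_lt] at hc
  rw [sig_succ] at h2
  exact absurd (csInf_le (sig_le hT m ω k).2.1 (Or.inl ⟨h, h3, hc⟩)) (not_le.2 h2)

theorem sig_finite {δ : ℝ} (hδ : ∀ u v, |u - v| < δ → |ev T hT ω u - ev T hT ω v| < (2:ℝ) ^ (-(m:ℤ)))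
    {N : ℕ} (hN : T < N * δ) : T < sig T hT m N ω := by
  have : ∀ k : ℕ, sig T hT m k ω ≤ T → k * δ ≤ sig T hT m k ω := by
    intro k
    induction k with
    | zero => intro _; simp [sig]
    | succ k ih =>
      intro h
      have h1 := (sig_le hT m ω k).2.2
      have h2 := ih (h1.trans h)
      have h3 := sig_jump hT m ω h
      have h4 : δ ≤ sig T hT m (k+1) ω - sig T hT m k ω := by
        by_contra hc
        exact absurd (hδ _ _ (by rw [abs_of_nonneg (by linarith)]; exact not_le.1 hc)) (not_lt.2 h3)
      push_cast; linarith
  by_contra hc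
  have := this N (not_lt.1 hc)
  linarith

theorem ev_unif {ε : ℝ} (hε : 0 < ε) : ∃ δ > 0, ∀ u v, |u - v| < δ → |ev T hT ω u - ev T hT ω v| < ε := by
  have h1 := CompactSpace.uniformContinuous_of_continuous ω.continuous
  rw [Metric.uniformContinuous_iff] at h1
  obtain ⟨δ, hδ, h⟩ := h1 ε hε
  refine ⟨δ, hδ, fun u v huv => h (lt_of_le_of_lt ?_ huv)⟩
  rw [Subtype.dist_eq, Real.dist_eq]
  simp only [clamp, coe_projIcc]
  rw [max_comm 0 (min T u), max_comm 0 (min T v)]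
  exact (abs_max_sub_max_le_abs _ _ _).trans (by
    have := abs_min_sub_min_le_max T u T v
    simpa using this)

theorem sig_exists : ∃ N, T < sig T hT m N ω := by
  obtain ⟨δ, hδ, h⟩ := ev_unif hT ω (epos m)
  obtain ⟨N, hN⟩ := exists_nat_gt (T / δ)
  exact ⟨N, sig_finite hT m ω h (by rwa [div_lt_iff₀ hδ] at hN)⟩

abbrev smT (t : ℝ) (k : ℕ) : ℝ := ev T hT ω (min (sig T hT m k ω) t) *
    (ev T hT ω (min (sig T hT m (k + 1) ω) t) - ev T hT ω (min (sig T hT m k ω) t))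

theorem smT_eq (t : ℝ) (k : ℕ) : ev T hT ω (sig T hT m k ω) *
    (ev T hT ω (min (sig T hT m (k + 1) ω) t) - ev T hT ω (min (sig T hT m k ω) t)) = smT hT m ω t k := by
  by_cases h : sig T hT m k ω ≤ t
  · simp only [smT, min_eq_left h]
  · have h1 := (not_le.1 h).le
    simp only [smT, min_eq_right h1, min_eq_right (h1.trans (sig_le hT m ω k).2.2), sub_self, mul_zero]

theorem smT_zero {t : ℝ} {N : ℕ} (hN : t ≤ sig T hT m N ω) {k : ℕ} (hk : N ≤ k) :
    smT hT m ω t k = 0 := by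
  have h1 := hN.trans (sig_mono hT m ω hk)
  simp only [smT, min_eq_right h1, min_eq_right (h1.trans (sig_le hT m ω k).2.2), sub_self, mul_zero]

theorem Sm_eq_sum {t : ℝ} {N : ℕ} (hN : t ≤ sig T hT m N ω) :
    Sm T hT m t ω = ∑ k ∈ Finset.range N, smT hT m ω t k := by
  unfold Sm
  simp only [smT_eq]
  refine tsum_eq_sum fun k hk => smT_zero hT m ω hN (by simpa using hk)

theorem Sm_tendsto {t : ℝ} (ht : t ≤ T) :
    Tendsto (fun N => ∑ k ∈ Finset.range N, smT hT m ω t k) atTop (𝓝 (Sm T hT m t ω)) := by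
  obtain ⟨N, hN⟩ := sig_exists hT m ω
  refine tendsto_const_nhds.congr' ?_
  filter_upwards [eventually_ge_atTop N] with n hn
  exact Sm_eq_sum hT m ω (ht.trans (hN.le.trans (sig_mono hT m ω hn)))

theorem Sm_cont : ContinuousOn (fun t => Sm T hT m t ω) (Iic T) := by
  obtain ⟨N, hN⟩ := sig_exists hT m ω
  have hc := continuous_ev hT ω
  have h : ∀ t ∈ Iic T, Sm T hT m t ω = ∑ k ∈ Finset.range N, smT hT m ω t k :=
    fun t ht => Sm_eq_sum hT m ω (le_trans ht hN.le)
  refine ContinuousOn.congr (Continuous.continuousOn ?_) h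
  refine continuous_finsetSum _ fun k _ => ?_
  exact (hc.comp (continuous_const.min continuous_id)).mul
    ((hc.comp (continuous_const.min continuous_id)).sub (hc.comp (continuous_const.min continuous_id)))

end sigfacts

section meas
variable {T : ℝ} (hT : 0 ≤ T)

theorem sig_stop (m k : ℕ) : IsStopRaw T (sig T hT m k) := by
  induction k with
  | zero => intro t ht; simp only [sig]; exact @MeasurableSet.const _ (Fraw T t) _
  | succ k ih =>
    intro t ht
    let Z : ℝ → Path T → ℝ := fun u ω => (2:ℝ) ^ (-(m:ℤ)) -
      |ev T hT ω (min (max u (max 0 (min (sig T hT m k ω) t))) t) - ev T hT ω (min (sig T hT m k ω) t)|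
    have hcZ : ∀ ω, Continuous fun u => Z u ω := by
      intro ω
      have hc := continuous_ev hT ω
      exact continuous_const.sub ((hc.comp ((continuous_id.max continuous_const).min continuous_const)).sub
        continuous_const).abs
    have hmin := ih.measurable_min ht
    have hmZ : ∀ u ∈ Icc (0:ℝ) t, Measurable[Fraw T t] (Z u) := by
      intro u hu
      have h1 : Measurable[Fraw T t] (fun ω => min (max u (max 0 (min (sig T hT m k ω) t))) t) :=
        @Measurable.comp _ _ _ (Fraw T t) _ _ (fun x : ℝ => min (max u x) t) _ (by fun_prop) hmin
      have h2 := measurable_ev_min hT ht (m := Fraw T t) le_rfl h1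
      have h3 := ih.measurable_ev hT ht
      exact @measSub _ (Fraw T t) _ _ (@measurable_const _ _ _ (Fraw T t) _)
        (@Measurable.comp _ _ _ (Fraw T t) _ _ _ _ continuous_abs.measurable (@measSub _ (Fraw T t) _ _ h2 h3))
    have := @meas_exists_le _ (Fraw T t) Z hcZ t ht.1 hmZ
    convert this using 1
    ext ω
    simp only [mem_ofPred_eq, Z]
    have h0 := sig_nonneg hT m ω k
    have h1 := (sig_le hT m ω k).2.2
    constructor
    · intro h
      refine ⟨sig T hT m (k+1) ω, ⟨h0.trans h1, h⟩, ?_⟩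
      rw [min_eq_left (h1.trans h), max_eq_right h0, max_eq_left h1, min_eq_left h]
      linarith [sig_jump hT m ω (h.trans ht.2)]
    · rintro ⟨u, hu, h⟩
      have hk : sig T hT m k ω ≤ u := by
        by_contra hcc
        rw [not_le] at hcc
        have hle : u ≤ max 0 (min (sig T hT m k ω) t) := le_max_of_le_right (le_min hcc.le hu.2)
        rw [max_eq_right hle, max_eq_right (le_min h0 ht.1), min_eq_left (min_le_right _ _), sub_self, abs_zero] at h
        linarith [epos m]
      rw [min_eq_left (hk.trans hu.2), max_eq_right h0, max_eq_left hk, min_eq_left hu.2] at h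
      by_contra hcc
      have := sig_small hT m ω hk (lt_of_le_of_lt hu.2 (not_le.1 hcc)) (hu.2.trans ht.2)
      linarith

theorem measLim {α : Type*} {m : MeasurableSpace α} {f : ℕ → α → ℝ} {g : α → ℝ} (hf : ∀ n, Measurable (f n))
    (h : ∀ x, Tendsto (fun n => f n x) atTop (𝓝 (g x))) : Measurable g :=
  measurable_of_tendsto_metrizable hf (tendsto_pi_nhds.2 h)

theorem measLiminf {α : Type*} {m : MeasurableSpace α} {f : ℕ → α → ℝ} (hf : ∀ n, Measurable (f n)) :
    Measurable (fun x => liminf (fun n => f n x) atTop) := Measurable.liminf hf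

theorem Sm_meas (m : ℕ) {t : ℝ} (ht : t ∈ Icc 0 T) : Measurable[Fraw T t] (Sm T hT m t) := by
  refine @measLim _ (Fraw T t) _ _ (fun N => ?_) fun ω => Sm_tendsto hT m ω ht.2
  refine @measSum _ _ (Fraw T t) _ _ fun k _ => ?_
  exact @measMul _ (Fraw T t) _ _ ((sig_stop hT m k).measurable_ev hT ht)
    (@measSub _ (Fraw T t) _ _ ((sig_stop hT m (k+1)).measurable_ev hT ht) ((sig_stop hT m k).measurable_ev hT ht))

theorem SS_meas {t : ℝ} (ht : t ∈ Icc 0 T) : Measurable[Fraw T t] (SS T hT t) :=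
  @measLiminf _ (Fraw T t) _ fun m => Sm_meas hT m ht

theorem measConst {α : Type*} {m : MeasurableSpace α} (c : ℝ) : Measurable (fun _ : α => c) := measurable_const

theorem measComp {α : Type*} {m : MeasurableSpace α} {φ : ℝ → ℝ} {f : α → ℝ} (hφ : Measurable φ)
   (hf : Measurable f) : Measurable (fun x => φ (f x)) := hφ.comp hf

theorem qvRaw_meas {t : ℝ} (ht : t ∈ Icc 0 T) : Measurable[Fraw T t] (fun ω => qvRaw T hT ω t) := by
  unfold qvRaw
  have h2 : Measurable (fun x : ℝ => x^2) := by fun_prop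
  have h3 : Measurable (fun x : ℝ => 2*x) := by fun_prop
  exact @measSub _ (Fraw T t) _ _ (@measSub _ (Fraw T t) _ _
    (@measComp _ (Fraw T t) _ _ h2 (measurable_ev_Fraw hT ht le_rfl))
    (@measComp _ (Fraw T t) _ _ h2 (measurable_ev_Fraw hT ht ht.1)))
    (@measComp _ (Fraw T t) _ _ h3 (SS_meas hT ht))

end meas

/-- clipping -/
def clip (N : ℕ) (x : ℝ) : ℝ := max (-(N:ℝ)) (min N x)

theorem clip_abs (N : ℕ) (x : ℝ) : |clip N x| ≤ N :=
  abs_le.2 ⟨le_max_left _ _, max_le (by linarith [(Nat.cast_nonneg N : (0:ℝ) ≤ N)]) (min_le_left _ _)⟩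

theorem clip_eq {N : ℕ} {x : ℝ} (h : |x| ≤ N) : clip N x = x := by
  rw [abs_le] at h
  rw [clip, min_eq_right h.2, max_eq_right h.1]

theorem clip_meas (N : ℕ) : Measurable (clip N) := by unfold clip; fun_prop

section fams
variable {T : ℝ} (hT : 0 ≤ T)

/-- position for the discretised integral -/
def famI (m N : ℕ) {s t : ℝ} (hs : 0 ≤ s) (hst : s ≤ t) (ht : t ≤ T) (c : Path T → ℝ)
    (hc : Measurable[Fraw T s] c) : Fam T where
  ι := Fin N
  ft := inferInstance
  a := fun k ω => max s (min (sig T hT m k ω) t)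
  b := fun k ω => max s (min (sig T hT m (k+1) ω) t)
  h := fun k ω => clip N (c ω) * clip N (ev T hT ω (min (sig T hT m k ω) t))
  a0 := fun k ω => le_max_of_le_left hs
  ab := fun k ω => max_le_max le_rfl (min_le_min (sig_le hT m ω k).2.2 le_rfl)
  bT := fun k ω => max_le (hst.trans ht) ((min_le_right _ _).trans ht)
  sa := fun k => (IsStopPlus.const s).sup2 ((sig_stop hT m k).plus.inf2 (IsStopPlus.const t))
  sb := fun k => (IsStopPlus.const s).sup2 ((sig_stop hT m (k+1)).plus.inf2 (IsStopPlus.const t))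
  bdd := fun k => ⟨N * N, fun ω => by
    rw [abs_mul]
    exact mul_le_mul (clip_abs _ _) (clip_abs _ _) (abs_nonneg _) (Nat.cast_nonneg _)⟩
  hm := fun k => by
    have hsa := (IsStopPlus.const (T := T) s).sup2 ((sig_stop hT m k).plus.inf2 (IsStopPlus.const t))
    refine MeasAtStopPlus.mul hsa ?_ ?_
    · exact MeasAtStopPlus.comp ((measAtStop_const_time hc (hst.trans ht)).mono hsa
        fun ω => le_max_left _ _) (clip_meas N)
    · exact MeasAtStopPlus.comp (measAtStop_ev hT hsa ((sig_stop hT m k).plus.inf2 (IsStopPlus.const t))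
        (fun ω => le_min (sig_nonneg hT m ω k) (hs.trans hst)) fun ω => le_max_right _ _) (clip_meas N)

theorem famI_W (m N : ℕ) {s t : ℝ} (hs : 0 ≤ s) (hst : s ≤ t) (ht : t ≤ T) (c : Path T → ℝ)
    (hc : Measurable[Fraw T s] c) {ω : Path T} (h1 : |c ω| ≤ N) (h2 : ∀ u, |ev T hT ω u| ≤ N)
    (h3 : T < sig T hT m N ω) (u : ℝ) :
    (famI hT m N hs hst ht c hc).W hT u ω =
      c ω * (Sm T hT m (max s (min u t)) ω - Sm T hT m s ω) := by
  rw [Sm_eq_sum hT m ω (N := N) ((max_le hst (min_le_right _ _)).trans (ht.trans h3.le)),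
    Sm_eq_sum hT m ω (N := N) (hst.trans (ht.trans h3.le)), ← Finset.sum_sub_distrib, Finset.mul_sum]
  unfold Fam.W
  show ∑ k : Fin N, _ = _
  rw [← Fin.sum_univ_eq_sum_range (fun k => c ω * (smT hT m ω (max s (min u t)) k - smT hT m ω s k)) N]
  refine Finset.sum_congr rfl fun k _ => ?_
  simp only [famI]
  rw [clip_eq h1, clip_eq (h2 _)]
  have key : ∀ k, ev T hT ω (min (max s (min (sig T hT m k ω) t)) u) =
    ev T hT ω (min (sig T hT m k ω) (max s (min u t))) - ev T hT ω (min (sig T hT m k ω) s)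
      + ev T hT ω (min s u) := by
    intro k
    generalize sig T hT m k ω = σ
    rcases le_total u s with h | h
    · rw [min_eq_right (le_max_of_le_left h), max_eq_left ((min_le_left _ _).trans h), sub_self, zero_add, min_eq_right h]
    · have e1 : min (max s (min σ t)) u = max s (min σ (min u t)) := by
        rw [min_max_distrib_right, min_eq_left h]
        congr 1; rw [min_assoc, min_comm t u]
      rw [e1, max_eq_right (le_min h hst), min_eq_left h]
      rcases le_total σ s with h' | h'
      · rw [min_eq_left h', min_eq_left (h'.trans (le_min h hst)), max_eq_left h']; ring
      · rw [min_eq_right h', max_eq_right (le_min h' (le_min h hst))]; ring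
  rw [key k, key (k+1), ← smT_eq, ← smT_eq]
  by_cases hk : sig T hT m k ω ≤ t
  · rw [min_eq_left hk]; ring
  · have h5 := (not_le.1 hk).le
    have h6 := h5.trans (sig_le hT m ω k).2.2
    have h7 : max s (min u t) ≤ t := max_le hst (min_le_right _ _)
    rw [min_eq_right (h7.trans h5), min_eq_right (h7.trans h6), min_eq_right (hst.trans h5),
      min_eq_right (hst.trans h6)]; ring

/-- single position -/
def famS (N : ℕ) {s t : ℝ} (hs : 0 ≤ s) (hst : s ≤ t) (ht : t ≤ T) (c : Path T → ℝ)
    (hc : Measurable[Fraw T s] c) : Fam T where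
  ι := Unit
  ft := inferInstance
  a := fun _ _ => s
  b := fun _ _ => t
  h := fun _ ω => clip N (c ω)
  a0 := fun _ _ => hs
  ab := fun _ _ => hst
  bT := fun _ _ => ht
  sa := fun _ => IsStopPlus.const s
  sb := fun _ => IsStopPlus.const t
  bdd := fun _ => ⟨N, fun ω => clip_abs _ _⟩
  hm := fun _ => MeasAtStopPlus.comp (measAtStop_const_time hc (hst.trans ht)) (clip_meas N)

theorem famS_W (N : ℕ) {s t : ℝ} (hs : 0 ≤ s) (hst : s ≤ t) (ht : t ≤ T) (c : Path T → ℝ)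
    (hc : Measurable[Fraw T s] c) {ω : Path T} (h1 : |c ω| ≤ N) (u : ℝ) :
    (famS N hs hst ht c hc).W hT u ω = c ω * (ev T hT ω (min t u) - ev T hT ω (min s u)) := by
  unfold Fam.W
  show ∑ k : Unit, _ = _
  simp [famS, clip_eq h1]

theorem coef_part (a h : ℕ → ℝ) (ha : Monotone a) (N : ℕ) (x ε u : ℝ) (hε : 0 ≤ ε)
    (hx : ∀ k < N, a k ≤ u → u < a (k+1) → |h k - x| ≤ ε) :
    (u ∈ Ico (a 0) (a N) → |(∑ k ∈ Finset.range N, h k * (if a k ≤ u ∧ u < a (k+1) then 1 else 0)) - x| ≤ ε) ∧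
    (u ∉ Ico (a 0) (a N) → (∑ k ∈ Finset.range N, h k * (if a k ≤ u ∧ u < a (k+1) then (1:ℝ) else 0)) = 0) := by
  have tele : ∑ k ∈ Finset.range N, (if a k ≤ u ∧ u < a (k+1) then (1:ℝ) else 0)
      = (if a 0 ≤ u then 1 else 0) - (if a N ≤ u then 1 else 0) := by
    rw [← Finset.sum_range_sub' (fun k => if a k ≤ u then (1:ℝ) else 0)]
    refine Finset.sum_congr rfl fun k _ => ?_
    have := ha (Nat.le_succ k)
    by_cases h1 : a k ≤ u <;> by_cases h2 : a (k+1) ≤ u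
    · simp [h1, h2, not_lt.2]
    · simp [h1, h2, not_le.1]
    · exact absurd (this.trans h2) h1
    · simp [h1, h2]
  constructor
  · intro hu
    rw [if_pos hu.1, if_neg (not_le.2 hu.2), sub_zero] at tele
    have : (∑ k ∈ Finset.range N, h k * (if a k ≤ u ∧ u < a (k+1) then (1:ℝ) else 0)) - x =
        ∑ k ∈ Finset.range N, (h k - x) * (if a k ≤ u ∧ u < a (k+1) then (1:ℝ) else 0) := by
      simp only [sub_mul, Finset.sum_sub_distrib, ← Finset.mul_sum, tele, mul_one]
    rw [this]
    calc _ ≤ ∑ k ∈ Finset.range N, ε * (if a k ≤ u ∧ u < a (k+1) then (1:ℝ) else 0) := by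
          refine (Finset.abs_sum_le_sum_abs _ _).trans (Finset.sum_le_sum fun k hk => ?_)
          split_ifs with h1
          · rw [mul_one, mul_one]; exact hx k (Finset.mem_range.1 hk) h1.1 h1.2
          · simp
      _ = ε := by rw [← Finset.mul_sum, tele, mul_one]
  · intro hu
    refine Finset.sum_eq_zero fun k hk => ?_
    rw [if_neg, mul_zero]
    rintro ⟨h1, h2⟩
    exact hu ⟨(ha (Nat.zero_le k)).trans h1, h2.trans_le (ha (Finset.mem_range.1 hk))⟩

theorem famI_coef (m N : ℕ) (hN : 1 ≤ N) {t : ℝ} (h0 : 0 ≤ t) (ht : t ≤ T) {ω : Path T}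
    (h2 : ∀ u, |ev T hT ω u| ≤ N) (h3 : T < sig T hT m N ω) (u : ℝ) :
    (u ∈ Ico 0 t → |(famI hT m N le_rfl h0 ht (fun _ => 1) measurable_const).coef u ω - ev T hT ω u| ≤
      (2:ℝ) ^ (-(m:ℤ))) ∧
    (u ∉ Ico 0 t → (famI hT m N le_rfl h0 ht (fun _ => 1) measurable_const).coef u ω = 0) := by
  let a : ℕ → ℝ := fun k => max 0 (min (sig T hT m k ω) t)
  let h : ℕ → ℝ := fun k => ev T hT ω (min (sig T hT m k ω) t)
  have e : (famI hT m N le_rfl h0 ht (fun _ => 1) measurable_const).coef u ω =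
      ∑ k ∈ Finset.range N, h k * (if a k ≤ u ∧ u < a (k+1) then (1:ℝ) else 0) := by
    rw [← Fin.sum_univ_eq_sum_range (fun k => h k * (if a k ≤ u ∧ u < a (k+1) then (1:ℝ) else 0)) N]
    unfold Fam.coef
    show ∑ k : Fin N, _ = _
    refine Finset.sum_congr rfl fun k _ => ?_
    simp only [famI, a, h]
    rw [clip_eq (h2 _), clip_eq (x := 1) (by simpa using hN), one_mul]
    congr 1
  have ha : Monotone a := fun i j hij => max_le_max le_rfl (min_le_min (sig_mono hT m ω hij) le_rfl)
  have a0 : a 0 = 0 := by simp [a, sig, h0]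
  have aN : a N = t := by simp only [a]; rw [min_eq_right (ht.trans h3.le), max_eq_right h0]
  have := coef_part a h ha N (ev T hT ω u) ((2:ℝ) ^ (-(m:ℤ))) u (epos m).le (by
    intro k _ hk1 hk2
    simp only [a] at hk1 hk2
    rw [max_eq_right (le_min (sig_nonneg hT m ω _) h0)] at hk1 hk2
    have hut : u < t := hk2.trans_le (min_le_right _ _)
    have hk3 : sig T hT m k ω ≤ u := by
      rcases min_le_iff.1 hk1 with h | h
      · exact h
      · linarith
    rw [abs_sub_comm]
    simp only [h]
    rw [min_eq_left (hk3.trans hut.le)]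
    exact (sig_small hT m ω hk3 (hk2.trans_le (min_le_left _ _)) (hut.le.trans ht)).le)
  rw [a0, aN] at this
  rw [e]; exact this

/-- grid position -/
def famG (n N : ℕ) {t : ℝ} (h0 : 0 ≤ t) (ht : t ≤ T) : Fam T where
  ι := Fin n
  ft := inferInstance
  a := fun k _ => min (t * (k / n)) t
  b := fun k _ => min (t * ((k+1:ℕ) / n)) t
  h := fun k ω => clip N (ev T hT ω (min (t * (k / n)) t))
  a0 := fun k _ => le_min (by positivity) h0
  ab := fun k _ => min_le_min (by gcongr; simp) le_rfl
  bT := fun _ _ => (min_le_right _ _).trans ht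
  sa := fun _ => IsStopPlus.const _
  sb := fun _ => IsStopPlus.const _
  bdd := fun _ => ⟨N, fun ω => clip_abs _ _⟩
  hm := fun k => MeasAtStopPlus.comp (measAtStop_ev hT (IsStopPlus.const _) (IsStopPlus.const _)
    (fun _ => le_min (by positivity) h0) fun _ => le_rfl) (clip_meas N)

def gpt (t : ℝ) (n k : ℕ) : ℝ := min (t * (k / n)) t

theorem gpt_mono {t : ℝ} (h0 : 0 ≤ t) (n : ℕ) : Monotone (gpt t n) := fun i j hij =>
  min_le_min (by gcongr) le_rfl

theorem famG_W (n N : ℕ) {t : ℝ} (h0 : 0 ≤ t) (ht : t ≤ T) {ω : Path T}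
    (h2 : ∀ u, |ev T hT ω u| ≤ N) :
    (famG hT n N h0 ht).W hT T ω = ∑ k ∈ Finset.range n, ev T hT ω (gpt t n k) *
      (ev T hT ω (gpt t n (k+1)) - ev T hT ω (gpt t n k)) := by
  rw [← Fin.sum_univ_eq_sum_range (fun k => ev T hT ω (gpt t n k) *
      (ev T hT ω (gpt t n (k+1)) - ev T hT ω (gpt t n k))) n]
  unfold Fam.W
  show ∑ k : Fin n, _ = _
  refine Finset.sum_congr rfl fun k _ => ?_
  simp only [famG, gpt]
  rw [clip_eq (h2 _), min_eq_left ((min_le_right _ _).trans ht), min_eq_left ((min_le_right _ _).trans ht)]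

theorem gpt_zero {t : ℝ} (h0 : 0 ≤ t) (n : ℕ) : gpt t n 0 = 0 := by simp [gpt, h0]
theorem gpt_last {t : ℝ} {n : ℕ} (hn : 0 < n) : gpt t n n = t := by
  have : (n:ℝ) ≠ 0 := by positivity
  simp [gpt, this]
theorem gpt_mem {t : ℝ} (h0 : 0 ≤ t) (n k : ℕ) : gpt t n k ∈ Icc 0 t :=
  ⟨le_min (by positivity) h0, min_le_right _ _⟩
theorem gpt_step {t : ℝ} (h0 : 0 ≤ t) {n : ℕ} (hn : 0 < n) (k : ℕ) :
    gpt t n (k+1) ≤ gpt t n k + t / n := by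
  simp only [gpt]
  have : (0:ℝ) < n := by positivity
  rw [← min_add_add_right]
  refine min_le_min (le_of_eq ?_) (by have : 0 ≤ t / n := by positivity
                                      linarith)
  push_cast; field_simp

theorem famG_coef (n N : ℕ) (hn : 0 < n) {t : ℝ} (h0 : 0 ≤ t) (ht : t ≤ T) {ω : Path T}
    (h2 : ∀ u, |ev T hT ω u| ≤ N) {w : ℝ} (hw0 : 0 ≤ w)
    (hw : ∀ u v, |u - v| ≤ t / n → |ev T hT ω u - ev T hT ω v| ≤ w) (u : ℝ) :
    (u ∈ Ico 0 t → |(famG hT n N h0 ht).coef u ω - ev T hT ω u| ≤ w) ∧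
    (u ∉ Ico 0 t → (famG hT n N h0 ht).coef u ω = 0) := by
  have e : (famG hT n N h0 ht).coef u ω = ∑ k ∈ Finset.range n, ev T hT ω (gpt t n k) *
      (if gpt t n k ≤ u ∧ u < gpt t n (k+1) then (1:ℝ) else 0) := by
    rw [← Fin.sum_univ_eq_sum_range (fun k => ev T hT ω (gpt t n k) *
      (if gpt t n k ≤ u ∧ u < gpt t n (k+1) then (1:ℝ) else 0)) n]
    unfold Fam.coef
    show ∑ k : Fin n, _ = _
    refine Finset.sum_congr rfl fun k _ => ?_
    simp only [famG, gpt]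
    rw [clip_eq (h2 _)]
    congr 1
  have := coef_part (gpt t n) (fun k => ev T hT ω (gpt t n k)) (gpt_mono h0 n) n (ev T hT ω u) w u hw0 (by
    intro k _ hk1 hk2
    refine hw _ _ ?_
    have := gpt_step h0 hn k
    rw [abs_le]; constructor <;> linarith)
  rw [gpt_zero h0, gpt_last hn] at this
  rw [e]; exact this

end fams
end PathwiseSuperhedging

namespace PathwiseSuperhedging

section trad
variable {T : ℝ} (hT : 0 ≤ T)

theorem qvRaw_cont {ω : Path T} (h : ω ∈ BigOmega T hT) :
    Continuous fun t : Icc (0:ℝ) T => qvRaw T hT ω (t : ℝ) := by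
  have hS : Continuous fun t : Icc (0:ℝ) T => SS T hT (t:ℝ) ω := by
    refine h.1.continuous (Frequently.of_forall fun m => ?_)
    exact (Sm_cont hT m ω).comp_continuous continuous_subtype_val fun t => t.2.2
  have := (continuous_ev hT ω).comp (continuous_subtype_val (p := fun x => x ∈ Icc (0:ℝ) T))
  exact ((this.pow 2).sub continuous_const).sub (continuous_const.mul hS)

theorem ev_coe (ω : Path T) (t : Icc (0:ℝ) T) : ev T hT ω (t:ℝ) = ω t := by
  simp [ev, clamp]

theorem ev_mk (ω : Path T) {t : ℝ} (ht : t ∈ Icc (0:ℝ) T) : ev T hT ω t = ω ⟨t, ht⟩ :=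
  ev_coe hT ω ⟨t, ht⟩

theorem qv_eq {ω : Path T} (h : ω ∈ BigOmega T hT) {t : ℝ} (ht : t ∈ Icc 0 T) :
    ev T hT (qv T hT ω) t = qvRaw T hT ω t := by
  rw [ev_mk hT _ ht, qv, dif_pos ⟨h, qvRaw_cont hT h⟩]; rfl

theorem SSbar_psi {ω : Path T} (h : ω ∈ BigOmega T hT) {t : ℝ} (ht : t ∈ Icc 0 T) :
    SSbarProc T hT t (psiMap T hT ω) = SS T hT t ω := by
  simp only [SSbarProc, psiMap, qv_eq hT h ht, qvRaw]; ring

def stopP (p : PathPair T) (t : ℝ) : PathPair T := (stopPath T p.1 (clamp T hT t), stopPath T p.2 (clamp T hT t))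

theorem clamp_coe {t : ℝ} (ht : t ∈ Icc 0 T) : ((clamp T hT t : Icc (0:ℝ) T) : ℝ) = t := by
  rw [clamp_mem hT ht]

theorem ev_stopP1 (p : PathPair T) {t : ℝ} (ht : t ∈ Icc 0 T) (u : ℝ) :
    ev T hT (stopP hT p t).1 u = ev T hT p.1 (min u t) := by
  rw [stopP, ev_stopPath, clamp_coe hT ht]

theorem ev_stopP2 (p : PathPair T) {t : ℝ} (ht : t ∈ Icc 0 T) (u : ℝ) :
    ev T hT (stopP hT p t).2 u = ev T hT p.2 (min u t) := by
  rw [stopP, ev_stopPath, clamp_coe hT ht]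

theorem stopPath_top (ω : Path T) : stopPath T ω (clamp T hT T) = ω := by
  ext u
  rw [← ev_coe hT, ← ev_coe hT, ev_stopPath, clamp_coe hT ⟨hT, le_rfl⟩, min_eq_left u.2.2]

theorem stopP_top (p : PathPair T) : stopP hT p T = p := by
  simp only [stopP, stopPath_top]

theorem SSbar_stop (p : PathPair T) {t : ℝ} (ht : t ∈ Icc 0 T) (u : ℝ) :
    SSbarProc T hT u (stopP hT p t) = SSbarProc T hT (min u t) p := by
  simp only [SSbarProc, ev_stopP1 hT p ht, ev_stopP2 hT p ht, min_eq_left ht.1]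

/-- admissible coefficients -/
def Adm (s : ℝ) (c : PathPair T → ℝ) : Prop :=
  Continuous c ∧ (∀ p, ∀ u ∈ Icc 0 T, s ≤ u → c (stopP hT p u) = c p) ∧
    ∃ c' : Path T → ℝ, Measurable[Fraw T s] c' ∧ ∀ ω ∈ BigOmega T hT, c' ω = c (psiMap T hT ω)

theorem continuous_ev1 (u : ℝ) : Continuous fun p : PathPair T => ev T hT p.1 u :=
  (continuous_eval_const (clamp T hT u)).comp continuous_fst

theorem continuous_ev2 (u : ℝ) : Continuous fun p : PathPair T => ev T hT p.2 u :=
  (continuous_eval_const (clamp T hT u)).comp continuous_snd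

theorem Adm.const (s r : ℝ) : Adm hT s (fun _ => r) :=
  ⟨continuous_const, fun _ _ _ _ => rfl, fun _ => r, @measConst _ (Fraw T s) _, fun _ _ => rfl⟩

theorem Adm.add {s : ℝ} {c d : PathPair T → ℝ} (hc : Adm hT s c) (hd : Adm hT s d) :
    Adm hT s (fun p => c p + d p) := by
  obtain ⟨h1, h2, c', h3, h4⟩ := hc
  obtain ⟨g1, g2, d', g3, g4⟩ := hd
  exact ⟨h1.add g1, fun p u hu hs => by beta_reduce; rw [h2 p u hu hs, g2 p u hu hs], fun ω => c' ω + d' ω,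
    @measAdd _ (Fraw T s) _ _ h3 g3, fun ω hω => by beta_reduce; rw [h4 ω hω, g4 ω hω]⟩

theorem Adm.mul {s : ℝ} {c d : PathPair T → ℝ} (hc : Adm hT s c) (hd : Adm hT s d) :
    Adm hT s (fun p => c p * d p) := by
  obtain ⟨h1, h2, c', h3, h4⟩ := hc
  obtain ⟨g1, g2, d', g3, g4⟩ := hd
  exact ⟨h1.mul g1, fun p u hu hs => by beta_reduce; rw [h2 p u hu hs, g2 p u hu hs], fun ω => c' ω * d' ω,
    @measMul _ (Fraw T s) _ _ h3 g3, fun ω hω => by beta_reduce; rw [h4 ω hω, g4 ω hω]⟩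

theorem Adm.S {s u : ℝ} (hs : s ∈ Icc 0 T) (hu : u ≤ s) : Adm hT s (fun p => ev T hT p.1 u) :=
  ⟨continuous_ev1 hT u, fun p v hv hsv => by beta_reduce; rw [ev_stopP1 hT p hv, min_eq_left (hu.trans hsv)],
    fun ω => ev T hT ω u, measurable_ev_Fraw hT hs hu, fun _ _ => rfl⟩

theorem Adm.V {s u : ℝ} (hs : s ∈ Icc 0 T) (hu0 : 0 ≤ u) (hu : u ≤ s) : Adm hT s (fun p => ev T hT p.2 u) :=
  ⟨continuous_ev2 hT u, fun p v hv hsv => by beta_reduce; rw [ev_stopP2 hT p hv, min_eq_left (hu.trans hsv)],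
    fun ω => qvRaw T hT ω u, (qvRaw_meas hT ⟨hu0, hu.trans hs.2⟩).mono (Fraw_mono T hu) le_rfl,
    fun ω hω => (qv_eq hT hω ⟨hu0, hu.trans hs.2⟩).symm⟩

theorem stopPath_cont (t : Icc (0:ℝ) T) : Continuous fun ω : Path T => stopPath T ω t := by
  have : (fun ω : Path T => stopPath T ω t) = fun ω => ω.comp
    ⟨fun s : Icc (0:ℝ) T => (⟨min t.1 s.1, le_min t.2.1 s.2.1, (min_le_left _ _).trans t.2.2⟩ : Icc (0:ℝ) T),
      (continuous_const.min continuous_subtype_val).subtype_mk _⟩ := rfl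
  rw [this]; exact ContinuousMap.continuous_precomp _

theorem Adm.phi {s : ℝ} (hs : s ∈ Icc 0 T) {φ : Path T → ℝ} (hφ : Continuous φ) :
    Adm hT s (fun p => φ (stopPath T p.1 ⟨s, hs⟩)) := by
  refine ⟨hφ.comp ((stopPath_cont _).comp continuous_fst), fun p u hu hsu => ?_,
    fun ω => φ (stopPath T ω ⟨s, hs⟩), ?_, fun _ _ => rfl⟩
  · beta_reduce
    have : stopPath T (stopP hT p u).1 ⟨s, hs⟩ = stopPath T p.1 ⟨s, hs⟩ := by
      ext v
      rw [← ev_coe hT, ← ev_coe hT, ev_stopPath, ev_stopPath, ev_stopP1 hT p hu, min_assoc,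
        min_eq_left hsu]
    rw [this]
  · have h := Fraw_eq_comap hT ⟨s, hs⟩
    simp only at h
    rw [h]
    exact hφ.measurable.comp (comap_measurable _)

/-- replicable functionals -/
def Trd (I : PathPair T → ℝ) : Prop :=
  Continuous I ∧ ∃ F : ℕ → ℕ → Fam T, ∀ ω ∈ BigOmega T hT, ∃ w : ℕ → ℝ → ℝ,
    (∀ m, ∀ᶠ N in atTop, ∀ t ∈ Icc 0 T, (F m N).W hT t ω = w m t) ∧
    ∀ ε > 0, ∀ᶠ m in atTop, ∀ t ∈ Icc 0 T, |w m t - I (stopP hT (psiMap T hT ω) t)| < ε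

theorem Trd.add {I J : PathPair T → ℝ} (hI : Trd hT I) (hJ : Trd hT J) : Trd hT (fun p => I p + J p) := by
  obtain ⟨h0, F, h⟩ := hI
  obtain ⟨g0, G, g⟩ := hJ
  refine ⟨h0.add g0, fun m N => (F m N).add (G m N), fun ω hω => ?_⟩
  obtain ⟨w, h1, h2⟩ := h ω hω
  obtain ⟨v, g1, g2⟩ := g ω hω
  refine ⟨fun m t => w m t + v m t, fun m => ?_, fun ε hε => ?_⟩
  · filter_upwards [h1 m, g1 m] with N a b t ht
    rw [Fam.add_W, a t ht, b t ht]
  · filter_upwards [h2 (ε/2) (by positivity), g2 (ε/2) (by positivity)] with m a b t ht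
    have a1 := abs_lt.1 (a t ht); have b1 := abs_lt.1 (b t ht)
    rw [abs_lt]; constructor <;> linarith [a1.1, a1.2, b1.1, b1.2]

theorem Trd.smul {I : PathPair T → ℝ} (r : ℝ) (hI : Trd hT I) : Trd hT (fun p => r * I p) := by
  obtain ⟨h0, F, h⟩ := hI
  refine ⟨continuous_const.mul h0, fun m N => (F m N).smul r, fun ω hω => ?_⟩
  obtain ⟨w, h1, h2⟩ := h ω hω
  refine ⟨fun m t => r * w m t, fun m => ?_, fun ε hε => ?_⟩
  · filter_upwards [h1 m] with N a t ht
    rw [Fam.smul_W, a t ht]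
  · filter_upwards [h2 (ε/(|r|+1)) (by positivity)] with m a t ht
    have a1 := a t ht
    rw [← mul_sub, abs_mul]
    rw [lt_div_iff₀ (by positivity)] at a1
    have := abs_nonneg (w m t - I (stopP hT (psiMap T hT ω) t))
    nlinarith

theorem Trd.genS {s t : ℝ} (hs : 0 ≤ s) (hst : s ≤ t) (ht : t ≤ T) {c : PathPair T → ℝ} (hc : Adm hT s c) :
    Trd hT (fun p => c p * (ev T hT p.1 t - ev T hT p.1 s)) := by
  obtain ⟨h1, h2, c', h3, h4⟩ := hc
  refine ⟨h1.mul ((continuous_ev1 hT t).sub (continuous_ev1 hT s)),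
    fun _ N => famS N hs hst ht c' h3, fun ω hω => ?_⟩
  refine ⟨fun _ u => c' ω * (ev T hT ω (min t u) - ev T hT ω (min s u)), fun m => ?_, fun ε hε => ?_⟩
  · obtain ⟨N0, hN0⟩ := exists_nat_ge |c' ω|
    filter_upwards [eventually_ge_atTop N0] with N hN u hu
    exact famS_W hT N hs hst ht c' h3 (hN0.trans (by exact_mod_cast hN)) u
  · refine Eventually.of_forall fun m u hu => ?_
    beta_reduce
    rw [ev_stopP1 hT _ hu, ev_stopP1 hT _ hu]
    rcases le_total s u with h | h
    · rw [h2 _ u hu h, h4 ω hω]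
      simpa [psiMap] using hε
    · rw [min_eq_right h, min_eq_right (h.trans hst)]; simpa using hε

theorem Trd.genSS {s t : ℝ} (hs : 0 ≤ s) (hst : s ≤ t) (ht : t ≤ T) {c : PathPair T → ℝ} (hc : Adm hT s c) :
    Trd hT (fun p => c p * (SSbarProc T hT t p - SSbarProc T hT s p)) := by
  obtain ⟨h1, h2, c', h3, h4⟩ := hc
  have cont : ∀ u, Continuous fun p : PathPair T => SSbarProc T hT u p := fun u =>
    ((((continuous_ev1 hT u).pow 2).sub ((continuous_ev1 hT 0).pow 2)).sub (continuous_ev2 hT u)).div_const 2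
  refine ⟨h1.mul ((cont t).sub (cont s)),
    fun m N => famI hT m N hs hst ht c' h3, fun ω hω => ?_⟩
  refine ⟨fun m u => c' ω * (Sm T hT m (max s (min u t)) ω - Sm T hT m s ω), fun m => ?_, fun ε hε => ?_⟩
  · obtain ⟨N0, hN0⟩ := exists_nat_ge |c' ω|
    obtain ⟨N1, hN1⟩ := exists_nat_ge ‖ω‖
    obtain ⟨N2, hN2⟩ := sig_exists hT m ω
    filter_upwards [eventually_ge_atTop N0, eventually_ge_atTop N1, eventually_ge_atTop N2] with N hN hN' hN'' u hu
    refine famI_W hT m N hs hst ht c' h3 (hN0.trans (by exact_mod_cast hN)) (fun v => ?_)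
      (hN2.trans_le (sig_mono hT m ω hN'')) u
    exact (ω.norm_coe_le_norm _).trans (hN1.trans (by exact_mod_cast hN'))
  · have hu := Metric.tendstoUniformly_iff.1 hω.1 (ε/(2*(|c' ω|+1))) (by positivity)
    filter_upwards [hu] with m hm u hu
    have key : ∀ v ∈ Icc 0 T, |SS T hT v ω - Sm T hT m v ω| < ε/(2*(|c' ω|+1)) := fun v hv => hm ⟨v, hv⟩
    have e : c (stopP hT (psiMap T hT ω) u) * (SSbarProc T hT t (stopP hT (psiMap T hT ω) u)
        - SSbarProc T hT s (stopP hT (psiMap T hT ω) u)) =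
        c' ω * (SS T hT (max s (min u t)) ω - SS T hT s ω) := by
      rw [SSbar_stop hT _ hu, SSbar_stop hT _ hu]
      rcases le_total s u with h | h
      · rw [h2 _ u hu h, h4 ω hω, min_eq_left h, max_eq_right (le_min h hst), min_comm u t,
          SSbar_psi hT hω ⟨le_min (hs.trans hst) hu.1, (min_le_right _ _).trans hu.2⟩,
          SSbar_psi hT hω ⟨hs, hst.trans ht⟩]
      · rw [min_eq_right h, min_eq_right (h.trans hst), max_eq_left ((min_le_left _ _).trans h)]; ring
    beta_reduce
    rw [e]
    have k1 := key (max s (min u t)) ⟨hs.trans (le_max_left _ _), (max_le hst (min_le_right _ _)).trans ht⟩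
    have k2 := key s ⟨hs, hst.trans ht⟩
    rw [← mul_sub, abs_mul]
    have k3 : |Sm T hT m (max s (min u t)) ω - Sm T hT m s ω - (SS T hT (max s (min u t)) ω - SS T hT s ω)|
        < 2 * (ε/(2*(|c' ω|+1))) := by
      rw [abs_lt] at *; constructor <;> linarith [k1.1, k1.2, k2.1, k2.2]
    have k4 : 2 * (ε/(2*(|c' ω|+1))) = ε / (|c' ω|+1) := by field_simp
    rw [k4, lt_div_iff₀ (by positivity)] at k3
    have := abs_nonneg (Sm T hT m (max s (min u t)) ω - Sm T hT m s ω - (SS T hT (max s (min u t)) ω - SS T hT s ω))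
    nlinarith

theorem Trd.zero : Trd hT (fun _ => 0) := by
  have := Trd.smul hT 0 (Trd.genS hT le_rfl hT le_rfl (Adm.const hT 0 0))
  simpa using this

theorem Trd.sum {ι : Type*} (s : Finset ι) {I : ι → PathPair T → ℝ} (h : ∀ i ∈ s, Trd hT (I i)) :
    Trd hT (fun p => ∑ i ∈ s, I i p) := by
  induction s using Finset.induction_on with
  | empty => simpa using Trd.zero hT
  | insert a s ha ih =>
    simp only [Finset.sum_insert ha]
    exact Trd.add hT (h a (by simp)) (ih fun i hi => h i (by simp [hi]))

theorem hedge (Ξ : Set (Path T)) {K : Set (PathPair T)} (hK : ∀ p ∈ K, ∀ t, stopP hT p t ∈ K)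
    {I : PathPair T → ℝ} (hI : Trd hT I) {c lam : ℝ} (hl : 0 < lam) (hc : c < lam)
    (hpos : ∀ p ∈ K, 0 < c + I p) :
    ∃ Y, GG T hT Ξ lam Y ∧ ∀ ω ∈ BigOmega T hT, psiMap T hT ω ∈ K → ((c + I (psiMap T hT ω) : ℝ) : EReal) ≤ Y ω := by
  obtain ⟨-, F, h⟩ := hI
  choose Y hY1 hY2 using fun m N => (F m N).gg hT Ξ hl
  refine ⟨fun ω => liminf (fun m => liminf (fun N => Y m N ω) atTop) atTop,
    GG.lim _ fun m => GG.lim _ fun N => hY1 m N, fun ω hω hωK => ?_⟩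
  obtain ⟨w, h1, h2⟩ := h ω hω
  refine le_liminf_of_le (by isBoundedDefault) ?_
  filter_upwards [h2 (lam - c) (by linarith)] with m hm
  have : liminf (fun N => Y m N ω) atTop = ((lam + w m T : ℝ) : EReal) := by
    refine Tendsto.liminf_eq (tendsto_const_nhds.congr' ?_)
    filter_upwards [h1 m] with N hN
    rw [hY2 m N ω, hN T ⟨hT, le_rfl⟩]
    intro t ht
    rw [hN t ht]
    have a := (abs_lt.1 (hm t ht)).1
    have b := hpos _ (hK _ hωK t)
    linarith
  rw [this, EReal.coe_le_coe_iff]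
  have a := (abs_lt.1 (hm T ⟨hT, le_rfl⟩)).1
  rw [stopP_top] at a
  linarith

end trad
end PathwiseSuperhedging

namespace PathwiseSuperhedging

theorem cond_eq {α β : Type*} [MeasurableSpace α] [TopologicalSpace β] [MeasurableSpace β] [BorelSpace β]
    [HasOuterApproxClosed β] (Q : Measure α) [IsFiniteMeasure Q] {g : α → β} (hg : Measurable g)
    {f h : α → ℝ} (hf : Measurable f) (hh : Measurable h) {C : ℝ}
    (hf0 : ∀ᵐ x ∂Q, 0 ≤ f x) (hh0 : ∀ᵐ x ∂Q, 0 ≤ h x) (hfC : ∀ᵐ x ∂Q, |f x| ≤ C) (hhC : ∀ᵐ x ∂Q, |h x| ≤ C)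
    (H : ∀ φ : BoundedContinuousFunction β ℝ, ∫ x, φ (g x) * f x ∂Q = ∫ x, φ (g x) * h x ∂Q)
    {B : Set β} (hB : MeasurableSet B) : ∫ x in g ⁻¹' B, f x ∂Q = ∫ x in g ⁻¹' B, h x ∂Q := by
  have fin : ∀ u : α → ℝ, Measurable u → (∀ᵐ x ∂Q, |u x| ≤ C) →
      IsFiniteMeasure (Q.withDensity fun x => ENNReal.ofReal (u x)) := by
    intro u hu huC
    exact isFiniteMeasure_withDensity_ofReal (intb hu huC).2
  have := fin f hf hfC
  have := fin h hh hhC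
  have form : ∀ u : α → ℝ, Measurable u → (∀ᵐ x ∂Q, 0 ≤ u x) → ∀ φ : BoundedContinuousFunction β ℝ,
      ∫ y, φ y ∂((Q.withDensity fun x => ENNReal.ofReal (u x)).map g) = ∫ x, φ (g x) * u x ∂Q := by
    intro u hu hu0 φ
    rw [integral_map hg.aemeasurable φ.continuous.measurable.aestronglyMeasurable,
      integral_withDensity_eq_integral_toReal_smul hu.ennreal_ofReal (by simp)]
    refine integral_congr_ae ?_
    filter_upwards [hu0] with x hx
    rw [ENNReal.toReal_ofReal hx, smul_eq_mul, mul_comm]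
  have key : (Q.withDensity fun x => ENNReal.ofReal (f x)).map g = (Q.withDensity fun x => ENNReal.ofReal (h x)).map g :=
    ext_of_forall_integral_eq_of_IsFiniteMeasure fun φ => by
      rw [form f hf hf0, form h hh hh0, H φ]
  have val : ∀ u : α → ℝ, Measurable u → (∀ᵐ x ∂Q, 0 ≤ u x) → (∀ᵐ x ∂Q, |u x| ≤ C) →
      ∫ x in g ⁻¹' B, u x ∂Q = (((Q.withDensity fun x => ENNReal.ofReal (u x)).map g) B).toReal := by
    intro u hu hu0 huC
    rw [Measure.map_apply hg hB, withDensity_apply _ (hg hB),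
      integral_eq_lintegral_of_nonneg_ae (ae_restrict_of_ae hu0) hu.aestronglyMeasurable]
  rw [val f hf hf0 hfC, val h hh hh0 hhC, key]

section meas
variable {T : ℝ} (hT : 0 ≤ T)

structure Dat (Q : Measure (PathPair T)) (R : ℝ) : Prop where
  R0 : 0 ≤ R
  b1 : ∀ᵐ p ∂Q, ∀ u, |ev T hT p.1 u| ≤ R
  b2 : ∀ᵐ p ∂Q, ∀ u, |ev T hT p.2 u| ≤ R
  md : ∀ ε > 0, ∃ δ > 0, ∀ᵐ p ∂Q, ∀ u v, |u - v| < δ →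
    |ev T hT p.1 u - ev T hT p.1 v| < ε ∧ |ev T hT p.2 u - ev T hT p.2 v| < ε
  mono : ∀ᵐ p ∂Q, ev T hT p.2 0 = 0 ∧ ∀ u v, u ≤ v → ev T hT p.2 u ≤ ev T hT p.2 v
  tr : ∀ I, Trd hT I → ∫ p, I p ∂Q = 0
  ic : ∀ I : PathPair T → ℝ, Continuous I → Integrable I Q
  c1 : ∀ᵐ ω ∂(Q.map Prod.fst), ∀ u, |ev T hT ω u| ≤ R
  c2 : ∀ ε > 0, ∃ δ > 0, ∀ᵐ ω ∂(Q.map Prod.fst), ∀ u v, |u - v| < δ →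
    |ev T hT ω u - ev T hT ω v| < ε

theorem equic {K : Set (Path T)} (hK : IsCompact K) {ε : ℝ} (hε : 0 < ε) :
    ∃ δ > 0, ∀ ω ∈ K, ∀ u v, |u - v| < δ → |ev T hT ω u - ev T hT ω v| < ε := by
  obtain ⟨s, -, hs, hc⟩ := hK.finite_cover_balls (e := ε/3) (by positivity)
  have h : ∀ᶠ δ in 𝓝[>] (0:ℝ), ∀ x ∈ s, ∀ u v, |u - v| < δ → |ev T hT x u - ev T hT x v| < ε/3 := by
    rw [eventually_all_finite hs]
    intro x _
    obtain ⟨δ, hδ, h⟩ := ev_unif hT x (ε := ε/3) (by positivity)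
    filter_upwards [Ioo_mem_nhdsGT hδ] with d hd u v huv
    exact h u v (huv.trans hd.2)
  obtain ⟨δ, h, hδ⟩ := (h.and self_mem_nhdsWithin).exists
  refine ⟨δ, hδ, fun ω hω u v huv => ?_⟩
  obtain ⟨x, hx, hωx⟩ := mem_iUnion₂.1 (hc hω)
  have a : ∀ r, |ev T hT ω r - ev T hT x r| < ε/3 := fun r =>
    (ContinuousMap.dist_apply_le_dist _).trans_lt hωx
  have a1 := abs_lt.1 (a u); have a2 := abs_lt.1 (a v); have a3 := abs_lt.1 (h x hx u v huv)
  rw [abs_lt]; constructor <;> linarith [a1.1, a1.2, a2.1, a2.2, a3.1, a3.2]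

theorem Dat.mk' {Ξ : Set (Path T)} {Xibar : Set (PathPair T)} (hA : AssumptionA T hT Ξ Xibar)
    {K : Set (PathPair T)} (hK : IsCompact K) (hKX : K ⊆ Xibar) (Q : Measure (PathPair T)) [IsProbabilityMeasure Q]
    (hQ : ∀ᵐ p ∂Q, p ∈ K) (tr : ∀ I, Trd hT I → ∫ p, I p ∂Q = 0) : ∃ R, Dat hT Q R := by
  obtain ⟨R, hR⟩ := hK.isBounded.exists_norm_le
  have hQ1 : ∀ᵐ ω ∂(Q.map Prod.fst), ω ∈ Prod.fst '' K := by
    refine (ae_map_iff (p := fun ω => ω ∈ Prod.fst '' K) measurable_fst.aemeasurable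
      (hK.image continuous_fst).isClosed.measurableSet).2 ?_
    exact hQ.mono fun p hp => mem_image_of_mem _ hp
  refine ⟨max R 0, le_max_right _ _, ?_, ?_, fun ε hε => ?_, ?_, tr, fun I hI => ?_, ?_, fun ε hε => ?_⟩
  rotate_right 3
  · obtain ⟨C, hC⟩ := hK.exists_bound_of_continuousOn hI.continuousOn
    exact intb hI.measurable (hQ.mono fun p hp => hC p hp)
  · filter_upwards [hQ1] with ω hω u
    obtain ⟨p, hp, rfl⟩ := hω
    exact (p.1.norm_coe_le_norm _).trans ((norm_fst_le p).trans ((hR p hp).trans (le_max_left _ _)))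
  · obtain ⟨d1, h1, e1⟩ := equic hT (hK.image continuous_fst) hε
    exact ⟨d1, h1, hQ1.mono fun ω hω => e1 ω hω⟩
  · filter_upwards [hQ] with p hp u
    exact (p.1.norm_coe_le_norm _).trans ((norm_fst_le p).trans ((hR p hp).trans (le_max_left _ _)))
  · filter_upwards [hQ] with p hp u
    exact (p.2.norm_coe_le_norm _).trans ((norm_snd_le p).trans ((hR p hp).trans (le_max_left _ _)))
  · obtain ⟨d1, h1, e1⟩ := equic hT (hK.image continuous_fst) hε
    obtain ⟨d2, h2, e2⟩ := equic hT (hK.image continuous_snd) hε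
    refine ⟨min d1 d2, lt_min h1 h2, ?_⟩
    filter_upwards [hQ] with p hp u v huv
    exact ⟨e1 _ (mem_image_of_mem _ hp) u v (huv.trans_le (min_le_left _ _)),
      e2 _ (mem_image_of_mem _ hp) u v (huv.trans_le (min_le_right _ _))⟩
  · filter_upwards [hQ] with p hp
    obtain ⟨h1, h2⟩ := hA.A2 p (hKX hp)
    refine ⟨?_, fun u v huv => h2 (monotone_projIcc hT huv)⟩
    rw [ev_mk hT _ ⟨le_rfl, hT⟩]; exact h1

variable {Q : Measure (PathPair T)} [IsProbabilityMeasure Q] {R : ℝ}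

theorem Dat.mart (D : Dat hT Q R) : IsMart T (Q.map Prod.fst) (Sproc T hT) := by
  have b1' : ∀ t, ∀ᵐ ω ∂(Q.map Prod.fst), |Sproc T hT t ω| ≤ R := fun t => by
    rw [ae_map_iff measurable_fst.aemeasurable]
    · filter_upwards [D.b1] with p hp using hp t
    · exact measurableSet_le (measurable_ev_const hT t).abs measurable_const
  have : IsProbabilityMeasure (Q.map Prod.fst) := Measure.isProbabilityMeasure_map measurable_fst.aemeasurable
  refine ⟨fun t _ => intb (measurable_ev_const hT t) (b1' t), fun s t hs ht hst A hA => ?_⟩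
  have h := Fraw_eq_comap hT ⟨s, hs⟩
  simp only at h
  rw [h] at hA
  obtain ⟨B, hB, rfl⟩ := hA
  have mg : Measurable fun p : PathPair T => stopPath T p.1 ⟨s, hs⟩ :=
    ((stopPath_cont _).comp continuous_fst).measurable
  have mS : ∀ u, Measurable fun p : PathPair T => ev T hT p.1 u := fun u => (continuous_ev1 hT u).measurable
  have iS : ∀ u, Integrable (fun p : PathPair T => ev T hT p.1 u) Q := fun u =>
    intb (mS u) (D.b1.mono fun p hp => hp u)
  have key := cond_eq Q mg ((mS t).add_const R) ((mS s).add_const R) (C := 2*R)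
    (D.b1.mono fun p hp => by linarith [(abs_le.1 (hp t)).1])
    (D.b1.mono fun p hp => by linarith [(abs_le.1 (hp s)).1])
    (D.b1.mono fun p hp => by
      rw [abs_le]; constructor <;> linarith [(abs_le.1 (hp t)).1, (abs_le.1 (hp t)).2, D.R0])
    (D.b1.mono fun p hp => by
      rw [abs_le]; constructor <;> linarith [(abs_le.1 (hp s)).1, (abs_le.1 (hp s)).2, D.R0])
    (fun φ => by
      have i1 : ∀ u, Integrable (fun p : PathPair T => φ (stopPath T p.1 ⟨s, hs⟩) * (ev T hT p.1 u + R)) Q := by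
        intro u
        refine intb ((φ.continuous.measurable.comp mg).mul ((mS u).add_const R)) (C := ‖φ‖ * (2*R)) ?_
        filter_upwards [D.b1] with p hp
        rw [abs_mul]
        refine mul_le_mul (φ.norm_coe_le_norm _) ?_ (abs_nonneg _) (norm_nonneg _)
        rw [abs_le]; constructor <;> linarith [(abs_le.1 (hp u)).1, (abs_le.1 (hp u)).2, D.R0]
      rw [← sub_eq_zero, ← integral_sub (i1 t) (i1 s)]
      refine Eq.trans ?_ (D.tr _ (Trd.genS hT hs.1 hst ht.2 (Adm.phi hT hs φ.continuous)))
      congr 1; ext p; ring) hB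
  have mv : ∀ u, ∫ ω in (fun ω => stopPath T ω ⟨s, hs⟩) ⁻¹' B, Sproc T hT u ω ∂(Q.map Prod.fst) =
      ∫ p in (fun p : PathPair T => stopPath T p.1 ⟨s, hs⟩) ⁻¹' B, (ev T hT p.1 u + R) ∂Q
        - Q.real ((fun p : PathPair T => stopPath T p.1 ⟨s, hs⟩) ⁻¹' B) * R := by
    intro u
    simp only [Sproc]
    rw [setIntegral_map ((stopPath_cont _).measurable hB) (measurable_ev_const hT u).aestronglyMeasurable
      measurable_fst.aemeasurable, integral_add (iS u).integrableOn (integrable_const _)]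
    simp
    rfl
  rw [mv t, mv s, key]

theorem Adm.SSb {s u : ℝ} (hs : s ∈ Icc 0 T) (hu0 : 0 ≤ u) (hu : u ≤ s) :
    Adm hT s (fun p => SSbarProc T hT u p) := by
  have a := Adm.S hT hs hu
  have b := Adm.S hT hs hs.1
  have c := Adm.V hT hs hu0 hu
  convert Adm.mul hT (Adm.const hT s (1/2)) (Adm.add hT (Adm.mul hT a a)
    (Adm.mul hT (Adm.const hT s (-1)) (Adm.add hT (Adm.mul hT b b) c))) using 2
  simp only [SSbarProc]; ring

theorem Dat.sq (D : Dat hT Q R) {n : ℕ} (hn : 0 < n) {t : ℝ} (h0 : 0 ≤ t) (ht : t ≤ T) {w : ℝ}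
    (hw : ∀ᵐ p ∂Q, ∀ u v, |u - v| ≤ t / n →
      |ev T hT p.1 u - ev T hT p.1 v| ≤ w ∧ |ev T hT p.2 u - ev T hT p.2 v| ≤ w) :
    ∫ p, (SSbarProc T hT t p - ∑ k ∈ Finset.range n, ev T hT p.1 (gpt t n k) *
      (ev T hT p.1 (gpt t n (k+1)) - ev T hT p.1 (gpt t n k)))^2 ∂Q ≤ (w^2 * R^2 + w * R)/2 := by
  set d : ℕ → PathPair T → ℝ := fun k p => (SSbarProc T hT (gpt t n (k+1)) p - SSbarProc T hT (gpt t n k) p)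
    - ev T hT p.1 (gpt t n k) * (ev T hT p.1 (gpt t n (k+1)) - ev T hT p.1 (gpt t n k)) with hd
  have gm : ∀ k, gpt t n k ∈ Icc 0 T := fun k => ⟨(gpt_mem h0 n k).1, (gpt_mem h0 n k).2.trans ht⟩
  have admd : ∀ k j, k < j → Adm hT (gpt t n j) (d k) := by
    intro k j hkj
    have e1 : gpt t n k ≤ gpt t n j := gpt_mono h0 n hkj.le
    have e2 : gpt t n (k+1) ≤ gpt t n j := gpt_mono h0 n hkj
    have a0 := fun u hu => Adm.SSb hT (gm j) (u := u) hu
    have a1 := Adm.S hT (gm j) e1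
    have a2 := Adm.S hT (gm j) e2
    convert Adm.add hT (Adm.add hT (a0 _ (gm (k+1)).1 e2) (Adm.mul hT (Adm.const hT _ (-1)) (a0 _ (gm k).1 e1)))
      (Adm.mul hT (Adm.mul hT (Adm.const hT _ (-1)) a1) (Adm.add hT a2 (Adm.mul hT (Adm.const hT _ (-1)) a1))) using 2
    simp only [hd]; ring
  have admD : ∀ j k, k ≤ j → Adm hT (gpt t n j) (fun p => ∑ i ∈ Finset.range k, d i p) := by
    intro j k hk
    induction k with
    | zero => simpa using Adm.const hT _ 0
    | succ k ih =>
      simp only [Finset.sum_range_succ]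
      exact Adm.add hT (ih (by omega)) (admd k j (by omega))
  have trdD : ∀ k (c : PathPair T → ℝ), Adm hT (gpt t n k) c → Trd hT (fun p => c p * d k p) := by
    intro k c hc
    have h1 := Trd.genSS hT (gm k).1 (gpt_mono h0 n k.le_succ) (gm _).2 hc
    have h2 := Trd.genS hT (gm k).1 (gpt_mono h0 n k.le_succ) (gm _).2 (Adm.mul hT hc (Adm.S hT (gm k) le_rfl))
    convert Trd.add hT h1 (Trd.smul hT (-1) h2) using 2
    simp only [hd]; ring
  have trX : Trd hT (fun p => 2 * (∑ k ∈ Finset.range n, (∑ i ∈ Finset.range k, d i p) * d k p)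
      + (-w^2) * ∑ k ∈ Finset.range n, ev T hT p.1 (gpt t n k) *
      (ev T hT p.1 (gpt t n (k+1)) - ev T hT p.1 (gpt t n k))) := by
    refine Trd.add hT (Trd.smul hT 2 (Trd.sum hT _ fun k _ => trdD k _ (admD k k le_rfl)))
      (Trd.smul hT _ (Trd.sum hT _ fun k _ => Trd.genS hT (gm k).1 (gpt_mono h0 n k.le_succ) (gm _).2 (Adm.S hT (gm k) le_rfl)))
  have sqs : ∀ (e : ℕ → ℝ) (j : ℕ), (∑ k ∈ Finset.range j, e k)^2 = ∑ k ∈ Finset.range j, (e k)^2 +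
      2 * ∑ k ∈ Finset.range j, (∑ i ∈ Finset.range k, e i) * e k := by
    intro e j
    induction j with
    | zero => simp
    | succ j ih => simp only [Finset.sum_range_succ]; linear_combination ih
  have iX := D.ic _ trX.1
  calc _ ≤ ∫ p, (((w^2 * R^2 + w * R)/2) + (2 * (∑ k ∈ Finset.range n, (∑ i ∈ Finset.range k, d i p) * d k p)
      + (-w^2) * ∑ k ∈ Finset.range n, ev T hT p.1 (gpt t n k) *
      (ev T hT p.1 (gpt t n (k+1)) - ev T hT p.1 (gpt t n k)))) ∂Q := by
        refine integral_mono_of_nonneg (Eventually.of_forall fun p => sq_nonneg _) ((integrable_const _).add iX) ?_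
        filter_upwards [hw, D.b1, D.b2, D.mono] with p pw p1 p2 p3
        have hstep : ∀ k, |gpt t n (k+1) - gpt t n k| ≤ t / n := fun k => by
          rw [abs_of_nonneg (sub_nonneg.2 (gpt_mono h0 n k.le_succ))]
          linarith [gpt_step h0 hn k]
        have e1 : SSbarProc T hT t p - ∑ k ∈ Finset.range n, ev T hT p.1 (gpt t n k) *
            (ev T hT p.1 (gpt t n (k+1)) - ev T hT p.1 (gpt t n k)) = ∑ k ∈ Finset.range n, d k p := by
          simp only [hd, Finset.sum_sub_distrib]
          rw [← Finset.sum_sub_distrib, Finset.sum_range_sub (fun k => SSbarProc T hT (gpt t n k) p), gpt_last hn, gpt_zero h0]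
          have : SSbarProc T hT 0 p = 0 := by simp [SSbarProc, p3.1]
          rw [this, sub_zero]
        beta_reduce
        rw [e1, sqs]
        have e2 : ∀ k, (d k p)^2 ≤ (w^2 * ((ev T hT p.1 (gpt t n (k+1)))^2 - (ev T hT p.1 (gpt t n k))^2)
            + w * (ev T hT p.2 (gpt t n (k+1)) - ev T hT p.2 (gpt t n k)))/2 - w^2 * (ev T hT p.1 (gpt t n k) *
            (ev T hT p.1 (gpt t n (k+1)) - ev T hT p.1 (gpt t n k))) := by
          intro k
          obtain ⟨q1, q2⟩ := pw _ _ (hstep k)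
          have q3 := p3.2 _ _ (gpt_mono h0 n k.le_succ)
          simp only [hd, SSbarProc]
          generalize ev T hT p.1 (gpt t n (k+1)) = x at *
          generalize ev T hT p.1 (gpt t n k) = y at *
          generalize ev T hT p.2 (gpt t n (k+1)) = v at *
          generalize ev T hT p.2 (gpt t n k) = v' at *
          rw [abs_of_nonneg (sub_nonneg.2 q3)] at q2
          have q4 : (x-y)^2 ≤ w^2 := by
            rw [← sq_abs]; exact pow_le_pow_left₀ (abs_nonneg _) q1 2
          have q5 : (x-y)^2 * (x-y)^2 ≤ w^2 * (x-y)^2 := mul_le_mul_of_nonneg_right q4 (sq_nonneg _)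
          have q6 : (v-v') * (v-v') ≤ w * (v-v') := mul_le_mul_of_nonneg_right q2 (sub_nonneg.2 q3)
          have : ((x ^ 2 - ev T hT p.1 0 ^ 2 - v) / 2 - (y ^ 2 - ev T hT p.1 0 ^ 2 - v') / 2 - y * (x - y)) =
            ((x-y)^2 - (v-v'))/2 := by ring
          rw [this]
          nlinarith [sq_nonneg ((x-y)^2 + (v-v'))]
        have e3 := Finset.sum_le_sum fun k (_ : k ∈ Finset.range n) => e2 k
        rw [Finset.sum_sub_distrib, ← Finset.sum_div, Finset.sum_add_distrib, ← Finset.mul_sum, ← Finset.mul_sum, ← Finset.mul_sum,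
          Finset.sum_range_sub (fun k => (ev T hT p.1 (gpt t n k))^2), Finset.sum_range_sub (fun k => ev T hT p.2 (gpt t n k)),
          gpt_last hn, gpt_zero h0, p3.1] at e3
        have w0 : 0 ≤ w := (abs_nonneg _).trans (pw _ _ (hstep 0)).1
        have f1 : (ev T hT p.1 t)^2 ≤ R^2 := by
          rw [← sq_abs]; exact pow_le_pow_left₀ (abs_nonneg _) (p1 t) 2
        have f2 := mul_le_mul_of_nonneg_left ((abs_le.1 (p2 t)).2) w0
        have f3 := mul_le_mul_of_nonneg_left f1 (sq_nonneg w)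
        nlinarith [mul_nonneg (sq_nonneg w) (sq_nonneg (ev T hT p.1 0))]
    _ = _ := by
        rw [integral_add (integrable_const _) iX, D.tr _ trX]; simp

theorem Sm_zero (m : ℕ) (ω : Path T) : Sm T hT m 0 ω = 0 := by
  simp [Sm, min_eq_right (sig_nonneg hT m ω _)]

theorem Dat.unifN (D : Dat hT Q R) (m : ℕ) : ∀ᶠ N : ℕ in atTop, ∀ᵐ ω ∂(Q.map Prod.fst),
    (∀ u, |ev T hT ω u| ≤ N) ∧ T < sig T hT m N ω := by
  obtain ⟨δ, hδ, h⟩ := D.c2 _ (epos m)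
  obtain ⟨N1, hN1⟩ := exists_nat_ge R
  obtain ⟨N2, hN2⟩ := exists_nat_gt (T/δ)
  filter_upwards [eventually_ge_atTop N1, eventually_ge_atTop N2] with N h1 h2
  filter_upwards [h, D.c1] with ω h3 h4
  refine ⟨fun u => (h4 u).trans (hN1.trans (by exact_mod_cast h1)), sig_finite hT m ω h3 ?_⟩
  rw [← div_lt_iff₀ hδ]
  exact hN2.trans_le (by exact_mod_cast h2)

theorem two_zpow (m : ℕ) : (2:ℝ) ^ (-(m:ℤ)) = (1/2)^m := by
  rw [zpow_neg, zpow_natCast, one_div, inv_pow]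

theorem Dat.incr (D : Dat hT Q R) (m : ℕ) : (Q.map Prod.fst) {ω | ∃ t ∈ Icc 0 T,
    (3/4:ℝ)^m ≤ |Sm T hT m t ω - Sm T hT (m+1) t ω|} ≤ ENNReal.ofReal (4 * R^2 * (4/9)^m) := by
  have : IsProbabilityMeasure (Q.map Prod.fst) := Measure.isProbabilityMeasure_map measurable_fst.aemeasurable
  obtain ⟨N, hN1, hN2, hN⟩ := ((D.unifN hT m).and ((D.unifN hT (m+1)).and (eventually_ge_atTop 1))).exists
  set F := (famI hT m N le_rfl hT le_rfl (fun _ => 1) measurable_const).add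
    (Fam.smul (-1) (famI hT (m+1) N le_rfl hT le_rfl (fun _ => 1) measurable_const)) with hF
  have hC : ∀ᵐ ω ∂(Q.map Prod.fst), ∀ u, |F.coef u ω| ≤ 2 * (1/2)^m := by
    filter_upwards [hN1, hN2] with ω h1 h2 u
    have a := famI_coef hT m N hN hT le_rfl h1.1 h1.2 u
    have b := famI_coef hT (m+1) N hN hT le_rfl h2.1 h2.2 u
    rw [hF, Fam.add_coef, Fam.smul_coef]
    rw [two_zpow] at a b
    have pp : (0:ℝ) ≤ (1/2)^m := by positivity
    by_cases hu : u ∈ Ico 0 T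
    · have a' := abs_le.1 (a.1 hu); have b' := abs_le.1 (b.1 hu)
      rw [pow_succ] at b'
      rw [abs_le]; constructor <;> linarith [a'.1, a'.2, b'.1, b'.2]
    · rw [a.2 hu, b.2 hu]; simp
  have := maximal hT (Q.map Prod.fst) (D.mart hT) D.c1 F hC (ε := (3/4)^m) (by positivity)
  calc _ ≤ _ := measure_mono_ae ?_
    _ ≤ _ := this
    _ = _ := by
      congr 1
      rw [mul_pow, ← pow_mul, ← pow_mul, mul_comm m 2, pow_mul, pow_mul]
      norm_num
      have : (4/9:ℝ)^m = (1/4)^m * (9/16:ℝ)⁻¹^m := by rw [← mul_pow]; norm_num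
      rw [div_eq_mul_inv, ← inv_pow, this]; ring
  filter_upwards [hN1, hN2] with ω h1 h2
  rintro ⟨t, ht, h⟩
  refine ⟨t, ht, ?_⟩
  rw [hF, Fam.add_W, Fam.smul_W, famI_W hT m N _ _ _ _ _ (by simpa using hN) h1.1 h1.2,
    famI_W hT (m+1) N _ _ _ _ _ (by simpa using hN) h2.1 h2.2, Sm_zero, Sm_zero, min_eq_left ht.2, max_eq_right ht.1]
  convert h using 2
  ring

theorem Dat.conv (D : Dat hT Q R) (m : ℕ) {t : ℝ} (h0 : 0 ≤ t) (ht : t ≤ T) : Q {p |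
    (3/4:ℝ)^m ≤ |Sm T hT m t p.1 - SSbarProc T hT t p|} ≤ ENNReal.ofReal ((9 * R^2 + R) * (4/9)^m) := by
  have : IsProbabilityMeasure (Q.map Prod.fst) := Measure.isProbabilityMeasure_map measurable_fst.aemeasurable
  obtain ⟨N, hN1, hN⟩ := ((D.unifN hT m).and (eventually_ge_atTop 1)).exists
  obtain ⟨δ, hδ, hd⟩ := D.md ((1/4)^m) (by positivity)
  obtain ⟨δ', hδ', hd'⟩ := D.c2 ((1/4)^m) (by positivity)
  obtain ⟨n, hn⟩ := exists_nat_gt (max (t/δ) (t/δ'))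
  have hn0 : 0 < n := by
    have : (0:ℝ) < n := (le_max_of_le_left (by positivity)).trans_lt hn
    exact_mod_cast this
  have hn0' : (0:ℝ) < n := by exact_mod_cast hn0
  have hnd : t / n < δ := by
    rw [div_lt_comm₀ hn0' hδ]; exact (le_max_left _ _).trans_lt hn
  have hnd' : t / n < δ' := by
    rw [div_lt_comm₀ hn0' hδ']; exact (le_max_right _ _).trans_lt hn
  set F := (famI hT m N le_rfl h0 ht (fun _ => 1) measurable_const).add
    (Fam.smul (-1) (famG hT n N h0 ht)) with hF
  have pp : (0:ℝ) ≤ (1/2)^m := by positivity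
  have pq : (1/4:ℝ)^m ≤ (1/2)^m := by gcongr; norm_num
  have hC : ∀ᵐ ω ∂(Q.map Prod.fst), ∀ u, |F.coef u ω| ≤ 2 * (1/2)^m := by
    filter_upwards [hN1, hd'] with ω h1 h2 u
    have a := famI_coef hT m N hN h0 ht h1.1 h1.2 u
    have b := famG_coef hT n N hn0 h0 ht h1.1 (w := (1/4)^m) (by positivity) (fun u v huv => (h2 u v (huv.trans_lt hnd')).le) u
    rw [hF, Fam.add_coef, Fam.smul_coef]
    rw [two_zpow] at a
    by_cases hu : u ∈ Ico 0 t
    · have a' := abs_le.1 (a.1 hu); have b' := abs_le.1 (b.1 hu)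
      rw [abs_le]; constructor <;> linarith [a'.1, a'.2, b'.1, b'.2]
    · rw [a.2 hu, b.2 hu]; simp
  obtain ⟨i1, i2⟩ := isometry hT (Q.map Prod.fst) (D.mart hT) D.c1 F hC
  have i1' : Integrable (fun p : PathPair T => (F.W hT T p.1)^2) Q := i1.comp_measurable measurable_fst
  have mW : Measurable fun ω => (F.W hT T ω)^2 := ((F.W_meas hT ⟨hT, le_rfl⟩).mono (Fplus_le T T) le_rfl).pow_const 2
  rw [integral_map measurable_fst.aemeasurable mW.aestronglyMeasurable] at i2
  have i3 := D.sq hT hn0 h0 ht (w := (1/4)^m) (hd.mono fun p hp u v huv =>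
    ⟨(hp u v (huv.trans_lt hnd)).1.le, (hp u v (huv.trans_lt hnd)).2.le⟩)
  set G : PathPair T → ℝ := fun p => SSbarProc T hT t p - ∑ k ∈ Finset.range n, ev T hT p.1 (gpt t n k) *
      (ev T hT p.1 (gpt t n (k+1)) - ev T hT p.1 (gpt t n k)) with hG
  have cG : Continuous G := by
    refine Continuous.sub (Adm.SSb hT (s := t) ⟨h0, ht⟩ h0 le_rfl).1 (continuous_finsetSum _ fun k _ => ?_)
    exact (continuous_ev1 hT _).mul ((continuous_ev1 hT _).sub (continuous_ev1 hT _))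
  have i4 : Integrable (fun p => (G p)^2) Q := D.ic _ (cG.pow 2)
  have mk := mul_meas_ge_le_integral_of_nonneg (μ := Q) (f := fun p => 2 * (F.W hT T p.1)^2 + 2 * (G p)^2)
    (Eventually.of_forall fun p => by positivity) ((i1'.const_mul 2).add (i4.const_mul 2)) (((3/4)^m)^2)
  rw [integral_add (i1'.const_mul 2) (i4.const_mul 2), integral_const_mul, integral_const_mul] at mk
  have fin : Q.real {p | ((3/4)^m)^2 ≤ 2 * (F.W hT T p.1)^2 + 2 * (G p)^2} ≤ (9 * R^2 + R) * (4/9)^m := by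
    have e1 : ((3/4:ℝ)^m)^2 * ((9 * R^2 + R) * (4/9)^m) = (9 * R^2 + R) * (1/4)^m := by
      rw [← pow_mul, mul_comm m 2, pow_mul, mul_left_comm, ← mul_pow]; norm_num
    refine le_of_mul_le_mul_left (mk.trans ?_) (show (0:ℝ) < ((3/4)^m)^2 by positivity)
    rw [e1]
    have e2 : (2 * (1/2:ℝ)^m)^2 = 4 * (1/4)^m := by
      rw [mul_pow, ← pow_mul, mul_comm m 2, pow_mul]; norm_num
    rw [e2] at i2
    have e3 : ((1/4:ℝ)^m)^2 ≤ (1/4)^m := by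
      rw [pow_two]; exact mul_le_of_le_one_left (by positivity) (pow_le_one₀ (by norm_num) (by norm_num))
    have e4 := mul_le_mul_of_nonneg_right e3 (sq_nonneg R)
    linarith
  calc _ ≤ Q {p | ((3/4)^m)^2 ≤ 2 * (F.W hT T p.1)^2 + 2 * (G p)^2} := measure_mono_ae ?_
    _ = _ := (ofReal_measureReal).symm
    _ ≤ _ := ENNReal.ofReal_le_ofReal fin
  filter_upwards [ae_of_ae_map measurable_fst.aemeasurable hN1] with p h1 h
  change (3/4:ℝ)^m ≤ |Sm T hT m t p.1 - SSbarProc T hT t p| at h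
  change ((3/4)^m)^2 ≤ 2 * (F.W hT T p.1)^2 + 2 * (G p)^2
  have e : F.W hT T p.1 - G p = Sm T hT m t p.1 - SSbarProc T hT t p := by
    rw [hF, hG, Fam.add_W, Fam.smul_W, famI_W hT m N _ _ _ _ _ (by simpa using hN) h1.1 h1.2, famG_W hT n N h0 ht h1.1,
      Sm_zero, min_eq_right ht, max_eq_right h0]
    ring
  have h' := pow_le_pow_left₀ (by positivity) h 2
  rw [sq_abs, ← e] at h'
  nlinarith [sq_nonneg (F.W hT T p.1 + G p)]

theorem bc {α : Type*} [MeasurableSpace α] {μ : Measure α} {P : ℕ → α → Prop} {C : ℝ}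
    (h : ∀ m, μ {x | P m x} ≤ ENNReal.ofReal (C * (4/9)^m)) : ∀ᵐ x ∂μ, ∀ᶠ m in atTop, ¬ P m x := by
  have hs : Summable fun m : ℕ => |C| * (4/9:ℝ)^m := (summable_geometric_of_lt_one (by norm_num) (by norm_num)).mul_left _
  have := measure_setOfPred_frequently_eq_zero (μ := μ) (p := P) ?_
  · rw [ae_iff]
    simpa [Filter.Frequently] using this
  · refine ne_top_of_le_ne_top (ENNReal.ofReal_ne_top (r := ∑' m : ℕ, |C| * (4/9:ℝ)^m)) ?_
    rw [ENNReal.ofReal_tsum_of_nonneg (fun m => by positivity) hs]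
    refine ENNReal.tsum_le_tsum fun m => (h m).trans (ENNReal.ofReal_le_ofReal ?_)
    gcongr; exact le_abs_self C

theorem unif_det {ω : Path T} {G : ℝ → ℝ} (hG : Continuous fun t : Icc (0:ℝ) T => G t)
    (ha : ∀ᶠ m in atTop, ∀ t ∈ Icc 0 T, |Sm T hT m t ω - Sm T hT (m+1) t ω| < (3/4)^m)
    {s : ℕ → Icc (0:ℝ) T} (hs : DenseRange s) (hb : ∀ i, Tendsto (fun m => Sm T hT m (s i) ω) atTop (𝓝 (G (s i)))) :
    TendstoUniformly (fun m (t : Icc (0:ℝ) T) => Sm T hT m (t : ℝ) ω) (fun t => G t) atTop := by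
  obtain ⟨M, hM⟩ := eventually_atTop.1 ha
  have h1 : ∀ m ≥ M, ∀ t ∈ Icc 0 T, ∀ k, |Sm T hT m t ω - Sm T hT (m+k) t ω| ≤ 4 * (3/4)^m - 4 * (3/4)^(m+k) := by
    intro m hm t ht k
    induction k with
    | zero => simp
    | succ k ih =>
      have := hM (m+k) (by omega) t ht
      rw [← add_assoc, pow_succ]
      rw [abs_le] at ih ⊢
      rw [abs_lt] at this
      constructor <;> linarith [ih.1, ih.2, this.1, this.2]
  have h2 : ∀ m ≥ M, ∀ t : Icc (0:ℝ) T, |Sm T hT m t ω - G t| ≤ 4 * (3/4)^m := by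
    intro m hm t
    have hc : IsClosed {t : Icc (0:ℝ) T | |Sm T hT m t ω - G t| ≤ 4 * (3/4)^m} := by
      refine isClosed_le (Continuous.abs (Continuous.sub ?_ hG)) continuous_const
      exact (Sm_cont hT m ω).comp_continuous continuous_subtype_val fun t => t.2.2
    have : closure (range s) ⊆ {t : Icc (0:ℝ) T | |Sm T hT m t ω - G t| ≤ 4 * (3/4)^m} := by
      refine closure_minimal ?_ hc
      rintro _ ⟨i, rfl⟩
      have ht : Tendsto (fun k => |Sm T hT m (s i) ω - Sm T hT (m+k) (s i) ω|) atTop (𝓝 |Sm T hT m (s i) ω - G (s i)|) := by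
        refine (tendsto_const_nhds.sub ((hb i).comp ?_)).abs
        exact tendsto_atTop_mono (fun k => Nat.le_add_left k m) tendsto_id
      refine le_of_tendsto ht (Eventually.of_forall fun k => (h1 m hm _ (s i).2 k).trans ?_)
      have : (0:ℝ) ≤ (3/4)^(m+k) := by positivity
      linarith
    exact this (hs t)
  rw [Metric.tendstoUniformly_iff]
  intro ε hε
  have hz : Tendsto (fun m : ℕ => 4 * (3/4:ℝ)^m) atTop (𝓝 0) := by
    simpa using (tendsto_pow_atTop_nhds_zero_of_lt_one (r := (3/4:ℝ)) (by norm_num) (by norm_num)).const_mul 4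
  filter_upwards [eventually_ge_atTop M, hz.eventually (gt_mem_nhds hε)] with m hm hm2 t
  rw [dist_comm]
  exact (h2 m hm t).trans_lt hm2

theorem Dat.bigOmega (D : Dat hT Q R) : ∀ᵐ p ∂Q, p.1 ∈ BigOmega T hT ∧ qv T hT p.1 = p.2 := by
  have : Nonempty (Icc (0:ℝ) T) := ⟨t0 T hT⟩
  have h1 := ae_of_ae_map measurable_fst.aemeasurable (bc fun m => D.incr hT m)
  have h2 := ae_all_iff.2 fun i => bc fun m => D.conv hT m (TopologicalSpace.denseSeq (Icc (0:ℝ) T) i).2.1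
    (TopologicalSpace.denseSeq (Icc (0:ℝ) T) i).2.2
  filter_upwards [h1, h2, D.mono] with p g1 g2 g3
  have hz : Tendsto (fun m : ℕ => (3/4:ℝ)^m) atTop (𝓝 0) :=
    tendsto_pow_atTop_nhds_zero_of_lt_one (by norm_num) (by norm_num)
  have cc : ∀ ω : Path T, Continuous fun t : Icc (0:ℝ) T => ev T hT ω t := fun ω =>
    (continuous_ev hT ω).comp continuous_subtype_val
  have hu := unif_det hT (ω := p.1) (G := fun t => SSbarProc T hT t p)
    (((((cc p.1).pow 2).sub continuous_const).sub (cc p.2)).div_const 2)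
    (g1.mono fun m hm t ht => by
      by_contra hcon
      exact hm ⟨t, ht, not_lt.1 hcon⟩) (TopologicalSpace.denseRange_denseSeq _)
    (fun i => by
      rw [tendsto_iff_dist_tendsto_zero]
      refine squeeze_zero' (Eventually.of_forall fun _ => dist_nonneg) ?_ hz
      filter_upwards [g2 i] with m hm using (not_le.1 hm).le)
  have hSS : ∀ t ∈ Icc 0 T, SS T hT t p.1 = SSbarProc T hT t p := fun t ht => (hu.tendsto_at ⟨t, ht⟩).liminf_eq
  have hq : ∀ t ∈ Icc 0 T, qvRaw T hT p.1 t = ev T hT p.2 t := by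
    intro t ht; rw [qvRaw, hSS t ht, SSbarProc]; ring
  have hB : p.1 ∈ BigOmega T hT := by
    refine ⟨?_, fun u hu v hv huv => ?_⟩
    · convert hu using 2 with t; exact hSS t t.2
    · rw [hq u hu, hq v hv]; exact g3.2 u v huv
  refine ⟨hB, ?_⟩
  ext t
  rw [← ev_coe hT, ← ev_coe hT, qv_eq hT hB t.2, hq t t.2]

theorem Q_mem {Ξ : Set (Path T)} {Xibar : Set (PathPair T)} (hA : AssumptionA T hT Ξ Xibar)
    {K : Set (PathPair T)} (hK : IsCompact K) (hKX : K ⊆ Xibar) (Q : Measure (PathPair T)) [IsProbabilityMeasure Q]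
    (hQ : ∀ᵐ p ∂Q, p ∈ K) (tr : ∀ I, Trd hT I → ∫ p, I p ∂Q = 0) : Q.map Prod.fst ∈ MSet T hT Ξ := by
  obtain ⟨R, D⟩ := Dat.mk' hT hA hK hKX Q hQ tr
  have : IsProbabilityMeasure (Q.map Prod.fst) := Measure.isProbabilityMeasure_map measurable_fst.aemeasurable
  refine ⟨this, ⟨fun m _ => T + m, fun m t ht => ?_, Eventually.of_forall fun ω => ⟨?_, ?_⟩, fun m => ?_⟩, ?_⟩
  · exact MeasurableSet.const _
  · exact fun a b hab => by simpa using hab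
  · exact tendsto_atTop_add_const_left _ _ tendsto_natCast_atTop_atTop
  · obtain ⟨h1, h2⟩ := D.mart hT
    have e : ∀ t ∈ Icc 0 T, min (T + (m:ℝ)) t = t := fun t ht => min_eq_right (by
      have : (0:ℝ) ≤ m := Nat.cast_nonneg m
      linarith [ht.2])
    refine ⟨fun t ht => by simpa only [e t ht] using h1 t ht, fun s t hs ht hst A hA => ?_⟩
    simpa only [e t ht, e s hs] using h2 s t hs ht hst A hA
  · refine le_antisymm prob_le_one ?_
    refine le_trans ?_ (Measure.le_map_apply measurable_fst.aemeasurable Ξ)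
    have : ∀ᵐ p ∂Q, p ∈ Prod.fst ⁻¹' Ξ := by
      filter_upwards [D.bigOmega hT, hQ] with p hp hpK
      rw [mem_preimage, hA.xi_eq]
      refine ⟨hp.1, ?_⟩
      rw [hp.2]; exact hKX hpK
    rw [← measure_univ (μ := Q)]
    exact measure_mono_ae (this.mono fun p hp _ => hp)

end meas
end PathwiseSuperhedging

namespace PathwiseSuperhedging

theorem rmk {X : Type*} [TopologicalSpace X] [CompactSpace X] [T2Space X] [MeasurableSpace X] [BorelSpace X]
    (l : C(X, ℝ) →ₗ[ℝ] ℝ) (hp : ∀ f : C(X, ℝ), (∀ x, 0 ≤ f x) → 0 ≤ l f) (h1 : l 1 = 1) :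
    ∃ μ : Measure X, IsProbabilityMeasure μ ∧ ∀ f : C(X, ℝ), ∫ x, f x ∂μ = l f := by
  let L : CompactlySupportedContinuousMap X ℝ →ₗ[ℝ] ℝ :=
    { toFun := fun f => l f.toContinuousMap
      map_add' := fun f g => by rw [← map_add]; rfl
      map_smul' := fun r f => by rw [RingHom.id_apply, ← map_smul]; rfl }
  let Λ : CompactlySupportedContinuousMap X ℝ →ₚ[ℝ] ℝ := PositiveLinearMap.mk₀ L fun f hf => hp _ hf
  have key : ∀ f : C(X, ℝ), ∫ x, f x ∂(RealRMK.rieszMeasure Λ) = l f := fun f =>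
    RealRMK.integral_rieszMeasure Λ (CompactlySupportedContinuousMap.continuousMapEquiv f)
  refine ⟨RealRMK.rieszMeasure Λ, ?_, key⟩
  have := key 1
  rw [h1] at this
  simp only [ContinuousMap.one_apply, integral_const, smul_eq_mul, mul_one] at this
  refine ⟨?_⟩
  rw [Measure.real, ENNReal.toReal_eq_one_iff] at this
  exact this

theorem sepa {X : Type*} [TopologicalSpace X] [CompactSpace X] {V A : Set C(X, ℝ)} {lam : ℝ}
    (hV0 : (0 : C(X, ℝ)) ∈ V) (hVa : ∀ v ∈ V, ∀ w ∈ V, v + w ∈ V) (hVs : ∀ v ∈ V, ∀ r : ℝ, r • v ∈ V)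
    (hAo : IsOpen A) (hAc : Convex ℝ A) (hAn : A.Nonempty) (hAu : ∀ g ∈ A, ∀ h : C(X, ℝ), (∀ x, 0 ≤ h x) → g + h ∈ A)
    (hAV : ∀ v ∈ V, ∀ c < lam, c • (1 : C(X, ℝ)) + v ∉ A) :
    ∃ l : C(X, ℝ) →ₗ[ℝ] ℝ, (∀ f : C(X, ℝ), (∀ x, 0 ≤ f x) → 0 ≤ l f) ∧ l 1 = 1 ∧ (∀ v ∈ V, l v = 0) ∧
      ∀ g ∈ A, lam ≤ l g := by
  obtain ⟨f, u, hf, hu⟩ := geometric_hahn_banach_open (s := A) (t := {g | ∃ c < lam, ∃ v ∈ V, g = c • (1 : C(X, ℝ)) + v})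
    hAc hAo (by
      rintro _ ⟨c, hc, v, hv, rfl⟩ _ ⟨d, hd, w, hw, rfl⟩ a b ha hb hab
      refine ⟨a * c + b * d, ?_, a • v + b • w, hVa _ (hVs _ hv _) _ (hVs _ hw _), ?_⟩
      · rcases ha.eq_or_lt with rfl | ha
        · simp at hab; subst hab; simpa using hd
        · have := mul_lt_mul_of_pos_left hc ha
          have := mul_le_mul_of_nonneg_left hd.le hb
          have : lam = a*lam + b*lam := by rw [← add_mul, hab, one_mul]
          linarith
      · simp only [smul_add, add_smul, smul_smul]; abel) (by
      rw [Set.disjoint_left]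
      rintro _ ha ⟨c, hc, v, hv, rfl⟩
      exact hAV v hv c hc ha)
  obtain ⟨a, ha⟩ := hAn
  have hT : ∀ c < lam, ∀ v ∈ V, u ≤ c * f 1 + f v := by
    intro c hc v hv
    have := hu _ ⟨c, hc, v, hv, rfl⟩
    simpa using this
  have pos : ∀ h : C(X, ℝ), (∀ x, 0 ≤ h x) → f h ≤ 0 := by
    intro h hh
    by_contra hcon
    push Not at hcon
    obtain ⟨n, hn⟩ := exists_nat_gt ((u - f a) / f h)
    have := hf _ (hAu a ha ((n:ℝ) • h) fun x => by
      simpa using mul_nonneg (Nat.cast_nonneg n) (hh x))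
    rw [map_add, map_smul, smul_eq_mul] at this
    rw [div_lt_iff₀ hcon] at hn
    linarith
  have van : ∀ v ∈ V, f v = 0 := by
    have one : ∀ v ∈ V, 0 ≤ f v := by
      intro v hv
      by_contra hcon
      push Not at hcon
      obtain ⟨n, hn⟩ := exists_nat_gt (((lam - 1) * f 1 - u) / (- f v))
      have := hT (lam - 1) (by linarith) _ (hVs v hv n)
      rw [map_smul, smul_eq_mul] at this
      rw [div_lt_iff₀ (by linarith)] at hn
      linarith
    intro v hv
    have h2 := one _ (hVs v hv (-1))
    rw [map_smul, smul_eq_mul] at h2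
    linarith [one v hv]
  have neg : f 1 < 0 := by
    refine lt_of_le_of_ne (pos 1 fun x => by simp) fun h1 => ?_
    have z : ∀ g : C(X, ℝ), f g ≤ 0 → f g = 0 := by
      intro g hg
      have h2 := pos (‖g‖ • 1 - g) fun x => by
        have := (abs_le.1 (g.norm_coe_le_norm x)).2
        simpa using this
      rw [map_sub, map_smul, h1, smul_zero] at h2
      linarith
    have hfa : f a = 0 := by
      rcases le_total (f a) 0 with h | h
      · exact z a h
      · have := z (-a) (by rw [map_neg]; linarith)
        rw [map_neg] at this; linarith
    have h3 := hf a ha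
    have h4 := hT (lam - 1) (by linarith) 0 hV0
    rw [h1, map_zero] at h4
    linarith
  refine ⟨(f 1)⁻¹ • (f : C(X, ℝ) →ₗ[ℝ] ℝ), fun g hg => ?_, ?_, fun v hv => ?_, fun g hg => ?_⟩
  · simp only [LinearMap.smul_apply, ContinuousLinearMap.coe_coe, smul_eq_mul]
    exact mul_nonneg_of_nonpos_of_nonpos (inv_nonpos.2 neg.le) (pos g hg)
  · simp [neg.ne]
  · simp [van v hv]
  · simp only [LinearMap.smul_apply, ContinuousLinearMap.coe_coe, smul_eq_mul]
    refine le_of_forall_lt_imp_le_of_dense fun c hc => ?_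
    have h1 := hT c hc 0 hV0
    rw [map_zero, add_zero] at h1
    have h2 := hf g hg
    rw [inv_mul_eq_div, le_div_iff_of_neg neg]
    linarith

section main
variable {T : ℝ} (hT : 0 ≤ T)

theorem usc_approx {X Z : Type*} [MetricSpace X] [TopologicalSpace Z] [CompactSpace Z] [Nonempty Z]
    {e : Z → X} (he : Continuous e) {y : Z → ℝ} (hy : Continuous y) :
    ∃ h : ℕ → X → ℝ, (∀ n, Continuous (h n)) ∧ (∀ n z, y z ≤ h n (e z)) ∧ (∀ n x, 0 ≤ h n x) ∧
      (∀ x, Antitone fun n => h n x) ∧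
      ∀ x (r : ℝ), 0 < r → (∀ n, r ≤ h n x) → ∃ z, e z = x ∧ r ≤ y z := by
  let F : ℕ → X → Z → ℝ := fun n x z => max 0 (y z - n * dist x (e z))
  have cF : ∀ n, Continuous fun q : X × Z => F n q.1 q.2 := fun n =>
    continuous_const.max ((hy.comp continuous_snd).sub (continuous_const.mul
      (continuous_fst.dist (he.comp continuous_snd))))
  have cF2 : ∀ n x, Continuous (F n x) := fun n x => (cF n).comp (Continuous.prodMk_right x)
  have bd : ∀ n x, BddAbove (F n x '' univ) := fun n x => (isCompact_univ.image (cF2 n x)).bddAbove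
  have att : ∀ n x, ∃ z, sSup (F n x '' univ) = F n x z := fun n x => by
    obtain ⟨z, -, hz⟩ := isCompact_univ.exists_sSup_image_eq univ_nonempty (cF2 n x).continuousOn
    exact ⟨z, hz⟩
  have up : ∀ n x z, F n x z ≤ sSup (F n x '' univ) := fun n x z => le_csSup (bd n x) ⟨z, trivial, rfl⟩
  have anti : ∀ x z, Antitone fun n => F n x z := fun x z n m hnm => by
    have : (n:ℝ) ≤ m := by exact_mod_cast hnm
    exact max_le_max le_rfl (sub_le_sub_left (mul_le_mul_of_nonneg_right this dist_nonneg) _)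
  refine ⟨fun n x => sSup (F n x '' univ), fun n => ?_, fun n z => ?_, fun n x => ?_, fun x n m hnm => ?_, ?_⟩
  · exact isCompact_univ.continuous_sSup (cF n)
  · refine le_trans ?_ (up n (e z) z)
    simp [F]
  · obtain ⟨z, hz⟩ := att n x
    beta_reduce; rw [hz]; exact le_max_left _ _
  · obtain ⟨z, hz⟩ := att m x
    beta_reduce; rw [hz]
    exact (anti x z hnm).trans (up n x z)
  · intro x r hr hx
    have := IsCompact.nonempty_iInter_of_sequence_nonempty_isCompact_isClosed (fun n => {z | r ≤ F n x z})
      (fun n z hz => le_trans hz (anti x z n.le_succ)) (fun n => by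
        obtain ⟨z, hz⟩ := att n x
        exact ⟨z, by have := hx n; beta_reduce at this; rw [hz] at this; exact this⟩)
      (isClosed_le continuous_const (cF2 0 x)).isCompact (fun n => isClosed_le continuous_const (cF2 n x))
    obtain ⟨z, hz⟩ := this
    rw [mem_iInter] at hz
    have hz' : ∀ n : ℕ, r ≤ y z - n * dist x (e z) := fun n => by
      rcases le_max_iff.1 (show r ≤ max 0 (y z - n * dist x (e z)) from hz n) with h | h
      · linarith
      · exact h
    refine ⟨z, ?_, by simpa using hz' 0⟩
    by_contra hne
    have hd : 0 < dist x (e z) := dist_pos.2 (Ne.symm hne)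
    obtain ⟨n, hn⟩ := exists_nat_gt (y z / dist x (e z))
    rw [div_lt_iff₀ hd] at hn
    linarith [hz' n]

theorem compact_dual {Ξ : Set (Path T)} {Xibar : Set (PathPair T)} (hA : AssumptionA T hT Ξ Xibar)
    {K : Set (PathPair T)} (hK : IsCompact K) (hKX : K ⊆ Xibar) {ξ : Path T → ℝ≥0∞} (hξ : Measurable ξ)
    {Z : Type} [TopologicalSpace Z] [CompactSpace Z] [Nonempty Z] {e : Z → PathPair T} (he : Continuous e)
    (heK : ∀ z, e z ∈ K) {y : Z → ℝ} (hy : Continuous y) (hyξ : ∀ z, ENNReal.ofReal (y z) ≤ ξ (e z).1) {lam : ℝ}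
    (hno : ∀ I, Trd hT I → ∀ c < lam, ¬ ((∀ p ∈ K, 0 < c + I p) ∧ ∀ z, y z < c + I (e z))) :
    ∃ Q ∈ MSet T hT Ξ, ENNReal.ofReal lam ≤ ∫⁻ ω, ξ ω ∂Q := by
  have : CompactSpace K := isCompact_iff_compactSpace.1 hK
  let eK : C(Z, K) := ⟨fun z => ⟨e z, heK z⟩, he.subtype_mk _⟩
  let yC : C(Z, ℝ) := ⟨y, hy⟩
  let A : Set C(K, ℝ) := {g | (∀ x, 0 < g x) ∧ ∀ z, y z < g (eK z)}
  let V : Set C(K, ℝ) := {g | ∃ I, Trd hT I ∧ ∀ x : K, g x = I x}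
  obtain ⟨l, lp, l1, lV, lA⟩ := sepa (V := V) (A := A) (lam := lam)
    ⟨_, Trd.zero hT, fun x => rfl⟩
    (by
      rintro v ⟨I, hI, h1⟩ w ⟨J, hJ, h2⟩
      exact ⟨_, Trd.add hT hI hJ, fun x => by simp [h1, h2]⟩)
    (by
      rintro v ⟨I, hI, h1⟩ r
      exact ⟨_, Trd.smul hT r hI, fun x => by simp [h1]⟩)
    (by
      have o1 : IsOpen {g : C(K, ℝ) | MapsTo g univ (Ioi 0)} :=
        ContinuousMap.isOpen_setOfPred_mapsTo isCompact_univ isOpen_Ioi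
      have o2 : IsOpen {g : C(Z, ℝ) | MapsTo g univ (Ioi 0)} :=
        ContinuousMap.isOpen_setOfPred_mapsTo isCompact_univ isOpen_Ioi
      have cc : Continuous fun g : C(K, ℝ) => g.comp eK - yC :=
        (ContinuousMap.continuous_precomp eK).sub continuous_const
      have : A = {g : C(K, ℝ) | MapsTo g univ (Ioi 0)} ∩ (fun g : C(K, ℝ) => g.comp eK - yC) ⁻¹' {g : C(Z, ℝ) | MapsTo g univ (Ioi 0)} := by
        ext g
        simp [A, MapsTo, yC]
      rw [this]
      exact o1.inter (o2.preimage cc))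
    (by
      rintro g ⟨g1, g2⟩ h ⟨h1, h2⟩ a b ha hb hab
      have aux : ∀ c x y : ℝ, c < x → c < y → c < a * x + b * y := by
        intro c x y hx hy
        rcases ha.eq_or_lt with rfl | ha
        · simp at hab; subst hab; simpa using hy
        · have := mul_lt_mul_of_pos_left hx ha
          have := mul_le_mul_of_nonneg_left hy.le hb
          have : c = a * c + b * c := by rw [← add_mul, hab, one_mul]
          linarith
      exact ⟨fun x => by simpa using aux _ _ _ (g1 x) (h1 x), fun z => by simpa using aux _ _ _ (g2 z) (h2 z)⟩)
    (by
      refine ⟨(‖yC‖ + 1) • 1, fun x => ?_, fun z => ?_⟩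
      · simp; positivity
      · have := (abs_le.1 (yC.norm_coe_le_norm z)).2
        simp
        exact this.trans_lt (lt_add_one _))
    (by
      rintro g ⟨g1, g2⟩ h hh
      exact ⟨fun x => by simpa using add_pos_of_pos_of_nonneg (g1 x) (hh x),
        fun z => by
          have := hh (eK z)
          rw [ContinuousMap.add_apply]; linarith [g2 z]⟩)
    (by
      rintro v ⟨I, hI, hv⟩ c hc ⟨h1, h2⟩
      refine hno I hI c hc ⟨fun p hp => ?_, fun z => ?_⟩
      · simpa [hv] using h1 ⟨p, hp⟩
      · simpa [hv, eK] using h2 z)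
  obtain ⟨μ, hμ, hint⟩ := rmk l lp l1
  have hval : Measurable (Subtype.val : K → PathPair T) := measurable_subtype_coe
  have hQ : IsProbabilityMeasure (μ.map Subtype.val) := Measure.isProbabilityMeasure_map hval.aemeasurable
  refine ⟨(μ.map Subtype.val).map Prod.fst, Q_mem hT hA hK hKX _ ?_ fun I hI => ?_, ?_⟩
  · exact (ae_map_iff (p := fun p => p ∈ K) hval.aemeasurable hK.isClosed.measurableSet).2 (Eventually.of_forall fun x => x.2)
  · rw [integral_map hval.aemeasurable hI.1.measurable.aestronglyMeasurable]
    have := hint ⟨fun x : K => I x, hI.1.comp continuous_subtype_val⟩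
    rw [lV _ ⟨I, hI, fun x => rfl⟩] at this
    exact this
  · rw [lintegral_map hξ measurable_fst, lintegral_map (f := fun a : PathPair T => ξ a.1) (hξ.comp measurable_fst) hval]
    obtain ⟨h, hc, hyh, h0, hanti, hlim⟩ := usc_approx eK.continuous hy
    have hm : ∀ n, Measurable fun x => ENNReal.ofReal (h n x) := fun n => (hc n).measurable.ennreal_ofReal
    have hb : ∀ n, Integrable (h n) μ := fun n => by
      obtain ⟨C, hC⟩ := isCompact_univ.exists_bound_of_continuousOn (hc n).continuousOn
      exact intb (hc n).measurable (Eventually.of_forall fun x => hC x trivial)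
    have s1 : ∀ n : ℕ, ENNReal.ofReal lam ≤ ∫⁻ x, ENNReal.ofReal (h n x) ∂μ + ENNReal.ofReal (1/((n:ℝ)+1)) := by
      intro n
      have p1 : (0:ℝ) < 1/((n:ℝ)+1) := by positivity
      have := lA (⟨h n, hc n⟩ + (1/((n:ℝ)+1)) • 1) ⟨fun x => by
        simpa using add_pos_of_nonneg_of_pos (h0 n x) (by positivity), fun z => by
        have := hyh n z
        have p2 : (0:ℝ) < ((n:ℝ)+1)⁻¹ := by positivity
        simp; linarith⟩
      rw [map_add, map_smul, l1, ← hint] at this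
      rw [← ofReal_integral_eq_lintegral_ofReal (hb n) (Eventually.of_forall (h0 n)),
        ← ENNReal.ofReal_add (integral_nonneg (h0 n)) p1.le]
      refine ENNReal.ofReal_le_ofReal ?_
      simpa using this
    have anti2 : Antitone fun n => ∫⁻ x, ENNReal.ofReal (h n x) ∂μ := fun n m hnm =>
      lintegral_mono fun x => ENNReal.ofReal_le_ofReal (hanti x hnm)
    have s2 : ENNReal.ofReal lam ≤ ⨅ n, ∫⁻ x, ENNReal.ofReal (h n x) ∂μ := by
      have t1 := tendsto_atTop_iInf anti2
      have t2 : Tendsto (fun n : ℕ => ENNReal.ofReal (1/((n:ℝ)+1))) atTop (𝓝 0) := by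
        have := ENNReal.tendsto_ofReal tendsto_one_div_add_atTop_nhds_zero_nat
        simpa using this
      have t3 := t1.add t2
      rw [add_zero] at t3
      exact ge_of_tendsto' t3 s1
    refine s2.trans ?_
    rw [← lintegral_iInf hm (fun n m hnm x => ENNReal.ofReal_le_ofReal (hanti x hnm)) (by
      rw [← ofReal_integral_eq_lintegral_ofReal (hb 0) (Eventually.of_forall (h0 0))]
      exact ENNReal.ofReal_ne_top)]
    refine lintegral_mono fun x => ?_
    by_contra hcon
    push Not at hcon
    obtain ⟨r, hr1, hr2⟩ := ENNReal.lt_iff_exists_nnreal_btwn.1 hcon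
    have hr0 : (0:ℝ) < r := by
      have : (0:ℝ≥0∞) < r := lt_of_le_of_lt bot_le hr1
      exact_mod_cast this
    obtain ⟨z, hz1, hz2⟩ := hlim x r hr0 fun n => by
      have := hr2.le.trans (iInf_le _ n)
      rw [ENNReal.le_ofReal_iff_toReal_le ENNReal.coe_ne_top (h0 n x)] at this
      simpa using this
    have : (r:ℝ≥0∞) ≤ ENNReal.ofReal (y z) := by
      rw [← ENNReal.ofReal_coe_nnreal]; exact ENNReal.ofReal_le_ofReal hz2
    have h5 := this.trans (hyξ z)
    have h6 : e z = x := congrArg Subtype.val hz1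
    rw [h6] at h5
    exact absurd hr1 (not_lt.2 h5)

end main
end PathwiseSuperhedging

namespace PathwiseSuperhedging

section fin
variable {T : ℝ} (hT : 0 ≤ T)

theorem stopPath_joint : Continuous fun q : Path T × Icc (0:ℝ) T => stopPath T q.1 q.2 := by
  let γ : C(Icc (0:ℝ) T, C(Icc (0:ℝ) T, Icc (0:ℝ) T)) := ContinuousMap.curry
    ⟨fun q : Icc (0:ℝ) T × Icc (0:ℝ) T => (⟨min q.1.1 q.2.1, le_min q.1.2.1 q.2.2.1, (min_le_left _ _).trans q.1.2.2⟩ : Icc (0:ℝ) T),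
      ((continuous_subtype_val.comp continuous_fst).min (continuous_subtype_val.comp continuous_snd)).subtype_mk _⟩
  have : (fun q : Path T × Icc (0:ℝ) T => stopPath T q.1 q.2) = fun q => q.1.comp (γ q.2) := rfl
  rw [this]
  exact continuous_fst.compCM (γ.continuous.comp continuous_snd)

theorem stopPath_stopPath (ω : Path T) (t u : Icc (0:ℝ) T) : stopPath T (stopPath T ω t) u = stopPath T ω (min t u) := by
  ext s
  simp only [stopPath, ContinuousMap.coe_mk]
  congr 1
  ext1
  have : ((min t u : Icc (0:ℝ) T) : ℝ) = min t.1 u.1 := by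
    rcases le_total t u with h | h
    · rw [min_eq_left h, min_eq_left (show t.1 ≤ u.1 from h)]
    · rw [min_eq_right h, min_eq_right (show u.1 ≤ t.1 from h)]
  simp only [this, min_assoc]

theorem exhaust {Ξ : Set (Path T)} {Xibar : Set (PathPair T)} (hA : AssumptionA T hT Ξ Xibar) :
    ∃ K : ℕ → Set (PathPair T), (∀ n, IsCompact (K n)) ∧ Monotone K ∧ (⋃ n, K n) = Xibar ∧
      ∀ n, ∀ p ∈ K n, ∀ t, stopP hT p t ∈ K n := by
  obtain ⟨K, hK, hX⟩ := hA.A1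
  let g : PathPair T × Icc (0:ℝ) T → PathPair T := fun q => (stopPath T q.1.1 q.2, stopPath T q.1.2 q.2)
  have hg : Continuous g :=
    (stopPath_joint.comp ((continuous_fst.comp continuous_fst).prodMk continuous_snd)).prodMk
      (stopPath_joint.comp ((continuous_snd.comp continuous_fst).prodMk continuous_snd))
  refine ⟨fun n => g '' ((⋃ j ∈ Finset.range (n+1), K j) ×ˢ univ), fun n => ?_, fun n m hnm => ?_, ?_, ?_⟩
  · exact ((Finset.isCompact_biUnion _ fun j _ => hK j).prod isCompact_univ).image hg
  · refine image_mono (prod_mono ?_ subset_rfl)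
    refine iUnion₂_subset fun j hj => ?_
    refine subset_biUnion_of_mem (u := fun j => K j) (show j ∈ (Finset.range (m+1) : Set ℕ) from ?_)
    simp at hj ⊢; omega
  · refine subset_antisymm (iUnion_subset fun n => ?_) fun p hp => ?_
    · rintro _ ⟨⟨p, t⟩, ⟨hp, -⟩, rfl⟩
      refine hA.A3 p ?_ t
      rw [hX]
      obtain ⟨j, -, hj⟩ := mem_iUnion₂.1 hp
      exact mem_iUnion.2 ⟨j, hj⟩
    · rw [hX] at hp
      obtain ⟨n, hn⟩ := mem_iUnion.1 hp
      refine mem_iUnion.2 ⟨n, (p, clamp T hT T), ⟨mem_iUnion₂.2 ⟨n, by simp, hn⟩, trivial⟩, ?_⟩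
      exact stopP_top hT p
  · rintro n _ ⟨⟨p, t⟩, ⟨hp, -⟩, rfl⟩ u
    refine ⟨(p, min t (clamp T hT u)), ⟨hp, trivial⟩, ?_⟩
    simp only [g, stopP, stopPath_stopPath]

/-- hedgeable subsets -/
def Hd (Ξ : Set (Path T)) (lam : ℝ) (A : Set (PathPair T × ℝ)) : Prop :=
  ∃ Y, GG T hT Ξ lam Y ∧ ∀ ω ∈ Ξ, ∀ y : ℝ, (psiMap T hT ω, y) ∈ A → (y : EReal) ≤ Y ω

theorem Hd.mono {Ξ : Set (Path T)} {lam : ℝ} {A B : Set (PathPair T × ℝ)} (h : Hd hT Ξ lam B) (hAB : A ⊆ B) :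
    Hd hT Ξ lam A := by
  obtain ⟨Y, h1, h2⟩ := h
  exact ⟨Y, h1, fun ω hω y hy => h2 ω hω y (hAB hy)⟩

theorem Hd.union {Ξ : Set (Path T)} {lam : ℝ} {A : ℕ → Set (PathPair T × ℝ)} (h : ∀ n, Hd hT Ξ lam (A n))
    (hm : Monotone A) : Hd hT Ξ lam (⋃ n, A n) := by
  choose Y h1 h2 using h
  refine ⟨_, GG.lim Y h1, fun ω hω y hy => ?_⟩
  obtain ⟨n, hn⟩ := mem_iUnion.1 hy
  refine le_liminf_of_le (by isBoundedDefault) ?_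
  filter_upwards [eventually_ge_atTop n] with m hm'
  exact h2 m ω hω y (hm hm' hn)

theorem baire_compact (k : ℕ → ℕ) : IsCompact {x : ℕ → ℕ | ∀ i, x i ≤ k i} := by
  have := isCompact_univ_pi (s := fun i => Iic (k i)) fun i => (finite_Iic (k i)).isCompact
  convert this using 1
  ext x; simp [Pi.le_def]

theorem baire_nhd (k : ℕ → ℕ) {U : Set (ℕ → ℕ)} (hU : IsOpen U) (hL : ∀ x, (∀ i, x i ≤ k i) → x ∈ U) :
    ∃ j, ∀ x : ℕ → ℕ, (∀ i < j, x i ≤ k i) → x ∈ U := by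
  by_contra hcon
  push Not at hcon
  choose x hx hxU using hcon
  obtain ⟨a, ha, φ, hφ, hlim⟩ := (baire_compact k).tendsto_subseq (x := fun j i => min (x j i) (k i))
    (fun j i => min_le_right _ _)
  have : Tendsto (fun j => x (φ j)) atTop (𝓝 a) := by
    rw [tendsto_pi_nhds] at hlim ⊢
    intro i
    refine (hlim i).congr' ?_
    filter_upwards [eventually_gt_atTop i] with j hj
    exact min_eq_left (hx (φ j) i (hj.trans_le (hφ.id_le j)))
  have h1 := this.eventually (hU.mem_nhds (hL a ha))
  obtain ⟨j, hj⟩ := h1.exists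
  exact hxU _ hj

theorem choquet {Ξ : Set (Path T)} {lam : ℝ} {f : (ℕ → ℕ) → PathPair T × ℝ}
    (hnot : ¬ Hd hT Ξ lam (range f)) :
    ∃ k : ℕ → ℕ, ∀ j, ¬ Hd hT Ξ lam (f '' {x | ∀ i < j, x i ≤ k i}) := by
  have step : ∀ (j : ℕ) (C : Set (ℕ → ℕ)), ¬ Hd hT Ξ lam (f '' C) →
      ∃ n, ¬ Hd hT Ξ lam (f '' (C ∩ {x | x j ≤ n})) := by
    intro j C hC
    by_contra hcon
    push Not at hcon
    refine hC ((Hd.union hT hcon fun n m hnm => image_mono (inter_subset_inter_right _ fun x hx => le_trans hx hnm)).mono hT ?_)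
    rintro _ ⟨x, hx, rfl⟩
    exact mem_iUnion.2 ⟨x j, x, ⟨hx, le_refl (x j)⟩, rfl⟩
  choose n hn using step
  let Cs : ℕ → {C : Set (ℕ → ℕ) // ¬ Hd hT Ξ lam (f '' C)} := fun j =>
    Nat.rec ⟨univ, by rwa [image_univ]⟩ (fun j C => ⟨C.1 ∩ {x | x j ≤ n j C.1 C.2}, hn j C.1 C.2⟩) j
  refine ⟨fun j => n j (Cs j).1 (Cs j).2, fun j => ?_⟩
  have : {x : ℕ → ℕ | ∀ i < j, x i ≤ n i (Cs i).1 (Cs i).2} = (Cs j).1 := by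
    induction j with
    | zero => simp [Cs]
    | succ j ih =>
      have e : (Cs (j+1)).1 = (Cs j).1 ∩ {x | x j ≤ n j (Cs j).1 (Cs j).2} := rfl
      rw [e]
      ext x
      rw [mem_inter_iff, ← (Set.ext_iff.1 ih x)]
      simp only [mem_ofPred_eq, Nat.lt_succ_iff_lt_or_eq]
      constructor
      · exact fun h => ⟨fun i hi => h i (Or.inl hi), h j (Or.inr rfl)⟩
      · rintro ⟨h1, h2⟩ i (hi | rfl)
        · exact h1 i hi
        · exact h2
  rw [this]
  exact (Cs j).2

theorem hd_analytic {Ξ : Set (Path T)} {Xibar : Set (PathPair T)} (hA : AssumptionA T hT Ξ Xibar)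
    {K : Set (PathPair T)} (hK : IsCompact K) (hKX : K ⊆ Xibar) (hKs : ∀ p ∈ K, ∀ t, stopP hT p t ∈ K)
    {ξ : Path T → ℝ≥0∞} (hξ : Measurable ξ) {lam : ℝ} (hl : 0 < lam)
    (hlt : supMart T hT Ξ ξ < ENNReal.ofReal lam) {B : Set (PathPair T × ℝ)} (hB : AnalyticSet B)
    (hBK : ∀ q ∈ B, q.1 ∈ K ∧ ENNReal.ofReal q.2 ≤ ξ q.1.1) : Hd hT Ξ lam B := by
  rw [AnalyticSet] at hB
  rcases hB with rfl | ⟨f, hf, rfl⟩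
  · obtain ⟨Y, h1, -⟩ := hedge hT Ξ (K := ∅) (by simp) (Trd.zero hT) (c := 0) hl hl (by simp)
    exact ⟨Y, h1, by simp⟩
  by_contra hnot
  obtain ⟨k, hk⟩ := choquet hT hnot
  let L : Set (ℕ → ℕ) := {x | ∀ i, x i ≤ k i}
  have : CompactSpace L := isCompact_iff_compactSpace.1 (baire_compact k)
  have : Nonempty L := ⟨⟨k, fun i => le_rfl⟩⟩
  have c1 : Continuous fun x => (f x).1 := continuous_fst.comp hf
  have c2 : Continuous fun x => (f x).2 := continuous_snd.comp hf
  obtain ⟨Q, hQ, hQl⟩ := compact_dual hT hA hK hKX hξ (Z := L) (e := fun z => (f z).1) (y := fun z => (f z).2) (lam := lam)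
    (c1.comp continuous_subtype_val) (fun z => (hBK _ ⟨z, rfl⟩).1) (c2.comp continuous_subtype_val)
    (fun z => (hBK _ ⟨z, rfl⟩).2) (by
      rintro I hI c hc ⟨h1, h2⟩
      obtain ⟨j, hj⟩ := baire_nhd k (U := {x | (f x).2 < c + I (f x).1})
        (isOpen_lt c2 (continuous_const.add (hI.1.comp c1))) fun x hx => h2 ⟨x, hx⟩
      refine hk j ?_
      obtain ⟨Y, hY1, hY2⟩ := hedge hT Ξ hKs hI hl hc h1
      refine ⟨Y, hY1, ?_⟩
      rintro ω hω y ⟨x, hx, hxe⟩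
      have hω' : ω ∈ BigOmega T hT := by rw [hA.xi_eq] at hω; exact hω.1
      have h3 := hj x hx
      have h4 := (hBK _ ⟨x, rfl⟩).1
      simp only [mem_ofPred_eq, hxe] at h3 h4
      exact le_trans (EReal.coe_le_coe_iff.2 h3.le) (hY2 ω hω' h4))
  have : ∫⁻ ω, ξ ω ∂Q ≤ supMart T hT Ξ ξ := le_iSup₂ (f := fun Q (_ : Q ∈ MSet T hT Ξ) => ∫⁻ ω, ξ ω ∂Q) Q hQ
  exact absurd (hQl.trans this) (not_le.2 hlt)

theorem strong {Ξ : Set (Path T)} {Xibar : Set (PathPair T)} (hA : AssumptionA T hT Ξ Xibar)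
    {ξ : Path T → ℝ≥0∞} (hξ : Measurable ξ) {lam : ℝ} (hl : 0 < lam)
    (hlt : supMart T hT Ξ ξ < ENNReal.ofReal lam) : ∃ Y, GG T hT Ξ lam Y ∧ ∀ ω ∈ Ξ, (ξ ω : EReal) ≤ Y ω := by
  obtain ⟨K, hK, hKm, hKU, hKs⟩ := exhaust hT hA
  let B : ℕ → Set (PathPair T × ℝ) := fun n => {q | q.1 ∈ K n ∧ ENNReal.ofReal q.2 ≤ ξ q.1.1}
  have hB : ∀ n, Hd hT Ξ lam (B n) := fun n =>
    hd_analytic hT hA (hK n) (hKU ▸ subset_iUnion K n) (hKs n) hξ hl hlt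
      (MeasurableSet.analyticSet (((hK n).isClosed.measurableSet.preimage measurable_fst).inter
        (measurableSet_le measurable_snd.ennreal_ofReal (hξ.comp (measurable_fst.comp measurable_fst)))))
      fun q hq => hq
  obtain ⟨Y, h1, h2⟩ := Hd.union hT hB fun n m hnm q hq => ⟨hKm hnm hq.1, hq.2⟩
  refine ⟨Y, h1, fun ω hω => ?_⟩
  have hψ : psiMap T hT ω ∈ ⋃ n, K n := by rw [hKU]; rw [hA.xi_eq] at hω; exact hω.2
  obtain ⟨n, hn⟩ := mem_iUnion.1 hψ
  have key : ∀ y : ℝ, ENNReal.ofReal y ≤ ξ ω → (y : EReal) ≤ Y ω := fun y hy =>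
    h2 ω hω y (mem_iUnion.2 ⟨n, hn, hy⟩)
  refine le_of_forall_lt_imp_le_of_dense fun r hr => ?_
  obtain ⟨s, hs1, hs2⟩ := EReal.lt_iff_exists_real_btwn.1 hr
  refine hs1.le.trans (key s ?_)
  have := EReal.toENNReal_le_toENNReal hs2.le
  simpa using this

end fin

/-- **Theorem 2.9 (superhedging duality for Borel measurable claims, via the
liminf-closure `𝒢^Ξ_λ`).** -/
theorem superhedging_duality_liminf_closure (T : ℝ) (hT : 0 ≤ T)
    (Ξ : Set (Path T)) (Xibar : Set (PathPair T)) (hA : AssumptionA T hT Ξ Xibar)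
    (ξ : Path T → ℝ≥0∞) (hmeas : Measurable ξ) :
    PhiCl T hT Ξ (fun ω => (ξ ω : EReal)) = (supMart T hT Ξ ξ : EReal) := by
  refine le_antisymm ?_ (le_sInf ?_)
  · refine le_of_forall_gt_imp_ge_of_dense fun x hx => ?_
    obtain ⟨lam, h1, h2⟩ := EReal.lt_iff_exists_real_btwn.1 hx
    refine le_trans ?_ h2.le
    have hl : (0:ℝ) < lam := by
      have : (0:EReal) < lam := lt_of_le_of_lt (EReal.coe_ennreal_nonneg _) h1
      exact_mod_cast this
    have hlt : supMart T hT Ξ ξ < ENNReal.ofReal lam := by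
      rw [← EReal.coe_ennreal_lt_coe_ennreal_iff, EReal.coe_ennreal_ofReal, max_eq_left hl.le]
      exact h1
    exact sInf_le ⟨lam, rfl, strong hT hA hmeas hl hlt⟩
  · rintro _ ⟨lam, rfl, Y, hY, hle⟩
    exact weak_duality hT hA.xi_nonempty hmeas hY hle

end PathwiseSuperhedging
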